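/- arXiv:2306.09040 — 3 statements merged into one kernel-verified Lean document; each statement's English description precedes it below -/
import Mathlib

section
/- Let n ≥ 2 and let f : Fin n → Fin n be a uniformly random function (all n^n functions equally likely). Let k := ⌈2·√(n·ln n)⌉ and let A := range(f^[k]) be the image of the k-fold iterate of f. Then the expected size of A is at most (1+o(1))·√(2πn); precisely, there exists a sequence ε : ℕ → ℝ with ε(n) → 0 as n → ∞ such that for all n ≥ 2, E[|A|] ≤ (1+ε(n))·√(2πn). -/
open scoped BigOperators

theorem card_functions_prescribed_le {α ι : Type*} [Fintype α] [DecidableEq α] [Fintype ι]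
    (s t : ι → α) (hs : Function.Injective s) [Fintype {f : α → α // ∀ i, f (s i) = t i}] :
    Fintype.card {f : α → α // ∀ i, f (s i) = t i} ≤
      Fintype.card α ^ (Fintype.card α - Fintype.card ι) := by
  classical
  have hcard : Fintype.card {a // a ∉ Set.range s} = Fintype.card α - Fintype.card ι := by
    rw [Fintype.card_subtype_compl, Set.card_range_of_injective hs]
  rw [← hcard, ← Fintype.card_fun]
  refine Fintype.card_le_of_injective
    (fun f (a : {a // a ∉ Set.range s}) => f.1 a.1) fun f g hfg => ?_
  ext a
  by_cases ha : a ∈ Set.range s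
  · obtain ⟨i, rfl⟩ := ha
    rw [f.2, g.2]
  · exact congrFun hfg ⟨a, ha⟩

/-- Pairs `(f, x)` whose first `m + 1` iterates are distinct and satisfy `l` prescribed
transitions are at most as many as choices of an injective path and of the remaining values. -/
theorem card_orbit_pairs_le {α : Type*} [Fintype α] [DecidableEq α] {m l : ℕ}
    (u v : Fin l → Fin (m + 1)) (hu : Function.Injective u)
    (P : (α → α) → α → Prop) [∀ f x, Decidable (P f x)]
    (hinj : ∀ f x, P f x → Function.Injective fun i : Fin (m + 1) => f^[i] x)
    (hstep : ∀ f x, P f x → ∀ j, f (f^[u j] x) = f^[v j] x) :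
    ∑ f : α → α, (Finset.univ.filter (P f)).card ≤
      (Fintype.card α).descFactorial (m + 1) * Fintype.card α ^ (Fintype.card α - l) := by
  classical
  let T := Σ s : Fin (m + 1) ↪ α, {f : α → α // ∀ j, f (s (u j)) = s (v j)}
  have hT : Fintype.card T ≤
      (Fintype.card α).descFactorial (m + 1) * Fintype.card α ^ (Fintype.card α - l) := by
    rw [Fintype.card_sigma]
    calc _ ≤ ∑ _s : Fin (m + 1) ↪ α, Fintype.card α ^ (Fintype.card α - l) := by
          refine Finset.sum_le_sum fun s _ => ?_
          simpa using card_functions_prescribed_le (fun j => s (u j)) (fun j => s (v j))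
            (s.injective.comp hu)
      _ = _ := by simp [Fintype.card_embedding_eq]
  refine le_trans ?_ hT
  have hsum : ∑ f : α → α, (Finset.univ.filter (P f)).card =
      Fintype.card (Σ f : α → α, {x // P f x}) := by
    rw [Fintype.card_sigma]
    exact Finset.sum_congr rfl fun f _ => (Fintype.card_subtype _).symm
  rw [hsum]
  let F : (Σ f : α → α, {x // P f x}) → T := fun p =>
    ⟨⟨fun i => p.1^[i] p.2.1, hinj p.1 p.2.1 p.2.2⟩, p.1, hstep p.1 p.2.1 p.2.2⟩
  let G : T → (α → α) × α := fun q => (q.2.1, q.1 0)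
  have hGF : Function.Injective (G ∘ F) := by
    rintro ⟨f, x, hx⟩ ⟨g, y, hy⟩ h
    obtain ⟨h1, h2⟩ := Prod.mk.inj h
    have h3 : f = g := h1
    have h4 : x = y := h2
    subst h3 h4
    rfl
  exact Fintype.card_le_of_injective F hGF.of_comp

theorem card_minimalPeriod_pairs_le {α : Type*} [Fintype α] [DecidableEq α] (m : ℕ) :
    ∑ f : α → α, (Finset.univ.filter fun x => Function.minimalPeriod f x = m + 1).card ≤
      (Fintype.card α).descFactorial (m + 1) * Fintype.card α ^ (Fintype.card α - (m + 1)) := by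
  refine card_orbit_pairs_le (m := m) (l := m + 1) id (fun i => i + 1) Function.injective_id _
    (fun f x h i j hij => ?_) (fun f x h j => ?_)
  · refine Fin.ext (Function.iterate_injOn_Iio_minimalPeriod (f := f) (x := x) ?_ ?_ hij) <;>
      simp only [Set.mem_Iio, h, Fin.is_lt]
  · change f (f^[(j : ℕ)] x) = f^[((j + 1 : Fin (m + 1)) : ℕ)] x
    rw [← Function.iterate_succ_apply' f,
      ← Function.iterate_mod_minimalPeriod_eq (n := (j : ℕ).succ), h, Fin.val_add]
    simp

theorem card_injective_orbit_pairs_le {α : Type*} [Fintype α] [DecidableEq α] (k : ℕ)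
    [∀ (f : α → α) x, Decidable (Function.Injective fun i : Fin (k + 1) => f^[i] x)] :
    ∑ f : α → α,
        (Finset.univ.filter fun x => Function.Injective fun i : Fin (k + 1) => f^[i] x).card ≤
      (Fintype.card α).descFactorial (k + 1) * Fintype.card α ^ (Fintype.card α - k) := by
  refine card_orbit_pairs_le (m := k) (l := k) Fin.castSucc Fin.succ
    (Fin.castSucc_injective k) _ (fun f x h => h) (fun f x _ j => ?_)
  simp [← Function.iterate_succ_apply']

theorem mem_periodicPts_iterate_or_injective {α : Type*} (f : α → α) (k : ℕ) (x : α) :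
    f^[k] x ∈ Function.periodicPts f ∨ Function.Injective fun i : Fin (k + 1) => f^[i] x := by
  refine or_iff_not_imp_right.2 fun h => ?_
  obtain ⟨i, j, hij, hlt⟩ : ∃ i j : Fin (k + 1), f^[i] x = f^[j] x ∧ i < j := by
    simp only [Function.Injective, not_forall] at h
    obtain ⟨i, j, hij, hne⟩ := h
    rcases lt_or_gt_of_ne hne with h | h
    · exact ⟨i, j, hij, h⟩
    · exact ⟨j, i, hij.symm, h⟩
  have hlt' : (i : ℕ) < j := hlt
  have hp : Function.IsPeriodicPt f (j - i) (f^[i] x) := by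
    rw [Function.IsPeriodicPt, Function.IsFixedPt, ← Function.iterate_add_apply,
      Nat.sub_add_cancel hlt'.le, hij]
  have hk : f^[k] x = f^[k - i] (f^[i] x) := by
    rw [← Function.iterate_add_apply, Nat.sub_add_cancel (Nat.lt_succ_iff.1 i.2)]
  rw [hk]
  exact ⟨j - i, Nat.sub_pos_of_lt hlt', hp.apply_iterate _⟩

theorem card_image_iterate_le {α : Type*} [Fintype α] [DecidableEq α] (f : α → α) (k : ℕ)
    [∀ x, Decidable (Function.Injective fun i : Fin (k + 1) => f^[i] x)] :
    (Finset.univ.image f^[k]).card ≤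
      ∑ m ∈ Finset.range (Fintype.card α),
        (Finset.univ.filter fun x => Function.minimalPeriod f x = m + 1).card +
      (Finset.univ.filter fun x => Function.Injective fun i : Fin (k + 1) => f^[i] x).card := by
  have hsub : Finset.univ.image f^[k] ⊆
      ((Finset.range (Fintype.card α)).biUnion fun m =>
        Finset.univ.filter fun x => Function.minimalPeriod f x = m + 1) ∪
      (Finset.univ.filter fun x =>
        Function.Injective fun i : Fin (k + 1) => f^[i] x).image f^[k] := by
    intro y hy
    obtain ⟨x, -, rfl⟩ := Finset.mem_image.1 hy
    rcases mem_periodicPts_iterate_or_injective f k x with h | h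
    · have hpos := Function.minimalPeriod_pos_of_mem_periodicPts h
      have hle : Function.minimalPeriod f (f^[k] x) ≤ Fintype.card α := by
        have := Fintype.card_le_of_injective
          (fun i : Fin (Function.minimalPeriod f (f^[k] x)) => f^[i] (f^[k] x))
          (fun i j hij => Fin.ext (Function.iterate_injOn_Iio_minimalPeriod i.2 j.2 hij))
        simpa using this
      refine Finset.mem_union_left _ (Finset.mem_biUnion.2
        ⟨Function.minimalPeriod f (f^[k] x) - 1, Finset.mem_range.2 (by omega), ?_⟩)
      simp only [Finset.mem_filter, Finset.mem_univ, true_and]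
      omega
    · exact Finset.mem_union_right _ (Finset.mem_image_of_mem _ (by simpa using h))
  exact (Finset.card_le_card hsub).trans <| (Finset.card_union_le _ _).trans <|
    add_le_add Finset.card_biUnion_le Finset.card_image_le

theorem descFactorial_succ_le_pow_mul_exp {n : ℕ} (hn : 0 < n) (m : ℕ) :
    (n.descFactorial (m + 1) : ℝ) ≤ n ^ (m + 1) * Real.exp (-(1 / (2 * n)) * (m : ℝ) ^ 2) := by
  have hn' : (0 : ℝ) < n := by exact_mod_cast hn
  suffices h : (n.descFactorial (m + 1) : ℝ) ≤
      n ^ (m + 1) * Real.exp (-(m * (m + 1) / (2 * n))) by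
    refine h.trans (mul_le_mul_of_nonneg_left (Real.exp_le_exp.2 ?_) (by positivity))
    have : 0 ≤ (m : ℝ) / (2 * n) := by positivity
    have e : (m : ℝ) * (m + 1) / (2 * n) = 1 / (2 * n) * (m : ℝ) ^ 2 + m / (2 * n) := by ring
    linarith
  induction m with
  | zero => simp
  | succ m ih =>
    have hstep : ((n - (m + 1) : ℕ) : ℝ) ≤ n * Real.exp (-((m + 1) / n)) := by
      rcases le_total (m + 1) n with h | h
      · have h1 := mul_le_mul_of_nonneg_left (Real.add_one_le_exp (-(((m : ℝ) + 1) / n))) hn'.le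
        have h2 : (n : ℝ) * (-((m + 1) / n) + 1) = n - (m + 1) := by field_simp; ring
        push_cast [Nat.cast_sub h]
        linarith
      · rw [Nat.sub_eq_zero_of_le h, Nat.cast_zero]
        positivity
    rw [Nat.descFactorial_succ, Nat.cast_mul]
    calc _ ≤ (n * Real.exp (-((m + 1) / n))) *
          (n ^ (m + 1) * Real.exp (-(m * (m + 1) / (2 * n)))) := by gcongr
      _ = n ^ (m + 1 + 1) *
          (Real.exp (-((m + 1) / n)) * Real.exp (-(m * (m + 1) / (2 * n)))) := by ring
      _ = _ := by
        rw [← Real.exp_add]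
        congr 2
        push_cast
        field_simp
        ring

theorem sum_range_exp_neg_mul_sq_le {b : ℝ} (hb : 0 < b) (n : ℕ) :
    ∑ m ∈ Finset.range n, Real.exp (-b * (m : ℝ) ^ 2) ≤ 1 + Real.sqrt (Real.pi / b) / 2 := by
  rcases n with _ | n
  · simp; positivity
  rw [Finset.sum_range_succ', add_comm]
  refine add_le_add (by simp) ?_
  have hanti : AntitoneOn (fun x : ℝ => Real.exp (-b * x ^ 2)) (Set.Icc 0 (0 + n)) := by
    intro x hx y _ hxy
    have : x ^ 2 ≤ y ^ 2 := pow_le_pow_left₀ hx.1 hxy 2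
    exact Real.exp_le_exp.2 (by nlinarith)
  have h := hanti.sum_le_integral
  rw [← integral_gaussian_Ioi b]
  calc _ ≤ ∫ x in (0 : ℝ)..0 + n, Real.exp (-b * x ^ 2) := by simpa using h
    _ ≤ _ := by
      rw [intervalIntegral.integral_of_le (by positivity)]
      exact MeasureTheory.setIntegral_mono_set (integrable_exp_neg_mul_sq hb).integrableOn
        (Filter.Eventually.of_forall fun x => (Real.exp_pos _).le)
        Set.Ioc_subset_Ioi_self.eventuallyLE

theorem mul_exp_neg_sq_ceil_le_one {n : ℕ} (hn : 0 < n) :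
    (n : ℝ) * Real.exp (-(1 / (2 * n)) *
      (⌈2 * Real.sqrt (n * Real.log n)⌉₊ : ℝ) ^ 2) ≤ 1 := by
  have hn' : (1 : ℝ) ≤ n := by exact_mod_cast hn
  have hlog : 0 ≤ Real.log n := Real.log_nonneg hn'
  have hk : 4 * (n * Real.log n) ≤ (⌈2 * Real.sqrt (n * Real.log n)⌉₊ : ℝ) ^ 2 := by
    calc _ = (2 * Real.sqrt (n * Real.log n)) ^ 2 := by
          rw [mul_pow, Real.sq_sqrt (by positivity)]; norm_num
      _ ≤ _ := pow_le_pow_left₀ (by positivity) (Nat.le_ceil _) 2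
  have he : -(1 / (2 * n)) * (⌈2 * Real.sqrt (n * Real.log n)⌉₊ : ℝ) ^ 2 ≤ -Real.log n := by
    have h1 := mul_le_mul_of_nonneg_left hk (by positivity : (0 : ℝ) ≤ 1 / (2 * n))
    have h2 : 1 / (2 * n) * (4 * (n * Real.log n)) = 2 * Real.log n := by field_simp; norm_num
    linarith
  calc _ ≤ (n : ℝ) * Real.exp (-Real.log n) := by gcongr
    _ = 1 := by rw [Real.exp_neg, Real.exp_log (by positivity)]; field_simp

/-- The nonasymptotic form: the expected image size is at most `√(2πn)/2` (the expected number of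
periodic points, up to a constant) plus a constant. -/
theorem sum_card_image_iterate_le {n : ℕ} (hn : 0 < n) :
    ∑ f : Fin n → Fin n,
        ((Finset.univ.image (f^[⌈2 * Real.sqrt (n * Real.log n)⌉₊])).card : ℝ) ≤
      (2 + Real.sqrt (2 * Real.pi * n) / 2) * (n : ℝ) ^ n := by
  classical
  have hexp := mul_exp_neg_sq_ceil_le_one hn
  set k := ⌈2 * Real.sqrt (n * Real.log n)⌉₊
  have hn' : (0 : ℝ) < n := by exact_mod_cast hn
  have hcount : ∑ f : Fin n → Fin n, (Finset.univ.image f^[k]).card ≤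
      ∑ m ∈ Finset.range n, n.descFactorial (m + 1) * n ^ (n - (m + 1)) +
        n.descFactorial (k + 1) * n ^ (n - k) := by
    calc _ ≤ ∑ f : Fin n → Fin n, (∑ m ∈ Finset.range n,
            (Finset.univ.filter fun x => Function.minimalPeriod f x = m + 1).card +
          (Finset.univ.filter fun x =>
            Function.Injective fun i : Fin (k + 1) => f^[i] x).card) :=
          Finset.sum_le_sum fun f _ => by simpa using card_image_iterate_le f k
      _ ≤ _ := by
        rw [Finset.sum_add_distrib, Finset.sum_comm]
        exact add_le_add
          (Finset.sum_le_sum fun m _ => by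
            simpa using card_minimalPeriod_pairs_le (α := Fin n) m)
          (by simpa using card_injective_orbit_pairs_le (α := Fin n) k)
  have hperiodic : ∑ m ∈ Finset.range n, (n.descFactorial (m + 1) : ℝ) * n ^ (n - (m + 1)) ≤
      (1 + Real.sqrt (2 * Real.pi * n) / 2) * (n : ℝ) ^ n := by
    have hsum := sum_range_exp_neg_mul_sq_le (b := 1 / (2 * n)) (by positivity) n
    have hb : Real.pi / (1 / (2 * n)) = 2 * Real.pi * n := by field_simp
    rw [hb] at hsum
    refine le_trans ?_ (mul_le_mul_of_nonneg_right hsum (by positivity))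
    rw [Finset.sum_mul]
    refine Finset.sum_le_sum fun m hm => ?_
    have hm' : m + 1 ≤ n := Finset.mem_range.1 hm
    calc _ ≤ (n ^ (m + 1) * Real.exp (-(1 / (2 * n)) * (m : ℝ) ^ 2)) *
          (n : ℝ) ^ (n - (m + 1)) := by
          gcongr; exact descFactorial_succ_le_pow_mul_exp hn m
      _ = Real.exp (-(1 / (2 * n)) * (m : ℝ) ^ 2) *
          ((n : ℝ) ^ (m + 1) * (n : ℝ) ^ (n - (m + 1))) := by ring
      _ = _ := by rw [← pow_add, Nat.add_sub_cancel' hm']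
  have htail : (n.descFactorial (k + 1) : ℝ) * n ^ (n - k) ≤ 1 * (n : ℝ) ^ n := by
    rcases lt_or_ge n k with h | h
    · rw [Nat.descFactorial_of_lt (by omega)]
      simp
    calc _ ≤ (n ^ (k + 1) * Real.exp (-(1 / (2 * n)) * (k : ℝ) ^ 2)) * (n : ℝ) ^ (n - k) := by
          gcongr; exact descFactorial_succ_le_pow_mul_exp hn k
      _ = (n * Real.exp (-(1 / (2 * n)) * (k : ℝ) ^ 2)) *
          ((n : ℝ) ^ k * (n : ℝ) ^ (n - k)) := by ring
      _ = (n * Real.exp (-(1 / (2 * n)) * (k : ℝ) ^ 2)) * (n : ℝ) ^ n := by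
        rw [← pow_add, Nat.add_sub_cancel' h]
      _ ≤ _ := by gcongr
  have hcount' : ∑ f : Fin n → Fin n, ((Finset.univ.image f^[k]).card : ℝ) ≤
      ∑ m ∈ Finset.range n, (n.descFactorial (m + 1) : ℝ) * n ^ (n - (m + 1)) +
        n.descFactorial (k + 1) * n ^ (n - k) := by exact_mod_cast hcount
  linarith

/-- For a uniformly random function `f : Fin n → Fin n` and
`k = ⌈2√(n ln n)⌉`, the expected size of the image of `f^[k]` is at most
`(1 + o(1))·√(2πn)`. -/
theorem expected_image_iterate_le :
    ∃ ε : ℕ → ℝ, Filter.Tendsto ε Filter.atTop (nhds 0) ∧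
      ∀ n : ℕ, 2 ≤ n →
        (∑ f : Fin n → Fin n,
            ((Finset.univ.image
                (f^[⌈2 * Real.sqrt (n * Real.log n)⌉₊])).card : ℝ))
          / (n : ℝ) ^ n
        ≤ (1 + ε n) * Real.sqrt (2 * Real.pi * n) := by
  refine ⟨fun n => 2 / Real.sqrt (2 * Real.pi * n), ?_, fun n hn => ?_⟩
  · exact Filter.Tendsto.const_div_atTop (Real.tendsto_sqrt_atTop.comp
      (tendsto_natCast_atTop_atTop.const_mul_atTop (by positivity))) 2
  · have hn' : (0 : ℝ) < n := by exact_mod_cast (by omega : 0 < n)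
    have hsqrt : 0 < Real.sqrt (2 * Real.pi * n) := Real.sqrt_pos.2 (by positivity)
    have hε : (1 + 2 / Real.sqrt (2 * Real.pi * n)) * Real.sqrt (2 * Real.pi * n) =
        Real.sqrt (2 * Real.pi * n) + 2 := by field_simp
    rw [hε, div_le_iff₀ (by positivity)]
    refine (sum_card_image_iterate_le (by omega)).trans
      (mul_le_mul_of_nonneg_right (by linarith) (by positivity))
end

section
/- There exists a constant C > 0 such that for all n ≥ 2 the following holds. Let δ : Fin n × {a,b} → Fin n be a uniformly random transition function, and let ω be the word a^⌈√n⌉ (b a^⌈√n⌉)^⌈√(log₂ n)⌉, i.e., ⌈√(log₂ n)⌉ + 1 blocks of ⌈√n⌉ letters 'a' separated by single letters 'b'. Then the expected size of A := δ_ω(Fin n) satisfies E[|A|] ≤ C·√(n / ln n). -/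
open scoped BigOperators

/-- `run δ ω x` applies the transitions of the word `ω` (over the two-letter
alphabet `Bool`, with `false = 'a'` and `true = 'b'`) starting from state `x`,
i.e. `run δ ω = δ_ω = δ_{ω_k} ∘ ⋯ ∘ δ_{ω_1}`. -/
def run {n : ℕ} (δ : Fin n × Bool → Fin n) : List Bool → Fin n → Fin n
  | [], x => x
  | c :: w, x => run δ w (δ (x, c))


open Finset in
/-- Backward breadth-first exploration of the functional graph of `φ`. The frontier `B` is replaced
`k` times by its unexplored preimages, the explored sets satisfy `good`, and the last frontier
meets `V`. -/
def Survives {α : Type*} [Fintype α] [DecidableEq α] (good : Finset α → Prop) (V : Finset α)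
    (φ : α → α) : ℕ → Finset α → Finset α → Prop
  | 0, _, B => ∃ u ∈ B, u ∈ V
  | k + 1, E, B => good (E ∪ B) ∧ Survives good V φ k (E ∪ B) {u ∈ (E ∪ B)ᶜ | φ u ∈ B}

/-- Probability that a multitype Poisson branching process started at `u` has a descendant in `V`
in generation `k`, where `κ * μ u` is the rate at which `u` produces children of any given type. -/
noncomputable def survivalProb {α : Type*} [Fintype α] [DecidableEq α] (κ : ℝ) (μ : α → ℝ)
    (V : Finset α) : ℕ → α → ℝ
  | 0, u => if u ∈ V then 1 else 0
  | k + 1, u => 1 - Real.exp (-(κ * μ u * ∑ x, survivalProb κ μ V k x))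

section Exploration

variable {α : Type*} [Fintype α] [DecidableEq α]

lemma survivalProb_mem_Icc {κ : ℝ} {μ : α → ℝ} (hκ : 0 ≤ κ) (hμ : ∀ x, 0 ≤ μ x) (V : Finset α)
    (k : ℕ) (u : α) : survivalProb κ μ V k u ∈ Set.Icc (0 : ℝ) 1 := by
  induction k generalizing u with
  | zero => unfold survivalProb; split_ifs <;> simp
  | succ k ih =>
    have h : 0 ≤ κ * μ u * ∑ x, survivalProb κ μ V k x :=
      mul_nonneg (mul_nonneg hκ (hμ u)) (Finset.sum_nonneg fun x _ => (ih x).1)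
    have h1 : Real.exp (-(κ * μ u * ∑ x, survivalProb κ μ V k x)) ≤ 1 :=
      Real.exp_le_one_iff.2 (by linarith)
    have h2 := Real.exp_pos (-(κ * μ u * ∑ x, survivalProb κ μ V k x))
    rw [survivalProb]
    constructor <;> linarith

lemma mul_exp_neg_div_le {a p c : ℝ} (ha : 0 < a) (hp : 0 ≤ p) (hc0 : 0 ≤ c) (hc1 : c ≤ 1) :
    (p + a) * Real.exp (-(p * c / a)) ≤ p * (1 - c) + a := by
  have h1 : 0 ≤ p * c / a := by positivity
  have h2 : p * c / a + 1 ≤ Real.exp (p * c / a) := Real.add_one_le_exp _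
  rw [Real.exp_neg, ← div_eq_mul_inv, div_le_iff₀ (Real.exp_pos _)]
  have h3 : 0 ≤ p * (1 - c) + a := by nlinarith
  refine le_trans ?_ (mul_le_mul_of_nonneg_left h2 h3)
  have h4 : (p * (1 - c) + a) * (p * c / a + 1) = p + a + p * (1 - c) * (p * c / a) := by
    field_simp
    ring
  rw [h4]
  have : 0 ≤ p * (1 - c) * (p * c / a) := mul_nonneg (mul_nonneg hp (by linarith)) h1
  linarith

omit [Fintype α] [DecidableEq α] in
lemma pow_card_mul_exp_le_prod {U : Finset α} {a p r : ℝ} {c : α → ℝ} (ha : 0 ≤ a) (hp : 0 ≤ p)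
    (hc0 : ∀ u, 0 ≤ c u) (hc1 : ∀ u, c u ≤ 1) (hr : 0 ≤ r) (hU : ∑ u ∈ U, c u ≤ a * r) :
    (p + a) ^ U.card * Real.exp (-(p * r)) ≤ ∏ u ∈ U, (p * (1 - c u) + a) := by
  rcases ha.eq_or_lt with rfl | ha
  · have h0 : ∀ u ∈ U, c u = 0 := by
      refine (Finset.sum_eq_zero_iff_of_nonneg fun u _ => hc0 u).1 (le_antisymm ?_ ?_)
      · simpa using hU
      · exact Finset.sum_nonneg fun u _ => hc0 u
    rw [Finset.prod_congr rfl fun u hu => by rw [h0 u hu], Finset.prod_const]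
    have : Real.exp (-(p * r)) ≤ 1 := Real.exp_le_one_iff.2 (by nlinarith)
    calc _ ≤ (p + 0) ^ U.card * 1 := by gcongr
      _ = _ := by ring
  · calc (p + a) ^ U.card * Real.exp (-(p * r))
        ≤ (p + a) ^ U.card * Real.exp (∑ u ∈ U, -(p * c u / a)) := by
          gcongr
          rw [Finset.sum_neg_distrib, ← Finset.sum_div, ← Finset.mul_sum]
          gcongr
          rw [div_le_iff₀ ha]
          nlinarith
      _ = ∏ u ∈ U, (p + a) * Real.exp (-(p * c u / a)) := by
          rw [Real.exp_sum, Finset.prod_mul_distrib, Finset.prod_const]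
      _ ≤ _ := Finset.prod_le_prod (fun u _ => by positivity)
          fun u _ => mul_exp_neg_div_le ha hp (hc0 u) (hc1 u)

open Classical in
/-- The exploration of a random map with independent values of law `μ`, restricted to the product
set of the `C u`, dies out at least as fast as the Poisson branching process. -/
lemma sum_survives_le {κ : ℝ} {μ : α → ℝ} (hκ : 0 ≤ κ) (hμ : ∀ x, 0 ≤ μ x) {V : Finset α}
    {good : Finset α → Prop}
    (hgood : ∀ k E, good E → ∑ u ∈ Eᶜ, survivalProb κ μ V k u ≤
      (∑ x ∈ Eᶜ, μ x) * (κ * ∑ u, survivalProb κ μ V k u))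
    (k : ℕ) (E B : Finset α) (C : α → Finset α) (hEB : Disjoint E B)
    (hC : ∀ u ∉ E ∪ B, C u = Eᶜ) :
    ∑ φ ∈ Fintype.piFinset C with Survives good V φ k E B, ∏ x, μ (φ x) ≤
      (∏ u, ∑ x ∈ C u, μ x) * (1 - ∏ u ∈ B, (1 - survivalProb κ μ V k u)) := by
  induction k generalizing E B C with
  | zero =>
    by_cases hB : ∃ u ∈ B, u ∈ V
    · obtain ⟨u, huB, huV⟩ := hB
      rw [Finset.prod_eq_zero huB (by simp [survivalProb, huV]), Finset.prod_univ_sum]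
      simp only [sub_zero, mul_one]
      exact Finset.sum_le_sum_of_subset_of_nonneg (Finset.filter_subset _ _)
        fun φ _ _ => Finset.prod_nonneg fun x _ => hμ _
    · rw [Finset.filter_false_of_mem fun φ _ => by simpa [Survives] using hB, Finset.sum_empty]
      have : ∏ u ∈ B, (1 - survivalProb κ μ V 0 u) ≤ 1 :=
        Finset.prod_le_one (fun u _ => by linarith [(survivalProb_mem_Icc hκ hμ V 0 u).2])
          fun u _ => by linarith [(survivalProb_mem_Icc hκ hμ V 0 u).1]
      exact mul_nonneg (Finset.prod_nonneg fun u _ => Finset.sum_nonneg fun x _ => hμ x)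
        (by linarith)
  | succ k ih =>
    have hC0 : 0 ≤ ∏ u ∈ E ∪ B, ∑ x ∈ C u, μ x :=
      Finset.prod_nonneg fun u _ => Finset.sum_nonneg fun x _ => hμ x
    have hsplit (D : α → Finset α) : ∏ u, ∑ x ∈ D u, μ x =
        (∏ u ∈ E ∪ B, ∑ x ∈ D u, μ x) * ∏ u ∈ (E ∪ B)ᶜ, ∑ x ∈ D u, μ x :=
      (Finset.prod_mul_prod_compl _ _).symm
    have hprod1 : ∏ u ∈ B, (1 - survivalProb κ μ V (k + 1) u) ≤ 1 :=
      Finset.prod_le_one (fun u _ => by linarith [(survivalProb_mem_Icc hκ hμ V (k+1) u).2])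
        fun u _ => by linarith [(survivalProb_mem_Icc hκ hμ V (k+1) u).1]
    by_cases hg : good (E ∪ B)
    swap
    · rw [Finset.filter_false_of_mem fun φ _ h => hg h.1, Finset.sum_empty]
      exact mul_nonneg (Finset.prod_nonneg fun u _ => Finset.sum_nonneg fun x _ => hμ x)
        (by linarith)
    set U := (E ∪ B)ᶜ with hU
    set p := ∑ x ∈ B, μ x with hp
    set a := ∑ x ∈ U, μ x with ha
    have hp0 : 0 ≤ p := Finset.sum_nonneg fun x _ => hμ x
    have ha0 : 0 ≤ a := Finset.sum_nonneg fun x _ => hμ x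
    have hpa : ∑ x ∈ Eᶜ, μ x = p + a := by
      rw [hp, ha, ← Finset.sum_union]
      · congr 1
        ext x
        have : x ∈ E → x ∉ B := fun h => Finset.disjoint_left.1 hEB h
        simp only [hU, Finset.mem_compl, Finset.mem_union]
        tauto
      · rw [Finset.disjoint_left]
        intro x hx
        simp [hU, hx]
    let D (B' : Finset α) (u : α) : Finset α :=
      if u ∈ E ∪ B then C u else if u ∈ B' then B else U
    have hstep : ∀ B' ∈ U.powerset,
        ∑ φ ∈ Fintype.piFinset C with
            Survives good V φ (k + 1) E B ∧ {u ∈ U | φ u ∈ B} = B', ∏ x, μ (φ x) ≤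
          (∏ u ∈ E ∪ B, ∑ x ∈ C u, μ x) * ((p ^ B'.card * a ^ (U \ B').card) *
            (1 - ∏ u ∈ B', (1 - survivalProb κ μ V k u))) := by
      intro B' hB'
      rw [Finset.mem_powerset] at hB'
      have hdisj : Disjoint (E ∪ B) B' :=
        Finset.disjoint_left.2 fun x hx hx' => by
          have := hB' hx'
          rw [hU, Finset.mem_compl] at this
          exact this hx
      have key := ih (E ∪ B) B' (D B') hdisj fun u hu => by
        rw [Finset.mem_union, not_or] at hu
        simp only [D, if_neg hu.1, if_neg hu.2, hU]
      have hDprod : ∏ u, ∑ x ∈ D B' u, μ x =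
          (∏ u ∈ E ∪ B, ∑ x ∈ C u, μ x) * (p ^ B'.card * a ^ (U \ B').card) := by
        rw [hsplit, ← Finset.prod_sdiff hB',
          Finset.prod_congr rfl (g := fun u => ∑ x ∈ C u, μ x) fun u hu => by simp only [D, if_pos hu]]
        congr 1
        rw [mul_comm]
        congr 1
        · rw [Finset.prod_congr rfl (g := fun _ => p), Finset.prod_const]
          intro u hu
          have := hB' hu
          rw [hU, Finset.mem_compl] at this
          simp only [D, if_neg this, if_pos hu, hp]
        · rw [Finset.prod_congr rfl (g := fun _ => a), Finset.prod_const]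
          intro u hu
          rw [Finset.mem_sdiff, hU, Finset.mem_compl] at hu
          simp only [D, if_neg hu.1, if_neg hu.2, ha]
      rw [hDprod, mul_assoc] at key
      refine le_trans (Finset.sum_le_sum_of_subset_of_nonneg ?_
        fun φ _ _ => Finset.prod_nonneg fun x _ => hμ _) key
      intro φ hφ
      rw [Finset.mem_filter, Fintype.mem_piFinset] at hφ ⊢
      obtain ⟨h1, h2, h3⟩ := hφ
      refine ⟨fun u => ?_, ?_⟩
      · by_cases hu : u ∈ E ∪ B
        · simpa only [D, if_pos hu] using h1 u
        · have hu' : u ∈ U := by rw [hU, Finset.mem_compl]; exact hu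
          by_cases huB : u ∈ B'
          · simp only [D, if_neg hu, if_pos huB]
            rw [← h3] at huB
            exact (Finset.mem_filter.1 huB).2
          · simp only [D, if_neg hu, if_neg huB]
            have h4 := h1 u
            rw [hC u hu, Finset.mem_compl] at h4
            rw [← h3, Finset.mem_filter] at huB
            rw [hU, Finset.mem_compl, Finset.mem_union]
            tauto
      · have := h2.2
        rwa [← hU, h3] at this
    have hsum : ∑ φ ∈ Fintype.piFinset C with Survives good V φ (k + 1) E B, ∏ x, μ (φ x) =
        ∑ B' ∈ U.powerset, ∑ φ ∈ Fintype.piFinset C with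
            Survives good V φ (k + 1) E B ∧ {u ∈ U | φ u ∈ B} = B', ∏ x, μ (φ x) := by
      rw [← Finset.sum_fiberwise_of_maps_to (t := U.powerset) (g := fun φ => {u ∈ U | φ u ∈ B})
        fun φ _ => Finset.mem_powerset.2 (Finset.filter_subset _ _)]
      refine Finset.sum_congr rfl fun B' _ => ?_
      rw [Finset.filter_filter]
    have hE : ∏ u ∈ B, (1 - survivalProb κ μ V (k + 1) u) =
        Real.exp (-(p * (κ * ∑ u, survivalProb κ μ V k u))) := by
      simp only [survivalProb, sub_sub_cancel]
      rw [← Real.exp_sum, Finset.sum_neg_distrib, ← Finset.sum_mul, ← Finset.mul_sum]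
      congr 2
      ring
    have hCU : ∏ u ∈ U, ∑ x ∈ C u, μ x = (p + a) ^ U.card := by
      rw [Finset.prod_congr rfl (g := fun _ => p + a), Finset.prod_const]
      intro u hu
      rw [hC u (by rwa [hU, Finset.mem_compl] at hu), hpa]
    rw [hsum, hsplit, hCU, hE, mul_assoc]
    refine (Finset.sum_le_sum hstep).trans ?_
    rw [← Finset.mul_sum]
    refine mul_le_mul_of_nonneg_left ?_ hC0
    have hexp : ∑ B' ∈ U.powerset, (p ^ B'.card * a ^ (U \ B').card) *
        (1 - ∏ u ∈ B', (1 - survivalProb κ μ V k u)) =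
        (p + a) ^ U.card - ∏ u ∈ U, (p * (1 - survivalProb κ μ V k u) + a) := by
      rw [← Finset.prod_const, Finset.prod_add, Finset.prod_add, ← Finset.sum_sub_distrib]
      refine Finset.sum_congr rfl fun B' _ => ?_
      simp only [Finset.prod_mul_distrib, Finset.prod_const]
      ring
    rw [hexp]
    have := pow_card_mul_exp_le_prod (U := U) (c := survivalProb κ μ V k) ha0 hp0
      (fun u => (survivalProb_mem_Icc hκ hμ V k u).1)
      (fun u => (survivalProb_mem_Icc hκ hμ V k u).2)
      (mul_nonneg hκ (Finset.sum_nonneg fun u _ => (survivalProb_mem_Icc hκ hμ V k u).1))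
      (hgood k _ hg)
    linarith

/-- The states from which `φ` reaches `v` in fewer than `i` steps. -/
def basin (φ : α → α) (v : α) (i : ℕ) : Finset α := {u | ∃ j < i, φ^[j] u = v}

/-- The states from which `φ` reaches `v` for the first time after exactly `i` steps. -/
def hitting (φ : α → α) (v : α) (i : ℕ) : Finset α := {u | φ^[i] u = v ∧ ∀ j < i, φ^[j] u ≠ v}

lemma mem_basin {φ : α → α} {v u : α} {i : ℕ} : u ∈ basin φ v i ↔ ∃ j < i, φ^[j] u = v := by
  simp [basin]

lemma mem_hitting {φ : α → α} {v u : α} {i : ℕ} :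
    u ∈ hitting φ v i ↔ φ^[i] u = v ∧ ∀ j < i, φ^[j] u ≠ v := by
  simp [hitting]

lemma basin_union_hitting (φ : α → α) (v : α) (i : ℕ) :
    basin φ v i ∪ hitting φ v i = basin φ v (i + 1) := by
  ext u
  rw [Finset.mem_union, mem_basin, mem_basin, mem_hitting]
  constructor
  · rintro (⟨j, hj, h⟩ | ⟨h, -⟩)
    · exact ⟨j, by omega, h⟩
    · exact ⟨i, by omega, h⟩
  · rintro ⟨j, hj, h⟩
    by_cases hex : ∃ j < i, φ^[j] u = v
    · exact Or.inl hex
    · have hji : j = i := by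
        by_contra hne
        exact hex ⟨j, by omega, h⟩
      subst hji
      exact Or.inr ⟨h, fun j' hj' he => hex ⟨j', hj', he⟩⟩

lemma filter_mem_hitting (φ : α → α) (v : α) (i : ℕ) :
    ({u ∈ (basin φ v (i + 1))ᶜ | φ u ∈ hitting φ v i} : Finset α) = hitting φ v (i + 1) := by
  ext u
  simp only [Finset.mem_filter, Finset.mem_compl, mem_basin, mem_hitting,
    ← Function.iterate_succ_apply]
  constructor
  · rintro ⟨h1, h2, -⟩
    exact ⟨h2, fun j hj he => h1 ⟨j, hj, he⟩⟩
  · rintro ⟨h1, h2⟩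
    refine ⟨?_, h1, fun j hj => h2 _ (by omega)⟩
    rintro ⟨j, hj, he⟩
    exact h2 j hj he

lemma survives_basin {good : Finset α → Prop} {V : Finset α} {φ : α → α} {v : α} {k i : ℕ}
    (hgood : ∀ j < i + k, good (basin φ v (j + 1))) {u : α} (hu : u ∈ hitting φ v (i + k))
    (huV : u ∈ V) : Survives good V φ k (basin φ v i) (hitting φ v i) := by
  induction k generalizing i with
  | zero => exact ⟨u, hu, huV⟩
  | succ k ih =>
    rw [Survives, basin_union_hitting, filter_mem_hitting]
    refine ⟨hgood i (by omega), ih (fun j hj => hgood j (by omega)) ?_⟩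
    rwa [show i + 1 + k = i + (k + 1) by ring]

lemma survives_singleton {good : Finset α → Prop} {V : Finset α} {φ : α → α} {v : α} {k : ℕ}
    (hgood : ∀ j < k, good (basin φ v (j + 1))) {u : α} (hu : u ∈ hitting φ v k) (huV : u ∈ V) :
    Survives good V φ k ∅ {v} := by
  have h := survives_basin (i := 0) (k := k) (by simpa using hgood) (by simpa using hu) huV
  convert h using 1
  · ext; simp [mem_basin]
  · ext; simp [mem_hitting]

lemma exists_mem_hitting {φ : α → α} {v u : α} {t : ℕ} (h : φ^[t] u = v) :
    ∃ i ≤ t, u ∈ hitting φ v i := by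
  classical
  have hex : ∃ i, φ^[i] u = v := ⟨t, h⟩
  exact ⟨Nat.find hex, Nat.find_min' hex h,
    mem_hitting.2 ⟨Nat.find_spec hex, fun j hj => Nat.find_min hex hj⟩⟩

lemma mem_hitting_or_exists_return {φ : α → α} {v u : α} {t : ℕ} (h : φ^[t] u = v) :
    u ∈ hitting φ v t ∨ ∃ j < t, φ v ∈ hitting φ v j := by
  obtain ⟨i, hi, hu⟩ := exists_mem_hitting h
  rcases hi.eq_or_lt with rfl | hi
  · exact Or.inl hu
  · right
    have h1 : φ^[t - i - 1] (φ v) = v := by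
      rw [← Function.iterate_succ_apply, ← (mem_hitting.1 hu).1, ← Function.iterate_add_apply,
        show (t - i - 1).succ + i = t by omega, h]
      exact (mem_hitting.1 hu).1.symm
    obtain ⟨j, hj, hv⟩ := exists_mem_hitting h1
    exact ⟨j, by omega, hv⟩

omit [Fintype α] in
lemma iterate_update_of_forall_ne {φ : α → α} {v u : α} {i : ℕ} (y : α)
    (h : ∀ j < i, φ^[j] u ≠ v) : (Function.update φ v y)^[i] u = φ^[i] u := by
  induction i with
  | zero => rfl
  | succ i ih =>
    rw [Function.iterate_succ_apply', Function.iterate_succ_apply', ih fun j hj => h j (by omega),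
      Function.update_of_ne (h i (by omega))]

lemma hitting_update (φ : α → α) (v y : α) (i : ℕ) :
    hitting (Function.update φ v y) v i = hitting φ v i := by
  have key (ψ : α → α) (z : α) : hitting ψ v i ⊆ hitting (Function.update ψ v z) v i := by
    intro u hu
    rw [mem_hitting] at hu ⊢
    refine ⟨?_, fun j hj => ?_⟩
    · rw [iterate_update_of_forall_ne z hu.2, hu.1]
    · rw [iterate_update_of_forall_ne z fun j' hj' => hu.2 j' (by omega)]
      exact hu.2 j hj
  refine Finset.Subset.antisymm ?_ (key φ y)
  simpa using key (Function.update φ v y) (φ v)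

lemma sum_prod_apply_eq_one {μ : α → ℝ} (hμ1 : ∑ x, μ x = 1) :
    ∑ φ : α → α, ∏ x, μ (φ x) = 1 := by
  have := Finset.prod_univ_sum (fun _ : α => (Finset.univ : Finset α)) (fun _ x => μ x)
  rw [Fintype.piFinset_univ] at this
  rw [← this]
  simp [hμ1]

/-- The value at `v` of a random map with independent values of law `μ` can be replaced by an
independent sample. -/
lemma sum_prod_mul_apply_eq {μ : α → ℝ} (hμ1 : ∑ x, μ x = 1) (v : α) (G : α → (α → α) → ℝ)
    (hG : ∀ x φ y, G x (Function.update φ v y) = G x φ) :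
    ∑ φ : α → α, (∏ x, μ (φ x)) * G (φ v) φ =
      ∑ φ : α → α, (∏ x, μ (φ x)) * ∑ x, μ x * G x φ := by
  have h1 : ∑ φ : α → α, (∏ x, μ (φ x)) * G (φ v) φ =
      ∑ q : (α → α) × α, (∏ x, μ (q.1 x)) * μ q.2 * G (q.1 v) q.1 := by
    rw [Fintype.sum_prod_type]
    refine Finset.sum_congr rfl fun φ _ => ?_
    dsimp only
    rw [← Finset.sum_mul, ← Finset.mul_sum, hμ1, mul_one]
  have h2 : ∑ φ : α → α, (∏ x, μ (φ x)) * ∑ x, μ x * G x φ =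
      ∑ q : (α → α) × α, (∏ x, μ (q.1 x)) * μ q.2 * G q.2 q.1 := by
    rw [Fintype.sum_prod_type]
    refine Finset.sum_congr rfl fun φ _ => ?_
    rw [Finset.mul_sum]
    exact Finset.sum_congr rfl fun x _ => (mul_assoc _ _ _).symm
  have hinv : Function.Involutive
      fun q : (α → α) × α => (Function.update q.1 v q.2, q.1 v) := by
    rintro ⟨φ, x⟩
    simp
  rw [h1, h2]
  refine Fintype.sum_equiv hinv.toPerm _ _ ?_
  rintro ⟨φ, x⟩
  simp only [Function.Involutive.coe_toPerm, hG]
  congr 1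
  rw [← Finset.mul_prod_erase _ _ (Finset.mem_univ v), ← Finset.mul_prod_erase _ _ (Finset.mem_univ v),
    Function.update_self, Finset.prod_congr rfl (f := fun z => μ (Function.update φ v x z))
      (g := fun z => μ (φ z)) fun z hz => by rw [Function.update_of_ne (Finset.ne_of_mem_erase hz)]]
  ring

/-- The expected number of states lying on a cycle of length at most `t` is at most `t`. -/
lemma sum_prod_mul_card_return_le {μ : α → ℝ} (hμ : ∀ x, 0 ≤ μ x) (hμ1 : ∑ x, μ x = 1) (t : ℕ) :
    ∑ φ : α → α, (∏ x, μ (φ x)) *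
      (({v | ∃ j < t, φ v ∈ hitting φ v j} : Finset α).card : ℝ) ≤ t := by
  have hw (φ : α → α) : 0 ≤ ∏ x, μ (φ x) := Finset.prod_nonneg fun x _ => hμ _
  calc ∑ φ : α → α, (∏ x, μ (φ x)) *
        (({v | ∃ j < t, φ v ∈ hitting φ v j} : Finset α).card : ℝ)
      ≤ ∑ φ : α → α, (∏ x, μ (φ x)) *
        ∑ j ∈ Finset.range t, ∑ v, if φ v ∈ hitting φ v j then (1 : ℝ) else 0 := by
        gcongr with φ _
        · exact hw φ
        rw [Finset.sum_comm, Finset.card_filter, Nat.cast_sum]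
        gcongr with v _
        split_ifs with h
        · obtain ⟨j, hj, h⟩ := h
          calc ((1 : ℕ) : ℝ) = if φ v ∈ hitting φ v j then (1 : ℝ) else 0 := by simp [h]
            _ ≤ _ := Finset.single_le_sum
              (f := fun j => if φ v ∈ hitting φ v j then (1 : ℝ) else 0)
              (fun i _ => by positivity) (Finset.mem_range.2 hj)
        · rw [Nat.cast_zero]
          positivity
    _ = ∑ j ∈ Finset.range t, ∑ v, ∑ φ : α → α, (∏ x, μ (φ x)) *
          if φ v ∈ hitting φ v j then (1 : ℝ) else 0 := by
        simp_rw [Finset.mul_sum]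
        rw [Finset.sum_comm]
        exact Finset.sum_congr rfl fun j _ => Finset.sum_comm
    _ = ∑ j ∈ Finset.range t, ∑ v, ∑ φ : α → α, (∏ x, μ (φ x)) *
          ∑ x, μ x * if x ∈ hitting φ v j then (1 : ℝ) else 0 := by
        refine Finset.sum_congr rfl fun j _ => Finset.sum_congr rfl fun v _ => ?_
        exact sum_prod_mul_apply_eq hμ1 v (fun x φ => if x ∈ hitting φ v j then (1 : ℝ) else 0)
          fun x φ y => by simp only [hitting_update]
    _ = ∑ j ∈ Finset.range t, ∑ φ : α → α, (∏ x, μ (φ x)) *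
          ∑ x, μ x * ∑ v, if x ∈ hitting φ v j then (1 : ℝ) else 0 := by
        refine Finset.sum_congr rfl fun j _ => ?_
        rw [Finset.sum_comm]
        refine Finset.sum_congr rfl fun φ _ => ?_
        rw [← Finset.mul_sum, Finset.sum_comm]
        simp_rw [Finset.mul_sum]
    _ ≤ ∑ j ∈ Finset.range t, ∑ φ : α → α, (∏ x, μ (φ x)) * ∑ x, μ x * 1 := by
        gcongr with j _ φ _ x _
        · exact hw φ
        · exact hμ x
        calc _ ≤ ∑ v, if φ^[j] x = v then (1 : ℝ) else 0 := by
              gcongr with v _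
              simp only [mem_hitting]
              split_ifs with h1 h2 h2
              · exact le_rfl
              · exact absurd h1.1 h2
              · exact zero_le_one
              · exact le_rfl
          _ = 1 := by simp
    _ = t := by simp [hμ1, sum_prod_apply_eq_one hμ1]

open Classical in
lemma sum_prod_mul_card_image_iterate_le {κ : ℝ} {μ : α → ℝ} (hκ : 0 ≤ κ) (hμ : ∀ x, 0 ≤ μ x)
    (hμ1 : ∑ x, μ x = 1) {V : Finset α} {good : Finset α → Prop}
    (hgood : ∀ k E, good E → ∑ u ∈ Eᶜ, survivalProb κ μ V k u ≤
      (∑ x ∈ Eᶜ, μ x) * (κ * ∑ u, survivalProb κ μ V k u)) (t : ℕ) {b : ℝ}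
    (hb : ∀ φ : α → α,
      (({v | ∃ j < t, ¬ good (basin φ v (j + 1))} : Finset α).card : ℝ) ≤ b) :
    ∑ φ : α → α, (∏ x, μ (φ x)) * ((V.image φ^[t]).card : ℝ) ≤
      t + ∑ v, survivalProb κ μ V t v + b := by
  have hw (φ : α → α) : 0 ≤ ∏ x, μ (φ x) := Finset.prod_nonneg fun x _ => hμ _
  have hcard (φ : α → α) : ((V.image φ^[t]).card : ℝ) ≤
      (({v | ∃ j < t, φ v ∈ hitting φ v j} : Finset α).card : ℝ) +
      (({v | Survives good V φ t ∅ {v}} : Finset α).card : ℝ) + b := by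
    refine le_trans ?_ (add_le_add_right (hb φ) _)
    norm_cast
    refine le_trans (Finset.card_le_card ?_)
      ((Finset.card_union_le _ _).trans (Nat.add_le_add_right (Finset.card_union_le _ _) _))
    intro v hv
    obtain ⟨u, huV, hu⟩ := Finset.mem_image.1 hv
    simp only [Finset.mem_union, Finset.mem_filter, Finset.mem_univ, true_and]
    by_cases hbad : ∃ j < t, ¬ good (basin φ v (j + 1))
    · exact Or.inr hbad
    left
    rcases mem_hitting_or_exists_return hu with h | h
    · right
      exact survives_singleton (fun j hj => by_contra fun hn => hbad ⟨j, hj, hn⟩) h huV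
    · exact Or.inl h
  have hsurv : ∑ φ : α → α, (∏ x, μ (φ x)) *
      (({v | Survives good V φ t ∅ {v}} : Finset α).card : ℝ) ≤
      ∑ v, survivalProb κ μ V t v := by
    calc _ = ∑ v, ∑ φ : α → α with Survives good V φ t ∅ {v}, ∏ x, μ (φ x) := by
          simp_rw [Finset.card_filter, Nat.cast_sum, Finset.mul_sum]
          rw [Finset.sum_comm]
          refine Finset.sum_congr rfl fun v _ => ?_
          rw [Finset.sum_filter]
          refine Finset.sum_congr rfl fun φ _ => ?_
          split_ifs <;> simp
      _ ≤ _ := by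
          gcongr with v _
          have := sum_survives_le hκ hμ hgood t ∅ {v} (fun _ => Finset.univ) (by simp) (by simp)
          simpa [Fintype.piFinset_univ, hμ1] using this
  calc _ ≤ ∑ φ : α → α, (∏ x, μ (φ x)) *
        ((({v | ∃ j < t, φ v ∈ hitting φ v j} : Finset α).card : ℝ) +
        (({v | Survives good V φ t ∅ {v}} : Finset α).card : ℝ) + b) := by
        gcongr with φ _
        · exact hw φ
        · exact hcard φ
    _ ≤ _ := by
        simp_rw [mul_add, Finset.sum_add_distrib, ← Finset.sum_mul, sum_prod_apply_eq_one hμ1,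
          one_mul]
        gcongr
        convert sum_prod_mul_card_return_le hμ hμ1 t

lemma one_sub_exp_neg_le {x : ℝ} (hx : 0 ≤ x) : 1 - Real.exp (-x) ≤ 2 * x / (x + 2) := by
  rcases le_or_gt 2 x with h2 | h2
  · have h : 1 ≤ 2 * x / (x + 2) := by
      rw [le_div_iff₀ (by linarith)]
      linarith
    linarith [Real.exp_pos (-x)]
  · have hpos : 0 < 2 - x := by linarith
    have hy : 0 ≤ 2 * x / (2 - x) := by positivity
    have h := Real.le_log_one_add_of_nonneg hy
    have e1 : 2 * (2 * x / (2 - x)) / (2 * x / (2 - x) + 2) = x := by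
      field_simp
      ring
    have e2 : 1 + 2 * x / (2 - x) = (2 + x) / (2 - x) := by
      field_simp
      ring
    rw [e1, e2, Real.le_log_iff_exp_le (by positivity)] at h
    have h3 : (2 - x) / (2 + x) ≤ Real.exp (-x) := by
      rw [Real.exp_neg, ← inv_div]
      exact inv_anti₀ (Real.exp_pos _) h
    have e3 : 2 * x / (x + 2) = 1 - (2 - x) / (2 + x) := by
      field_simp
      ring
    linarith

lemma one_sub_exp_neg_le_tangent (z l : ℝ) :
    1 - Real.exp (-z) ≤ 1 - Real.exp (-l) + Real.exp (-l) * (z - l) := by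
  have h := Real.add_one_le_exp (l - z)
  have e : Real.exp (-z) = Real.exp (-l) * Real.exp (l - z) := by
    rw [← Real.exp_add]
    congr 1
    ring
  rw [e]
  nlinarith [Real.exp_pos (-l)]

lemma sum_survivalProb_le {κ : ℝ} {μ : α → ℝ} (hκ : 1 ≤ κ) (hμ : ∀ x, 0 ≤ μ x)
    (hμ1 : ∑ x, μ x = 1) {V : Finset α} (hV : ∀ u ∉ V, μ u = 0) (k : ℕ) :
    ∑ u, survivalProb κ μ V k u ≤ V.card * (2 * κ ^ k / (k + 2)) := by
  have hVne : V.Nonempty := by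
    by_contra h
    rw [Finset.not_nonempty_iff_eq_empty] at h
    subst h
    rw [Finset.sum_eq_zero fun x _ => hV x (Finset.notMem_empty x)] at hμ1
    exact zero_ne_one hμ1
  have hm : (0 : ℝ) < V.card := by exact_mod_cast hVne.card_pos
  have hμV : ∑ x ∈ V, μ x = 1 := by
    rw [← hμ1]
    exact Finset.sum_subset (Finset.subset_univ _) fun x _ hx => hV x hx
  induction k with
  | zero => simp [survivalProb]
  | succ k ih =>
    set Q := ∑ u, survivalProb κ μ V k u with hQ
    have hQ0 : 0 ≤ Q :=
      Finset.sum_nonneg fun u _ => (survivalProb_mem_Icc (by linarith) hμ V k u).1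
    set l := κ * Q / V.card with hl
    have hl0 : 0 ≤ l := by positivity
    have hκk : 1 ≤ κ ^ (k + 1) := one_le_pow₀ hκ
    have hlk : l ≤ 2 * κ ^ (k + 1) / (k + 2) := by
      rw [hl, div_le_iff₀ hm]
      calc κ * Q ≤ κ * (V.card * (2 * κ ^ k / (k + 2))) := by gcongr
        _ = _ := by ring
    calc ∑ u, survivalProb κ μ V (k + 1) u
        = ∑ u ∈ V, (1 - Real.exp (-(κ * μ u * Q))) := by
          symm
          refine Finset.sum_subset (Finset.subset_univ _) fun u _ hu => ?_
          simp [hV u hu]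
      _ ≤ ∑ u ∈ V, (1 - Real.exp (-l) + Real.exp (-l) * (κ * μ u * Q - l)) :=
          Finset.sum_le_sum fun u _ => one_sub_exp_neg_le_tangent _ _
      _ = V.card * (1 - Real.exp (-l)) := by
          have h : ∑ u ∈ V, (κ * μ u * Q - l) = 0 := by
            rw [Finset.sum_sub_distrib, ← Finset.sum_mul, ← Finset.mul_sum, hμV, Finset.sum_const,
              nsmul_eq_mul, mul_one, sub_eq_zero, hl]
            field_simp
          rw [Finset.sum_add_distrib, ← Finset.mul_sum, h, Finset.sum_const, nsmul_eq_mul]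
          ring
      _ ≤ V.card * (2 * l / (l + 2)) := by
          gcongr
          exact one_sub_exp_neg_le hl0
      _ ≤ V.card * (2 * κ ^ (k + 1) / ((k + 1 : ℕ) + 2)) := by
          refine mul_le_mul_of_nonneg_left ?_ hm.le
          rw [div_le_div_iff₀ (by positivity) (by positivity)]
          rw [le_div_iff₀ (by positivity)] at hlk
          push_cast
          nlinarith

lemma sum_card_image_iterate_le_s1 [Nonempty α] (s : ℕ) :
    ∑ f : α → α, ((Finset.univ.image f^[s]).card : ℝ) ≤
      (Fintype.card α : ℝ) ^ Fintype.card α * (s + 2 * Fintype.card α / (s + 2)) := by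
  set n := Fintype.card α with hn
  have hn0 : (0 : ℝ) < n := by exact_mod_cast Fintype.card_pos
  have hμ1 : ∑ _x : α, (n : ℝ)⁻¹ = 1 := by
    simp [← hn, hn0.ne']
  have h1 := sum_prod_mul_card_image_iterate_le (κ := 1) (μ := fun _ : α => (n : ℝ)⁻¹)
    (V := Finset.univ) (good := fun _ => True) zero_le_one (fun _ => by positivity) hμ1
    (fun k E _ => by
      obtain ⟨c, hc⟩ : ∃ c, ∀ u, survivalProb 1 (fun _ : α => (n : ℝ)⁻¹) Finset.univ k u = c := by
        cases k with
        | zero => exact ⟨1, fun u => by simp [survivalProb]⟩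
        | succ k => exact ⟨_, fun u => rfl⟩
      simp only [hc, Finset.sum_const, nsmul_eq_mul, Finset.card_univ, ← hn]
      field_simp
      exact le_rfl) s (b := 0) (fun φ => by simp)
  have h2 := sum_survivalProb_le (κ := 1) (μ := fun _ : α => (n : ℝ)⁻¹) (V := Finset.univ) le_rfl
    (fun _ => by positivity) hμ1 (by simp) s
  simp only [Finset.prod_const, Finset.card_univ, ← hn, ← Finset.mul_sum] at h1 h2
  have h3 : ((n : ℝ)⁻¹ ^ n) * ∑ f : α → α, ((Finset.univ.image f^[s]).card : ℝ) ≤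
      s + 2 * n / (s + 2) := by
    refine h1.trans ?_
    calc _ ≤ s + n * (2 * 1 ^ s / (s + 2)) + (0 : ℝ) := by gcongr
      _ = _ := by rw [one_pow]; ring
  rwa [inv_pow, inv_mul_le_iff₀ (by positivity)] at h3

lemma card_exists_basin_le {μ : α → ℝ} (hμ : ∀ x, 0 ≤ μ x) (hμ1 : ∑ x, μ x = 1) (φ : α → α)
    {t : ℕ} {S : Finset α}
    (hS : ∀ v ∈ S, ∃ j < t, 1 / ((t : ℝ) + 1) ≤ ∑ x ∈ basin φ v (j + 1), μ x) :
    (S.card : ℝ) ≤ t * (t + 1) := by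
  have h1 : ∑ v, ∑ x ∈ basin φ v t, μ x ≤ t := by
    calc ∑ v, ∑ x ∈ basin φ v t, μ x
        ≤ ∑ v, ∑ j ∈ Finset.range t, ∑ x, if φ^[j] x = v then μ x else 0 := by
          gcongr with v _
          rw [basin, Finset.sum_filter, Finset.sum_comm]
          gcongr with x _
          have hpos : ∀ j ∈ Finset.range t, 0 ≤ if φ^[j] x = v then μ x else 0 := fun j _ => by
            split_ifs
            · exact hμ x
            · exact le_rfl
          split_ifs with h
          · obtain ⟨j, hj, h⟩ := h
            calc μ x = if φ^[j] x = v then μ x else 0 := by simp [h]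
              _ ≤ _ := Finset.single_le_sum (f := fun j => if φ^[j] x = v then μ x else 0)
                hpos (Finset.mem_range.2 hj)
          · exact Finset.sum_nonneg hpos
      _ = ∑ j ∈ Finset.range t, ∑ x, ∑ v, if φ^[j] x = v then μ x else 0 := by
          rw [Finset.sum_comm]
          exact Finset.sum_congr rfl fun j _ => Finset.sum_comm
      _ = t := by simp [hμ1]
  have h2 : (S.card : ℝ) * (1 / (t + 1)) ≤ t := by
    calc (S.card : ℝ) * (1 / (t + 1)) = ∑ v ∈ S, 1 / ((t : ℝ) + 1) := by simp
      _ ≤ ∑ v ∈ S, ∑ x ∈ basin φ v t, μ x := by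
          refine Finset.sum_le_sum fun v hv => ?_
          obtain ⟨j, hj, h⟩ := hS v hv
          refine h.trans (Finset.sum_le_sum_of_subset_of_nonneg (fun x hx => ?_) fun x _ _ => hμ x)
          rw [mem_basin] at hx ⊢
          obtain ⟨i, hi, hx⟩ := hx
          exact ⟨i, by omega, hx⟩
      _ ≤ ∑ v, ∑ x ∈ basin φ v t, μ x :=
          Finset.sum_le_sum_of_subset_of_nonneg (Finset.subset_univ _)
            fun v _ _ => Finset.sum_nonneg fun x _ => hμ x
      _ ≤ t := h1
  rwa [mul_one_div, div_le_iff₀ (by positivity)] at h2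

lemma sum_prod_mul_card_image_iterate_le_of_support {μ : α → ℝ} (hμ : ∀ x, 0 ≤ μ x)
    (hμ1 : ∑ x, μ x = 1) {V : Finset α} (hV : ∀ u ∉ V, μ u = 0) {t : ℕ} (ht : 0 < t) :
    ∑ φ : α → α, (∏ x, μ (φ x)) * ((V.image φ^[t]).card : ℝ) ≤
      t + V.card * (2 * Real.exp 1 / (t + 2)) + t * (t + 1) := by
  have ht0 : (0 : ℝ) < t := by exact_mod_cast ht
  set κ : ℝ := 1 + 1 / t with hκ
  have hκ1 : 1 ≤ κ := by rw [hκ]; linarith [show (0 : ℝ) < 1 / t by positivity]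
  have hκt : κ ^ t ≤ Real.exp 1 := by
    calc κ ^ t ≤ Real.exp (1 / t) ^ t := by
          gcongr
          rw [hκ]
          linarith [Real.add_one_le_exp (1 / (t : ℝ))]
      _ = Real.exp 1 := by
          rw [← Real.exp_nat_mul, mul_one_div_cancel ht0.ne']
  refine (sum_prod_mul_card_image_iterate_le (κ := κ) (by linarith) hμ hμ1 (V := V)
    (good := fun E => ∑ x ∈ E, μ x < 1 / ((t : ℝ) + 1)) ?_ t (b := t * (t + 1)) ?_).trans ?_
  · intro k E hE
    have hpos (u : α) := (survivalProb_mem_Icc (κ := κ) (by linarith) hμ V k u).1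
    have hEc : 1 - 1 / ((t : ℝ) + 1) ≤ ∑ x ∈ Eᶜ, μ x := by
      have := Finset.sum_add_sum_compl E μ
      linarith
    have hκE : 1 ≤ (∑ x ∈ Eᶜ, μ x) * κ := by
      calc (1 : ℝ) = (1 - 1 / ((t : ℝ) + 1)) * κ := by
            rw [hκ]
            field_simp
            ring
        _ ≤ _ := by gcongr
    rw [← mul_assoc]
    calc ∑ u ∈ Eᶜ, survivalProb κ μ V k u ≤ ∑ u, survivalProb κ μ V k u :=
          Finset.sum_le_sum_of_subset_of_nonneg (Finset.subset_univ _) fun u _ _ => hpos u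
      _ ≤ _ := le_mul_of_one_le_left (Finset.sum_nonneg fun u _ => hpos u) hκE
  · intro φ
    refine card_exists_basin_le hμ hμ1 φ fun v hv => ?_
    simpa using hv
  · gcongr
    refine (sum_survivalProb_le hκ1 hμ hμ1 hV t).trans ?_
    gcongr

lemma sum_card_image_iterate_comp_le [Nonempty α] (h : α → α) {t : ℕ} (ht : 0 < t) :
    ∑ g : α → α, (((Finset.univ.image h).image (h ∘ g)^[t]).card : ℝ) ≤
      (Fintype.card α : ℝ) ^ Fintype.card α *
        (t + (Finset.univ.image h).card * (2 * Real.exp 1 / (t + 2)) + t * (t + 1)) := by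
  set n := Fintype.card α with hn
  have hn0 : (0 : ℝ) < n := by exact_mod_cast Fintype.card_pos
  set μ : α → ℝ := fun x => (({y | h y = x} : Finset α).card : ℝ) / n with hμ
  have hμ1 : ∑ x, μ x = 1 := by
    rw [hμ, ← Finset.sum_div, div_eq_one_iff_eq hn0.ne', ← Nat.cast_sum,
      ← Finset.card_eq_sum_card_fiberwise fun x _ => Finset.mem_univ _, Finset.card_univ]
  have hV : ∀ u ∉ Finset.univ.image h, μ u = 0 := by
    intro u hu
    have : ({y | h y = u} : Finset α) = ∅ :=
      Finset.filter_false_of_mem fun y _ hy => hu (Finset.mem_image.2 ⟨y, Finset.mem_univ _, hy⟩)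
    simp [hμ, this]
  have key := sum_prod_mul_card_image_iterate_le_of_support (fun x => by positivity) hμ1 hV ht
  have hpush : ∑ g : α → α, (((Finset.univ.image h).image (h ∘ g)^[t]).card : ℝ) =
      (n : ℝ) ^ n * ∑ φ : α → α, (∏ x, μ (φ x)) * (((Finset.univ.image h).image φ^[t]).card : ℝ) := by
    rw [← Finset.sum_fiberwise _ (fun g : α → α => h ∘ g), Finset.mul_sum]
    refine Finset.sum_congr rfl fun φ _ => ?_
    have hfib : ({g | h ∘ g = φ} : Finset (α → α)) =
        Fintype.piFinset fun x => ({y | h y = φ x} : Finset α) := by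
      ext g
      simp [funext_iff]
    rw [Finset.sum_congr rfl fun g hg => by rw [(Finset.mem_filter.1 hg).2], Finset.sum_const,
      hfib, Fintype.card_piFinset, nsmul_eq_mul, Finset.prod_div_distrib, Finset.prod_const,
      Finset.card_univ, ← hn, Nat.cast_prod, ← mul_assoc, mul_div_cancel₀ _ (by positivity)]
  rw [hpush]
  gcongr

end Exploration

lemma run_append {n : ℕ} (δ : Fin n × Bool → Fin n) (w₁ w₂ : List Bool) (x : Fin n) :
    run δ (w₁ ++ w₂) x = run δ w₂ (run δ w₁ x) := by
  induction w₁ generalizing x with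
  | nil => rfl
  | cons c w ih => exact ih _

lemma run_replicate {n : ℕ} (δ : Fin n × Bool → Fin n) (c : Bool) (s : ℕ) (x : Fin n) :
    run δ (List.replicate s c) x = (fun y => δ (y, c))^[s] x := by
  induction s generalizing x with
  | zero => rfl
  | succ s ih => rw [List.replicate_succ, run, ih, Function.iterate_succ_apply]

lemma run_flatten_replicate {n : ℕ} (δ : Fin n × Bool → Fin n) (w : List Bool) (t : ℕ) (x : Fin n) :
    run δ (List.replicate t w).flatten x = (run δ w)^[t] x := by
  induction t generalizing x with
  | zero => rfl
  | succ t ih =>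
    rw [List.replicate_succ, List.flatten_cons, run_append, ih, Function.iterate_succ_apply]

lemma image_run_block_word {n : ℕ} (δ : Fin n × Bool → Fin n) (s t : ℕ) :
    Finset.univ.image (run δ (List.replicate s false ++
      (List.replicate t (true :: List.replicate s false)).flatten)) =
    (Finset.univ.image (fun y => δ (y, false))^[s]).image
      ((fun y => δ (y, false))^[s] ∘ fun y => δ (y, true))^[t] := by
  rw [Finset.image_image]
  congr 1
  funext x
  rw [run_append, run_flatten_replicate, run_replicate]
  have : run δ (true :: List.replicate s false) =
      (fun y => δ (y, false))^[s] ∘ fun y => δ (y, true) := by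
    funext y
    rw [run, run_replicate, Function.comp_apply]
  rw [this, Function.comp_apply]

lemma sum_card_image_block_word_le {n : ℕ} [NeZero n] (s : ℕ) {t : ℕ} (ht : 0 < t) :
    (∑ δ : Fin n × Bool → Fin n,
      ((Finset.univ.image (run δ (List.replicate s false ++
        (List.replicate t (true :: List.replicate s false)).flatten))).card : ℝ))
        / (n : ℝ) ^ (2 * n) ≤
      (s + 2 * n / (s + 2)) * (2 * Real.exp 1 / (t + 2)) + t * (t + 2) := by
  have hn0 : (0 : ℝ) < n := by exact_mod_cast Nat.pos_of_ne_zero (NeZero.ne n)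
  let e : (Fin n × Bool → Fin n) ≃ (Fin n → Fin n) × (Fin n → Fin n) :=
    { toFun := fun δ => (fun y => δ (y, false), fun y => δ (y, true))
      invFun := fun q p => bif p.2 then q.2 p.1 else q.1 p.1
      left_inv := by
        intro δ
        funext ⟨x, c⟩
        cases c <;> rfl
      right_inv := fun q => rfl }
  have hsum : ∑ δ : Fin n × Bool → Fin n,
      ((Finset.univ.image (run δ (List.replicate s false ++
        (List.replicate t (true :: List.replicate s false)).flatten))).card : ℝ) =
      ∑ f : Fin n → Fin n, ∑ g : Fin n → Fin n,
        (((Finset.univ.image f^[s]).image (f^[s] ∘ g)^[t]).card : ℝ) := by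
    rw [← Fintype.sum_prod_type' (f := fun f g : Fin n → Fin n =>
      (((Finset.univ.image f^[s]).image (f^[s] ∘ g)^[t]).card : ℝ))]
    exact Fintype.sum_equiv e _ _ fun δ => by rw [image_run_block_word]; rfl
  have hf := sum_card_image_iterate_le_s1 (α := Fin n) s
  have hg (f : Fin n → Fin n) := sum_card_image_iterate_comp_le f^[s] ht
  simp only [Fintype.card_fin] at hf hg
  rw [div_le_iff₀ (by positivity), hsum]
  refine (Finset.sum_le_sum fun f _ => hg f).trans ?_
  rw [← Finset.mul_sum]
  simp only [Finset.sum_add_distrib, ← Finset.sum_mul]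
  simp only [Finset.sum_const, Finset.card_univ, Fintype.card_fun, Fintype.card_fin, nsmul_eq_mul,
    Nat.cast_pow]
  calc _ ≤ (n : ℝ) ^ n * ((n : ℝ) ^ n * t + (n : ℝ) ^ n * (s + 2 * n / (s + 2)) *
        (2 * Real.exp 1 / (t + 2)) + (n : ℝ) ^ n * t * (t + 1)) := by gcongr
    _ = _ := by rw [two_mul n, pow_add]; ring

lemma log_pow_three_le {x : ℝ} (hx : 0 < x) : Real.log x ^ 3 ≤ 27 * x := by
  have h : Real.log x / 3 ≤ Real.exp (Real.log x / 3) := by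
    linarith [Real.add_one_le_exp (Real.log x / 3)]
  have h3 : (Real.log x / 3) ^ 3 ≤ Real.exp (Real.log x / 3) ^ 3 :=
    (Odd.strictMono_pow (by decide : Odd 3)).monotone h
  rw [← Real.exp_nat_mul, show ((3 : ℕ) : ℝ) * (Real.log x / 3) = Real.log x by push_cast; ring,
    Real.exp_log hx] at h3
  nlinarith

/-- For a uniformly random transition function
`δ : Fin n × {a,b} → Fin n` and the word
`ω = a^⌈√n⌉ (b a^⌈√n⌉)^⌈√(log₂ n)⌉`, the expected size of `δ_ω(Fin n)` is
`O(√(n / ln n))`. -/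
theorem expected_image_word_le :
    ∃ C : ℝ, 0 < C ∧ ∀ n : ℕ, 2 ≤ n →
      (∑ δ : Fin n × Bool → Fin n,
          ((Finset.univ.image
              (run δ (List.replicate ⌈Real.sqrt n⌉₊ false ++
                (List.replicate ⌈Real.sqrt (Real.logb 2 n)⌉₊
                  (true :: List.replicate ⌈Real.sqrt n⌉₊ false)).flatten))).card : ℝ))
        / (n : ℝ) ^ (2 * n)
      ≤ C * Real.sqrt ((n : ℝ) / Real.log n) := by
  refine ⟨120, by norm_num, fun n hn => ?_⟩
  have : NeZero n := ⟨by omega⟩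
  have hn2 : (2 : ℝ) ≤ n := by exact_mod_cast hn
  have hn0 : (0 : ℝ) < n := by linarith
  have hL0 : 0 < Real.log n := Real.log_pos (by linarith)
  set L := Real.log n with hL
  set R := Real.sqrt n with hR
  have hR1 : 1 ≤ R := by
    rw [hR, Real.one_le_sqrt]
    linarith
  have hRR : R * R = n := Real.mul_self_sqrt hn0.le
  have hlogb : Real.logb 2 n = L / Real.log 2 := rfl
  have hlogb1 : 1 ≤ Real.logb 2 n := by
    rw [hlogb, le_div_iff₀ (Real.log_pos (by norm_num)), one_mul]
    exact Real.log_le_log (by norm_num) hn2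
  set T := Real.sqrt (Real.logb 2 n) with hT
  have hT1 : 1 ≤ T := by rwa [hT, Real.one_le_sqrt]
  have hTT : T * T = Real.logb 2 n := Real.mul_self_sqrt (by linarith)
  have ht : 0 < ⌈T⌉₊ := Nat.ceil_pos.2 (by linarith)
  refine (sum_card_image_block_word_le ⌈R⌉₊ ht).trans ?_
  have hs1 : R ≤ ⌈R⌉₊ := Nat.le_ceil R
  have hs2 : (⌈R⌉₊ : ℝ) ≤ 2 * R := by linarith [Nat.ceil_lt_add_one (show 0 ≤ R by linarith)]
  have ht1 : T ≤ ⌈T⌉₊ := Nat.le_ceil T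
  have ht2 : (⌈T⌉₊ : ℝ) ≤ 2 * T := by linarith [Nat.ceil_lt_add_one (show 0 ≤ T by linarith)]
  have hln2 : Real.log 2 ≤ 1 := by linarith [Real.log_two_lt_d9]
  have hln2' : (1 : ℝ) / 2 ≤ Real.log 2 := by linarith [Real.log_two_gt_d9]
  have hsL : 0 < Real.sqrt L := Real.sqrt_pos.2 hL0
  have hsLL : Real.sqrt L * Real.sqrt L = L := Real.mul_self_sqrt hL0.le
  have hTL : Real.sqrt L ≤ T := by
    refine Real.sqrt_le_sqrt ?_
    rw [hlogb, le_div_iff₀ (by linarith)]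
    nlinarith
  have hTL2 : T * T ≤ 2 * L := by
    rw [hTT, hlogb, div_le_iff₀ (by linarith)]
    nlinarith
  rw [Real.sqrt_div hn0.le, ← hR]
  have hmain : ((⌈R⌉₊ : ℝ) + 2 * n / (⌈R⌉₊ + 2)) * (2 * Real.exp 1 / (⌈T⌉₊ + 2)) ≤
      24 * (R / Real.sqrt L) := by
    have h1 : 2 * (n : ℝ) / (⌈R⌉₊ + 2) ≤ 2 * R := by
      rw [div_le_iff₀ (by positivity)]
      nlinarith
    have h2 : 2 * Real.exp 1 / (⌈T⌉₊ + 2) ≤ 6 / Real.sqrt L := by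
      gcongr
      · linarith [Real.exp_one_lt_d9]
      · linarith
    calc _ ≤ (2 * R + 2 * R) * (6 / Real.sqrt L) := by gcongr
      _ = _ := by ring
  have herr : (⌈T⌉₊ : ℝ) * (⌈T⌉₊ + 2) ≤ 90 * (R / Real.sqrt L) := by
    have h1 : (⌈T⌉₊ : ℝ) * (⌈T⌉₊ + 2) ≤ 8 * (T * T) := by nlinarith
    have h2 : L * Real.sqrt L ≤ 5.4 * R := by
      refine abs_le_of_sq_le_sq' (a := L * Real.sqrt L) ?_ (by positivity) |>.2
      have : (L * Real.sqrt L) ^ 2 = L ^ 3 := by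
        calc _ = L ^ 2 * (Real.sqrt L * Real.sqrt L) := by ring
          _ = _ := by rw [hsLL]; ring
      rw [this]
      nlinarith [log_pow_three_le hn0]
    rw [← mul_div_assoc, le_div_iff₀ hsL]
    nlinarith
  linarith [show 0 < R / Real.sqrt L by positivity]
end

section
/- Let δ : Fin n × {a,b} → Fin n be a uniformly random transition function. Then, with probability tending to 1 as n → ∞, for every pair of states x, y ∈ Fin n there exists a word ω ∈ {a,b}* of length at most 3·log₂ n such that δ_ω(x) = δ_ω(y). -/
open scoped BigOperators Classical

/-! ### Uniform probability on a finite type -/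

/-- The mean of `g` over a finite type. -/
noncomputable def ex {Ω : Type*} [Fintype Ω] (g : Ω → ℝ) : ℝ :=
  (∑ ω, g ω) / Fintype.card Ω

/-- The probability of `A` under the uniform distribution on a finite type. -/
noncomputable def pr {Ω : Type*} [Fintype Ω] (A : Ω → Prop) : ℝ :=
  ex (fun ω => if A ω then (1 : ℝ) else 0)

section Probability

variable {Ω : Type*} [Fintype Ω]

lemma ex_mono {g h : Ω → ℝ} (H : ∀ ω, g ω ≤ h ω) : ex g ≤ ex h := by
  unfold ex
  gcongr
  exact H _

lemma ex_sum {ι : Type*} (s : Finset ι) (g : ι → Ω → ℝ) :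
    ex (fun ω => ∑ i ∈ s, g i ω) = ∑ i ∈ s, ex (g i) := by
  unfold ex
  rw [Finset.sum_comm, Finset.sum_div]

lemma ex_add (g h : Ω → ℝ) : ex (fun ω => g ω + h ω) = ex g + ex h := by
  unfold ex
  rw [Finset.sum_add_distrib, add_div]

lemma ex_const_mul (c : ℝ) (g : Ω → ℝ) : ex (fun ω => c * g ω) = c * ex g := by
  unfold ex
  rw [← Finset.mul_sum, mul_div_assoc]

lemma ex_const [Nonempty Ω] (c : ℝ) : ex (fun _ : Ω => c) = c := by
  unfold ex
  have : (Fintype.card Ω : ℝ) ≠ 0 := by positivity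
  simp [this]

lemma ex_nonneg {g : Ω → ℝ} (H : ∀ ω, 0 ≤ g ω) : 0 ≤ ex g :=
  div_nonneg (Finset.sum_nonneg fun ω _ => H ω) (by positivity)

lemma pr_eq (A : Ω → Prop) :
    pr A = ((Finset.univ.filter A).card : ℝ) / Fintype.card Ω := by
  simp [pr, ex]

lemma ex_ite (A : Ω → Prop) [DecidablePred A] :
    ex (fun ω => if A ω then (1 : ℝ) else 0) = pr A := by
  unfold pr
  congr!

lemma pr_nonneg (A : Ω → Prop) : 0 ≤ pr A :=
  ex_nonneg fun ω => by split_ifs <;> norm_num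

lemma pr_mono {A B : Ω → Prop} (H : ∀ ω, A ω → B ω) : pr A ≤ pr B := by
  refine ex_mono fun ω => ?_
  by_cases h : A ω
  · simp [h, H ω h]
  · simp only [h, if_false]; split_ifs <;> norm_num

lemma pr_le_one (A : Ω → Prop) : pr A ≤ 1 := by
  rw [pr_eq]
  refine div_le_one_of_le₀ ?_ (by positivity)
  exact_mod_cast Finset.card_le_univ _

lemma pr_le_sum {ι : Type*} (s : Finset ι) {A : Ω → Prop} (B : ι → Ω → Prop)
    (H : ∀ ω, A ω → ∃ i ∈ s, B i ω) : pr A ≤ ∑ i ∈ s, pr (B i) := by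
  unfold pr
  rw [← ex_sum]
  refine ex_mono fun ω => ?_
  have hnn : ∀ i ∈ s, (0 : ℝ) ≤ if B i ω then 1 else 0 := fun i _ => by
    split_ifs <;> norm_num
  by_cases h : A ω
  · obtain ⟨i, hi, hB⟩ := H ω h
    simp only [h, if_true]
    calc (1 : ℝ) = if B i ω then 1 else 0 := by simp [hB]
      _ ≤ _ := Finset.single_le_sum (f := fun i => if B i ω then (1 : ℝ) else 0) hnn hi
  · simp only [h, if_false]
    exact Finset.sum_nonneg hnn

lemma pr_le_add {A B C : Ω → Prop} (H : ∀ ω, A ω → B ω ∨ C ω) : pr A ≤ pr B + pr C := by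
  unfold pr
  rw [← ex_add]
  refine ex_mono fun ω => ?_
  have := H ω
  by_cases h : A ω <;> by_cases h' : B ω <;> by_cases h'' : C ω <;> simp_all

lemma pr_compl_add [Nonempty Ω] (A : Ω → Prop) : pr A + pr (fun ω => ¬ A ω) = 1 := by
  have h1 := ex_const (Ω := Ω) (1 : ℝ)
  have h2 : (fun ω => (if A ω then (1 : ℝ) else 0) + if ¬ A ω then 1 else 0) = fun _ => 1 := by
    funext ω
    by_cases h : A ω <;> simp [h]
  rw [← h1, ← h2, ex_add]
  unfold pr
  congr!

lemma mul_pr_le_ex {A : Ω → Prop} {g : Ω → ℝ} {a : ℝ} (hg : ∀ ω, 0 ≤ g ω)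
    (H : ∀ ω, A ω → a ≤ g ω) : a * pr A ≤ ex g := by
  unfold pr
  rw [← ex_const_mul]
  refine ex_mono fun ω => ?_
  by_cases h : A ω
  · simp [h, H ω h]
  · simp [h, hg ω]

end Probability

/-! ### Resampling values of a random function at unexplored points -/

section Resampling

variable {α β ι : Type*} [Fintype α] [Fintype β] [Fintype ι] [DecidableEq α] [DecidableEq ι]

/-- If the points `e f` and the event `A` are not affected by changing the values of `f` at the
points `e f`, then conditionally on `A` these values are independent and uniform. -/
lemma pr_resample_family (A : (α → β) → Prop) (e : (α → β) → ι → α)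
    (B : (α → β) → (ι → β) → Prop) (k : ℝ)
    (hinj : ∀ f, A f → Function.Injective (e f))
    (hA : ∀ f v, A f → A (Function.extend (e f) v f) ∧
      e (Function.extend (e f) v f) = e f ∧
      B (Function.extend (e f) v f) = B f)
    (hk : ∀ f, A f → ((Finset.univ.filter (B f)).card : ℝ) ≤ k) :
    pr (fun f => A f ∧ B f (f ∘ e f)) * (Fintype.card β : ℝ) ^ Fintype.card ι ≤ k * pr A := by
  have key : (((Finset.univ : Finset (α → β)).filter fun f => A f ∧ B f (f ∘ e f)) ×ˢ
        (Finset.univ : Finset (ι → β))).card =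
      (((Finset.univ : Finset (α → β)).filter A).sigma
        (fun f => (Finset.univ : Finset (ι → β)).filter (B f))).card := by
    refine Finset.card_nbij'
      (fun x => ⟨Function.extend (e x.1) x.2 x.1, x.1 ∘ e x.1⟩)
      (fun x => (Function.extend (e x.1) x.2 x.1, x.1 ∘ e x.1)) ?_ ?_ ?_ ?_
    · rintro ⟨f, v⟩ h
      simp only [Finset.coe_product, Finset.coe_filter, Finset.mem_univ, true_and,
        Finset.coe_univ, Set.mem_prod, Set.mem_ofPred_eq, Set.mem_univ, and_true] at h
      obtain ⟨h1, h2, h3⟩ := hA f v h.1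
      simp [h1, h3, h.2]
    · rintro ⟨f, v⟩ h
      simp only [Finset.coe_sigma, Finset.coe_filter, Finset.mem_univ, true_and,
        Set.mem_sigma_iff, Set.mem_ofPred_eq] at h
      obtain ⟨h1, h2, h3⟩ := hA f v h.1
      have : Function.extend (e f) v f ∘ e f = v := by
        funext i; simp [(hinj f h.1).extend_apply]
      simp [h1, h2, h3, this, h.2]
    · rintro ⟨f, v⟩ h
      simp only [Finset.coe_product, Finset.coe_filter, Finset.mem_univ, true_and,
        Finset.coe_univ, Set.mem_prod, Set.mem_ofPred_eq, Set.mem_univ, and_true] at h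
      obtain ⟨h1, h2, h3⟩ := hA f v h.1
      have h4 : Function.extend (e f) v f ∘ e f = v := by
        funext i; simp [(hinj f h.1).extend_apply]
      have h5 : Function.extend (e f) (f ∘ e f) (Function.extend (e f) v f) = f := by
        funext a
        by_cases ha : ∃ i, e f i = a
        · obtain ⟨i, rfl⟩ := ha
          simp [(hinj f h.1).extend_apply]
        · rw [Function.extend_apply' _ _ _ ha, Function.extend_apply' _ _ _ ha]
      simp [h2, h4, h5]
    · rintro ⟨f, v⟩ h
      simp only [Finset.coe_sigma, Finset.coe_filter, Finset.mem_univ, true_and,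
        Set.mem_sigma_iff, Set.mem_ofPred_eq] at h
      obtain ⟨h1, h2, h3⟩ := hA f v h.1
      have h4 : Function.extend (e f) v f ∘ e f = v := by
        funext i; simp [(hinj f h.1).extend_apply]
      have h5 : Function.extend (e f) (f ∘ e f) (Function.extend (e f) v f) = f := by
        funext a
        by_cases ha : ∃ i, e f i = a
        · obtain ⟨i, rfl⟩ := ha
          simp [(hinj f h.1).extend_apply]
        · rw [Function.extend_apply' _ _ _ ha, Function.extend_apply' _ _ _ ha]
      simp [h2, h4, h5]
  rw [Finset.card_product, Finset.card_sigma, Finset.card_univ] at key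
  have key' : (((Finset.univ : Finset (α → β)).filter fun f => A f ∧ B f (f ∘ e f)).card : ℝ)
      * (Fintype.card β : ℝ) ^ Fintype.card ι ≤
      k * ((Finset.univ : Finset (α → β)).filter A).card := by
    have h1 : (((Finset.univ : Finset (α → β)).filter fun f => A f ∧ B f (f ∘ e f)).card : ℝ)
      * (Fintype.card β : ℝ) ^ Fintype.card ι =
        ∑ f ∈ (Finset.univ : Finset (α → β)).filter A,
          ((Finset.univ.filter (B f)).card : ℝ) := by
      rw [Fintype.card_fun] at key
      exact_mod_cast key
    rw [h1]
    calc _ ≤ ∑ f ∈ (Finset.univ : Finset (α → β)).filter A, k :=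
          Finset.sum_le_sum fun f hf => hk f (by simpa using hf)
      _ = _ := by rw [Finset.sum_const, nsmul_eq_mul, mul_comm]
  rw [pr_eq, pr_eq, div_mul_eq_mul_div, ← mul_div_assoc]
  refine div_le_div_of_nonneg_right ?_ (by positivity)
  refine le_trans (le_of_eq ?_) (key'.trans (le_of_eq ?_)) <;> congr!

/-- Single-point version of `pr_resample_family`. -/
lemma pr_resample (A C : (α → β) → Prop) (e : (α → β) → α) (Z : (α → β) → Finset β) (k : ℝ)
    [Nonempty β]
    (hA : ∀ f v, A f → A (Function.update f (e f) v) ∧ e (Function.update f (e f) v) = e f ∧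
      Z (Function.update f (e f) v) = Z f)
    (hk : ∀ f, A f → ((Z f).card : ℝ) ≤ k)
    (hC : ∀ f, C f → A f ∧ f (e f) ∈ Z f) :
    pr C ≤ k / Fintype.card β * pr A := by
  have hext : ∀ (f : α → β) (v : Unit → β),
      Function.extend (fun _ : Unit => e f) v f = Function.update f (e f) (v ()) := by
    intro f v
    funext a
    by_cases ha : a = e f
    · subst ha
      have : Function.Injective (fun _ : Unit => e f) := fun _ _ _ => rfl
      simpa using this.extend_apply v f ()
    · rw [Function.extend_apply' _ _ _ (by rintro ⟨_, h⟩; exact ha h.symm)]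
      simp [ha]
  have h := pr_resample_family A (fun f (_ : Unit) => e f) (fun f v => v () ∈ Z f) k
    (fun f _ _ _ _ => rfl)
    (fun f v hf => by
      obtain ⟨h1, h2, h3⟩ := hA f (v ()) hf
      simp only [hext]
      exact ⟨h1, by rw [h2], by rw [h3]⟩)
    (fun f hf => by
      refine le_trans ?_ (hk f hf)
      have : (Finset.univ.filter fun v : Unit → β => v () ∈ Z f).card ≤ (Z f).card :=
        Finset.card_le_card_of_injOn (fun v => v ()) (fun v hv => by simpa using hv)
          (fun v _ u _ huv => by funext; exact huv)
      have h2 : ((Finset.univ.filter fun v : Unit → β => v () ∈ Z f).card : ℝ) ≤ (Z f).card :=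
        Nat.cast_le.2 this
      exact le_trans (le_of_eq (by congr!)) h2)
  have hpos : (0 : ℝ) < Fintype.card β := by positivity
  simp only [Fintype.card_unit, pow_one] at h
  rw [div_mul_eq_mul_div, le_div_iff₀ hpos]
  refine le_trans ?_ h
  gcongr
  exact pr_mono fun f hf => hC f hf

end Resampling

/-! ### Paths -/

/-- The state reached from `p` after reading the first `i` letters of `w`. -/
def st {n : ℕ} (f : Fin n × Bool → Fin n) (w : ℕ → Bool) (p : Fin n) : ℕ → Fin n
  | 0 => p
  | i + 1 => f (st f w p i, w i)

section Paths

variable {n : ℕ} (f : Fin n × Bool → Fin n) (w : ℕ → Bool) (p : Fin n)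

lemma st_congr {g : Fin n × Bool → Fin n} {i : ℕ}
    (h : ∀ t < i, g (st f w p t, w t) = f (st f w p t, w t)) :
    ∀ t ≤ i, st g w p t = st f w p t := by
  intro t
  induction t with
  | zero => intro _; rfl
  | succ t ih =>
    intro ht
    simp only [st]
    rw [ih (by omega), h t (by omega)]

lemma st_update {e : Fin n × Bool} {v : Fin n} {i : ℕ}
    (h : ∀ t < i, (st f w p t, w t) ≠ e) :
    ∀ t ≤ i, st (Function.update f e v) w p t = st f w p t :=
  st_congr f w p fun t ht => Function.update_of_ne (h t ht) _ _

lemma st_congr_word {w' : ℕ → Bool} {i : ℕ} (h : ∀ t < i, w' t = w t) :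
    ∀ t ≤ i, st f w' p t = st f w p t := by
  intro t
  induction t with
  | zero => intro _; rfl
  | succ t ih =>
    intro ht
    simp only [st]
    rw [ih (by omega), h t (by omega)]

end Paths

/-! ### Moments of the number of preimages under a fixed word -/

section Preimages

variable {n : ℕ} (w : ℕ → Bool) (l : ℕ) (z : Fin n)

/-- All states of `P` are sent to `z` by the first `l` letters of `w`. -/
def AllTo (P : Finset (Fin n)) (f : Fin n × Bool → Fin n) : Prop :=
  ∀ p ∈ P, st f w p l = z

/-- The states visited from `P` while reading the first `l` letters of `w`, together with `z`. -/
def visited (P : Finset (Fin n)) (f : Fin n × Bool → Fin n) : Finset (Fin n) :=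
  insert z ((P ×ˢ Finset.range (l + 1)).image fun x => st f w x.1 x.2)

lemma card_visited_le (P : Finset (Fin n)) (f : Fin n × Bool → Fin n) :
    (visited w l z P f).card ≤ P.card * (l + 1) + 1 := by
  refine (Finset.card_insert_le _ _).trans ?_
  have := Finset.card_image_le (s := P ×ˢ Finset.range (l + 1)) (f := fun x => st f w x.1 x.2)
  rw [Finset.card_product, Finset.card_range] at this
  omega

lemma mem_visited {P : Finset (Fin n)} {f : Fin n × Bool → Fin n} {p : Fin n} (hp : p ∈ P)
    {t : ℕ} (ht : t ≤ l) : st f w p t ∈ visited w l z P f := by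
  refine Finset.mem_insert_of_mem (Finset.mem_image.2 ⟨(p, t), ?_, rfl⟩)
  simp [hp]; omega

variable [NeZero n]

lemma pr_hit_visited_le (P : Finset (Fin n)) (q : Fin n) (t : ℕ) :
    pr (fun f => AllTo w l z P f ∧ (∀ s ≤ t, st f w q s ∉ visited w l z P f) ∧
      st f w q (t + 1) ∈ visited w l z P f) ≤
      ((P.card * (l + 1) + 1 : ℕ) : ℝ) / n * pr (AllTo w l z P) := by
  have key := pr_resample (α := Fin n × Bool) (β := Fin n)
    (A := fun f => AllTo w l z P f ∧ (∀ s ≤ t, st f w q s ∉ visited w l z P f) ∧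
      ∀ s < t, (st f w q s, w s) ≠ (st f w q t, w t))
    (C := fun f => AllTo w l z P f ∧ (∀ s ≤ t, st f w q s ∉ visited w l z P f) ∧
      st f w q (t + 1) ∈ visited w l z P f)
    (e := fun f => (st f w q t, w t)) (Z := fun f => visited w l z P f)
    (k := ((P.card * (l + 1) + 1 : ℕ) : ℝ)) ?_ ?_ ?_
  · refine key.trans ?_
    rw [Fintype.card_fin]
    gcongr
    exact pr_mono fun f hf => hf.1
  · rintro f v ⟨h1, h2, h3⟩
    have hq := st_update f w q (v := v) h3
    have hp : ∀ p ∈ P, ∀ s ≤ l,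
        st (Function.update f (st f w q t, w t) v) w p s = st f w p s := by
      intro p hp
      refine st_update f w p fun s hs h => h2 t le_rfl ?_
      rw [Prod.mk.injEq] at h
      rw [← h.1]
      exact mem_visited w l z hp hs.le
    have hV : visited w l z P (Function.update f (st f w q t, w t) v) = visited w l z P f := by
      unfold visited
      congr 1
      refine Finset.image_congr ?_
      rintro ⟨p, s⟩ h
      simp only [Finset.coe_product, Set.mem_prod, Finset.mem_coe, Finset.mem_range] at h
      exact hp p h.1 s (by omega)
    refine ⟨⟨fun p h => by rw [hp p h l le_rfl]; exact h1 p h, fun s hs => ?_, fun s hs => ?_⟩,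
      ?_, hV⟩
    · rw [hV, hq s hs]; exact h2 s hs
    · rw [hq s hs.le, hq t le_rfl]; exact h3 s hs
    · rw [hq t le_rfl]
  · intro f _
    exact_mod_cast card_visited_le w l z P f
  · rintro f ⟨h1, h2, h3⟩
    refine ⟨⟨h1, h2, fun s hs h => h2 (s + 1) (by omega) ?_⟩, h3⟩
    have : st f w q (s + 1) = st f w q (t + 1) := by simp only [st]; rw [h]
    rw [this]; exact h3

/-- Among the states `q`, the expected number of those joining `P` is bounded. -/
lemma sum_pr_allTo_insert_le (P : Finset (Fin n)) :
    ∑ q, pr (AllTo w l z (insert q P)) ≤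
      (((P.card * (l + 1) + 1) * (l + 1) : ℕ) : ℝ) * pr (AllTo w l z P) := by
  set b : ℝ := ((P.card * (l + 1) + 1 : ℕ) : ℝ) with hb
  have hn : (0 : ℝ) < n := by exact_mod_cast Nat.pos_of_ne_zero (NeZero.ne n)
  have h1 : ∀ q, pr (AllTo w l z (insert q P)) ≤
      pr (fun f => AllTo w l z P f ∧ q ∈ visited w l z P f) +
        l * (b / n * pr (AllTo w l z P)) := by
    intro q
    refine (pr_le_add (C := fun f => ∃ t ∈ Finset.range l, AllTo w l z P f ∧
      (∀ s ≤ t, st f w q s ∉ visited w l z P f) ∧ st f w q (t + 1) ∈ visited w l z P f)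
      (B := fun f => AllTo w l z P f ∧ q ∈ visited w l z P f) ?_).trans ?_
    · intro f hf
      have hP : AllTo w l z P f := fun p hp => hf p (Finset.mem_insert_of_mem hp)
      have hq : st f w q l ∈ visited w l z P f := by
        rw [hf q (Finset.mem_insert_self _ _)]
        exact Finset.mem_insert_self _ _
      have hex : ∃ i, st f w q i ∈ visited w l z P f := ⟨l, hq⟩
      have hle : Nat.find hex ≤ l := Nat.find_min' hex hq
      have hspec := Nat.find_spec hex
      have hmin := fun m => Nat.find_min hex (m := m)
      rcases hN : Nat.find hex with _ | t
      · rw [hN] at hspec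
        exact Or.inl ⟨hP, hspec⟩
      · rw [hN] at hspec hle hmin
        exact Or.inr ⟨t, by simp; omega, hP, fun s hs => hmin s (by omega), hspec⟩
    · gcongr
      refine (pr_le_sum (Finset.range l) _ fun f hf => hf).trans ?_
      refine (Finset.sum_le_sum fun t _ => pr_hit_visited_le w l z P q t).trans ?_
      rw [Finset.sum_const, Finset.card_range, nsmul_eq_mul]
  have h2 : ∑ q, pr (fun f => AllTo w l z P f ∧ q ∈ visited w l z P f) ≤
      b * pr (AllTo w l z P) := by
    unfold pr
    rw [← ex_sum, ← ex_const_mul]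
    refine ex_mono fun f => ?_
    by_cases h : AllTo w l z P f
    · simp only [h, true_and, if_true, mul_one, Finset.sum_boole]
      rw [hb]
      have : (Finset.univ.filter fun q => q ∈ visited w l z P f) = visited w l z P f := by
        ext; simp
      rw [this]
      exact_mod_cast card_visited_le w l z P f
    · simp [h]
  calc _ ≤ ∑ q, (pr (fun f => AllTo w l z P f ∧ q ∈ visited w l z P f) +
        l * (b / n * pr (AllTo w l z P))) := Finset.sum_le_sum fun q _ => h1 q
    _ = ∑ q, pr (fun f => AllTo w l z P f ∧ q ∈ visited w l z P f) +
        l * b * pr (AllTo w l z P) := by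
      rw [Finset.sum_add_distrib, Finset.sum_const, Finset.card_univ, Fintype.card_fin,
        nsmul_eq_mul]
      field_simp
    _ ≤ b * pr (AllTo w l z P) + l * b * pr (AllTo w l z P) := by gcongr
    _ = _ := by rw [hb]; push_cast; ring

/-- The number of states sent to `z` by the first `l` letters of `w`. -/
def preCount (f : Fin n × Bool → Fin n) : ℕ :=
  (Finset.univ.filter fun p => st f w p l = z).card

lemma ex_allTo_preCount_pow_le (k m : ℕ) : ∀ P : Finset (Fin n), P.card + m ≤ k →
    ex (fun f => (if AllTo w l z P f then (1 : ℝ) else 0) * (preCount w l z f : ℝ) ^ m) ≤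
      (((k * (l + 1) + 1) * (l + 1) : ℕ) : ℝ) ^ m * pr (AllTo w l z P) := by
  induction m with
  | zero => intro P _; simp [pr]
  | succ m ih =>
    intro P hP
    have hexp : (fun f => (if AllTo w l z P f then (1 : ℝ) else 0) *
        (preCount w l z f : ℝ) ^ (m + 1)) =
        fun f => ∑ q, (if AllTo w l z (insert q P) f then (1 : ℝ) else 0) *
          (preCount w l z f : ℝ) ^ m := by
      funext f
      have h1 : (if AllTo w l z P f then (1 : ℝ) else 0) * preCount w l z f =
          ∑ q, (if AllTo w l z (insert q P) f then (1 : ℝ) else 0) := by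
        unfold preCount
        rw [Finset.card_filter]
        push_cast
        rw [Finset.mul_sum]
        refine Finset.sum_congr rfl fun q _ => ?_
        have : AllTo w l z (insert q P) f ↔ AllTo w l z P f ∧ st f w q l = z := by
          simp [AllTo, and_comm]
        by_cases h : AllTo w l z P f <;> by_cases h' : st f w q l = z <;> simp [this, h, h']
      rw [← Finset.sum_mul, ← h1, pow_succ]
      ring
    rw [hexp, ex_sum]
    set b : ℝ := (((k * (l + 1) + 1) * (l + 1) : ℕ) : ℝ) with hb
    calc _ ≤ ∑ q, b ^ m * pr (AllTo w l z (insert q P)) :=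
          Finset.sum_le_sum fun q _ => ih _ (by
            have := Finset.card_insert_le q P
            omega)
      _ = b ^ m * ∑ q, pr (AllTo w l z (insert q P)) := by rw [Finset.mul_sum]
      _ ≤ b ^ m * (b * pr (AllTo w l z P)) := by
        gcongr
        refine (sum_pr_allTo_insert_le w l z P).trans ?_
        have := pr_nonneg (AllTo w l z P)
        gcongr
        rw [hb]
        have : P.card ≤ k := by omega
        gcongr
      _ = _ := by ring

lemma pr_preCount_ge_le (k : ℕ) (a : ℝ) (ha : 0 ≤ a) :
    a ^ k * pr (fun f : Fin n × Bool → Fin n => a ≤ preCount w l z f) ≤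
      (((k * (l + 1) + 1) * (l + 1) : ℕ) : ℝ) ^ k := by
  have h := ex_allTo_preCount_pow_le w l z k k ∅ (by simp)
  have h1 : ∀ f, AllTo w l z ∅ f := fun f p hp => absurd hp (Finset.notMem_empty p)
  simp only [h1, if_true, one_mul] at h
  refine (mul_pr_le_ex (g := fun f => (preCount w l z f : ℝ) ^ k) (fun f => by positivity)
    fun f hf => by gcongr).trans (h.trans ?_)
  exact mul_le_of_le_one_right (by positivity) (pr_le_one _)

end Preimages

/-! ### Second moment of the number of words merging two given states -/

section Merging

variable {n : ℕ}

/-- The path of `p` under `w`, stopped after `l` steps. -/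
def pathUpTo (f : Fin n × Bool → Fin n) (w : ℕ → Bool) (p : Fin n) (l : ℕ) : ℕ → Fin n :=
  fun t => st f w p (min t l)

lemma pathUpTo_of_le (f : Fin n × Bool → Fin n) (w : ℕ → Bool) (p : Fin n) {l t : ℕ}
    (h : t ≤ l) : pathUpTo f w p l t = st f w p t := by
  simp [pathUpTo, h]

lemma pathUpTo_update (f : Fin n × Bool → Fin n) (w : ℕ → Bool) (p : Fin n) {l : ℕ}
    {e : Fin n × Bool} (h : ∀ t < l, (st f w p t, w t) ≠ e) (v : Fin n) :
    pathUpTo (Function.update f e v) w p l = pathUpTo f w p l := by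
  funext t
  exact st_update f w p h _ (min_le_right _ _)

/-- The first `i` values of `P` and `Q` are all distinct. -/
def Separated (P Q : ℕ → Fin n) (i : ℕ) : Prop :=
  ∀ s < i, ∀ t < i, (s ≠ t → P s ≠ P t ∧ Q s ≠ Q t) ∧ P s ≠ Q t

lemma Separated.congr {P Q P' Q' : ℕ → Fin n} {i : ℕ} (h : Separated P Q i)
    (hP : ∀ t < i, P' t = P t)
    (hQ : ∀ t < i, Q' t = Q t) : Separated P' Q' i := by
  intro s hs t ht
  rw [hP s hs, hP t ht, hQ s hs, hQ t ht]
  exact h s hs t ht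

lemma Separated.symm {P Q : ℕ → Fin n} {i : ℕ} (h : Separated P Q i) : Separated Q P i :=
  fun s hs t ht =>
  ⟨fun hst => ((h s hs t ht).1 hst).symm, ((h t ht s hs).2).symm⟩

/-- The set of the values of `P` and `Q` up to index `l`. -/
def pathSet (P Q : ℕ → Fin n) (l : ℕ) : Finset (Fin n) :=
  (Finset.range (l + 1)).image P ∪ (Finset.range (l + 1)).image Q

lemma card_pathSet_le (P Q : ℕ → Fin n) (l : ℕ) : (pathSet P Q l).card ≤ 2 * l + 2 := by
  refine (Finset.card_union_le _ _).trans ?_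
  have h1 := Finset.card_image_le (s := Finset.range (l + 1)) (f := P)
  have h2 := Finset.card_image_le (s := Finset.range (l + 1)) (f := Q)
  rw [Finset.card_range] at h1 h2
  omega

lemma mem_pathSet_left (P Q : ℕ → Fin n) {l t : ℕ} (h : t ≤ l) : P t ∈ pathSet P Q l :=
  Finset.mem_union_left _ (Finset.mem_image.2 ⟨t, by simp; omega, rfl⟩)

lemma mem_pathSet_right (P Q : ℕ → Fin n) {l t : ℕ} (h : t ≤ l) : Q t ∈ pathSet P Q l :=
  Finset.mem_union_right _ (Finset.mem_image.2 ⟨t, by simp; omega, rfl⟩)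

lemma pathSet_comm (P Q : ℕ → Fin n) (l : ℕ) : pathSet P Q l = pathSet Q P l :=
  Finset.union_comm _ _

lemma pathSet_congr {P Q P' Q' : ℕ → Fin n} {l : ℕ} (hP : ∀ t ≤ l, P' t = P t)
    (hQ : ∀ t ≤ l, Q' t = Q t) : pathSet P' Q' l = pathSet P Q l := by
  unfold pathSet
  congr 1 <;> refine Finset.image_congr fun t ht => ?_
  · exact hP t (by simpa [Nat.lt_succ_iff] using ht)
  · exact hQ t (by simpa [Nat.lt_succ_iff] using ht)

/-- The values of three paths being revealed, the next step of a fourth path is uniform if it uses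
an edge that was not revealed. -/
lemma pr_fresh_step [NeZero n] (w w₂ w' : ℕ → Bool) (p q p₂ q' : Fin n) (l s : ℕ)
    (Φ : (ℕ → Fin n) → (ℕ → Fin n) → (ℕ → Fin n) → (ℕ → Fin n) → Prop)
    (Z : (ℕ → Fin n) → (ℕ → Fin n) → (ℕ → Fin n) → (ℕ → Fin n) → Finset (Fin n)) (k : ℝ)
    (C : (Fin n × Bool → Fin n) → Prop)
    (hfresh : ∀ f, Φ (pathUpTo f w p l) (pathUpTo f w q l) (pathUpTo f w₂ p₂ l)
        (pathUpTo f w' q' s) →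
      (∀ t < l, (st f w p t, w t) ≠ (st f w' q' s, w' s)) ∧
      (∀ t < l, (st f w q t, w t) ≠ (st f w' q' s, w' s)) ∧
      (∀ t < l, (st f w₂ p₂ t, w₂ t) ≠ (st f w' q' s, w' s)) ∧
      (∀ t < s, (st f w' q' t, w' t) ≠ (st f w' q' s, w' s)))
    (hk : ∀ P Q R S, ((Z P Q R S).card : ℝ) ≤ k)
    (hC : ∀ f, C f → Φ (pathUpTo f w p l) (pathUpTo f w q l) (pathUpTo f w₂ p₂ l)
        (pathUpTo f w' q' s) ∧ st f w' q' (s + 1) ∈ Z (pathUpTo f w p l)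
        (pathUpTo f w q l) (pathUpTo f w₂ p₂ l) (pathUpTo f w' q' s)) :
    pr C ≤ k / n * pr (fun f => Φ (pathUpTo f w p l) (pathUpTo f w q l)
      (pathUpTo f w₂ p₂ l) (pathUpTo f w' q' s)) := by
  have key := pr_resample (α := Fin n × Bool) (β := Fin n)
    (A := fun f => Φ (pathUpTo f w p l) (pathUpTo f w q l)
      (pathUpTo f w₂ p₂ l) (pathUpTo f w' q' s)) (C := C)
    (e := fun f => (st f w' q' s, w' s))
    (Z := fun f => Z (pathUpTo f w p l)
        (pathUpTo f w q l) (pathUpTo f w₂ p₂ l) (pathUpTo f w' q' s)) (k := k)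
    ?_ (fun f _ => hk _ _ _ _) hC
  · rwa [Fintype.card_fin] at key
  · intro f v hf
    obtain ⟨h1, h2, h3, h4⟩ := hfresh f hf
    simp only [pathUpTo_update f w p h1, pathUpTo_update f w q h2,
      pathUpTo_update f w₂ p₂ h3, pathUpTo_update f w' q' h4,
      st_update f w' q' h4 s le_rfl, and_true]
    exact hf

lemma pr_separated_step [NeZero n] (w : ℕ → Bool) (p q : Fin n) (i : ℕ)
    (Z : (ℕ → Fin n) → (ℕ → Fin n) → Finset (Fin n)) (k : ℝ)
    (hk : ∀ P Q, ((Z P Q).card : ℝ) ≤ k) :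
    pr (fun f => Separated (st f w p) (st f w q) (i + 1) ∧
      st f w p (i + 1) ∈ Z (pathUpTo f w p i) (pathUpTo f w q (i + 1))) ≤
    k / n * pr (fun f => Separated (st f w p) (st f w q) (i + 1)) := by
  have hd : ∀ f, Separated (pathUpTo f w p i) (pathUpTo f w q (i + 1)) (i + 1) ↔
      Separated (st f w p) (st f w q) (i + 1) := fun f =>
    ⟨fun h => h.congr (fun t ht => (pathUpTo_of_le f w p (by omega)).symm)
      fun t ht => (pathUpTo_of_le f w q (by omega)).symm,
    fun h => h.congr (fun t ht => pathUpTo_of_le f w p (by omega))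
      fun t ht => pathUpTo_of_le f w q (by omega)⟩
  have := pr_fresh_step w w w q q q p (i + 1) i (fun _ Q _ S => Separated S Q (i + 1))
    (fun _ Q _ S => Z S Q) k (fun f => Separated (st f w p) (st f w q) (i + 1) ∧
      st f w p (i + 1) ∈ Z (pathUpTo f w p i) (pathUpTo f w q (i + 1))) ?_
    (fun _ _ _ _ => hk _ _) (fun f hf => ⟨(hd f).2 hf.1, hf.2⟩)
  · simpa only [hd] using this
  · intro f hf
    rw [hd] at hf
    have h1 : ∀ t < i + 1, (st f w q t, w t) ≠ (st f w p i, w i) := fun t ht h =>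
      (hf i (by omega) t ht).2 (Prod.mk.injEq _ _ _ _ ▸ h).1.symm
    exact ⟨h1, h1, h1, fun t ht h => ((hf t (by omega) i (by omega)).1 (by omega)).1
      (Prod.mk.injEq _ _ _ _ ▸ h).1⟩

/-- The words `w` of length `l` first bring `p` and `q` together at their last letter, without any
collision before. -/
def Merges (f : Fin n × Bool → Fin n) (w : ℕ → Bool) (p q : Fin n) (l : ℕ) : Prop :=
  Separated (st f w p) (st f w q) l ∧ st f w p l = st f w q l

lemma Merges.symm {f : Fin n × Bool → Fin n} {w : ℕ → Bool} {p q : Fin n} {l : ℕ}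
    (h : Merges f w p q l) : Merges f w q p l := ⟨h.1.symm, h.2.symm⟩

lemma pr_not_separated_le [NeZero n] (w : ℕ → Bool) {p q : Fin n} (hpq : p ≠ q) (m : ℕ) :
    ∀ i ≤ m, pr (fun f => ¬ Separated (st f w p) (st f w q) i) ≤ i * ((4 * m + 2 : ℕ) : ℝ) / n := by
  intro i
  induction i with
  | zero =>
    intro _
    have : ∀ f : Fin n × Bool → Fin n, Separated (st f w p) (st f w q) 0 :=
      fun f s hs => absurd hs (by omega)
    simp [this, pr, ex]
  | succ i ih =>
    intro hi
    rcases Nat.eq_zero_or_pos i with rfl | hi0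
    · have : ∀ f : Fin n × Bool → Fin n, Separated (st f w p) (st f w q) (0 + 1) := by
        intro f s hs t ht
        obtain rfl : s = 0 := by omega
        obtain rfl : t = 0 := by omega
        exact ⟨fun h => absurd rfl h, hpq⟩
      simp only [this, not_true]
      have h0 : pr (fun _ : Fin n × Bool → Fin n => False) = 0 := by simp [pr, ex]
      rw [h0]; positivity
    obtain ⟨j, rfl⟩ : ∃ j, i = j + 1 := ⟨i - 1, by omega⟩
    have hstep : ∀ p q : Fin n, pr (fun f => Separated (st f w p) (st f w q) (j + 1) ∧
        st f w p (j + 1) ∈ (Finset.range (j + 1)).image (pathUpTo f w p j) ∪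
          (Finset.range (j + 2)).image (pathUpTo f w q (j + 1))) ≤
        ((2 * m + 1 : ℕ) : ℝ) / n := by
      intro p q
      refine (pr_separated_step w p q j (fun P Q => (Finset.range (j + 1)).image P ∪
          (Finset.range (j + 2)).image Q) ((2 * m + 1 : ℕ) : ℝ) ?_).trans
        (mul_le_of_le_one_right (by positivity) (pr_le_one _))
      intro P Q
      have h1 := Finset.card_image_le (s := Finset.range (j + 1)) (f := P)
      have h2 := Finset.card_image_le (s := Finset.range (j + 2)) (f := Q)
      have h3 := Finset.card_union_le ((Finset.range (j + 1)).image P)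
        ((Finset.range (j + 2)).image Q)
      rw [Finset.card_range] at h1 h2
      exact_mod_cast (by omega : ((Finset.range (j + 1)).image P ∪
        (Finset.range (j + 2)).image Q).card ≤ 2 * m + 1)
    have hmem : ∀ (f : Fin n × Bool → Fin n) (p q : Fin n) (x : Fin n),
        ((∃ t < j + 1, x = st f w p t) ∨
        ∃ t < j + 2, x = st f w q t) → x ∈ (Finset.range (j + 1)).image (pathUpTo f w p j) ∪
          (Finset.range (j + 2)).image (pathUpTo f w q (j + 1)) := by
      rintro f p q x (⟨t, ht, rfl⟩ | ⟨t, ht, rfl⟩)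
      · exact Finset.mem_union_left _ (Finset.mem_image.2 ⟨t, by simpa using ht,
          pathUpTo_of_le _ _ _ (by omega)⟩)
      · exact Finset.mem_union_right _ (Finset.mem_image.2 ⟨t, by simpa using ht,
          pathUpTo_of_le _ _ _ (by omega)⟩)
    have hnot : ∀ f, ¬ Separated (st f w p) (st f w q) (j + 1 + 1) →
        ¬ Separated (st f w p) (st f w q) (j + 1) ∨
        ((Separated (st f w p) (st f w q) (j + 1) ∧
        st f w p (j + 1) ∈ (Finset.range (j + 1)).image (pathUpTo f w p j) ∪
          (Finset.range (j + 2)).image (pathUpTo f w q (j + 1))) ∨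
        (Separated (st f w q) (st f w p) (j + 1) ∧
        st f w q (j + 1) ∈ (Finset.range (j + 1)).image (pathUpTo f w q j) ∪
          (Finset.range (j + 2)).image (pathUpTo f w p (j + 1)))) := by
      intro f
      contrapose!
      rintro ⟨h1, h2, h3⟩
      have h2' := mt (hmem f p q _) (h2 h1)
      have h3' := mt (hmem f q p _) (h3 h1.symm)
      push Not at h2' h3'
      intro s hs t ht
      rcases Nat.lt_succ_iff_lt_or_eq.1 hs with hs | rfl <;>
        rcases Nat.lt_succ_iff_lt_or_eq.1 ht with ht | rfl
      · exact h1 s hs t ht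
      · exact ⟨fun _ => ⟨(h2'.1 s hs).symm, (h3'.1 s hs).symm⟩, (h3'.2 s (by omega)).symm⟩
      · exact ⟨fun _ => ⟨h2'.1 t ht, h3'.1 t ht⟩, h2'.2 t (by omega)⟩
      · exact ⟨fun h => absurd rfl h, h2'.2 _ (by omega)⟩
    refine (pr_le_add hnot).trans ?_
    have h1 := ih (by omega)
    have h2 := (pr_le_add (C := fun f => (Separated (st f w q) (st f w p) (j + 1) ∧
        st f w q (j + 1) ∈ (Finset.range (j + 1)).image (pathUpTo f w q j) ∪
          (Finset.range (j + 2)).image (pathUpTo f w p (j + 1)))) fun f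
        (hf : (Separated (st f w p) (st f w q) (j + 1) ∧
        st f w p (j + 1) ∈ (Finset.range (j + 1)).image (pathUpTo f w p j) ∪
          (Finset.range (j + 2)).image (pathUpTo f w q (j + 1))) ∨
        (Separated (st f w q) (st f w p) (j + 1) ∧
        st f w q (j + 1) ∈ (Finset.range (j + 1)).image (pathUpTo f w q j) ∪
          (Finset.range (j + 2)).image (pathUpTo f w p (j + 1)))) => hf).trans
      (add_le_add (hstep p q) (hstep q p))
    refine (add_le_add h1 h2).trans (le_of_eq ?_)
    push_cast
    ring

lemma pr_merges_le [NeZero n] (w : ℕ → Bool) (p q : Fin n) (i : ℕ) :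
    pr (fun f => Merges f w p q (i + 1)) ≤ 1 / n := by
  have h := pr_separated_step w p q i (fun _ Q => {Q (i + 1)}) 1 (by simp)
  refine le_trans (pr_mono fun f hf => ⟨hf.1, ?_⟩) (h.trans
    (mul_le_of_le_one_right (by positivity) (pr_le_one _)))
  rw [pathUpTo_of_le _ _ _ le_rfl, Finset.mem_singleton]
  exact hf.2

lemma le_pr_merges [NeZero n] (w : ℕ → Bool) {p q : Fin n} (hpq : p ≠ q) (i : ℕ) :
    (1 - (i + 1 : ℕ) * ((4 * (i + 1) + 2 : ℕ) : ℝ) / n) / n ≤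
      pr (fun f => Merges f w p q (i + 1)) := by
  have hn : (0 : ℝ) < n := by exact_mod_cast Nat.pos_of_ne_zero (NeZero.ne n)
  have h := pr_separated_step w p q i (fun _ Q => Finset.univ.erase (Q (i + 1))) (n - 1) (by
    intro P Q
    rw [Finset.card_erase_of_mem (Finset.mem_univ _), Finset.card_univ, Fintype.card_fin,
      Nat.cast_sub (Nat.one_le_iff_ne_zero.2 (NeZero.ne n))]
    simp)
  have h1 := pr_compl_add fun f => Separated (st f w p) (st f w q) (i + 1)
  have h2 := pr_not_separated_le w hpq (i + 1) (i + 1) le_rfl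
  have h3 : pr (fun f => Separated (st f w p) (st f w q) (i + 1)) ≤
      pr (fun f => Merges f w p q (i + 1)) +
      pr (fun f => Separated (st f w p) (st f w q) (i + 1) ∧ st f w p (i + 1) ∈
        Finset.univ.erase (pathUpTo f w q (i + 1) (i + 1))) := by
    refine pr_le_add fun f hf => ?_
    rw [pathUpTo_of_le _ _ _ le_rfl, Finset.mem_erase]
    by_cases h : st f w p (i + 1) = st f w q (i + 1)
    · exact Or.inl ⟨hf, h⟩
    · exact Or.inr ⟨hf, h, Finset.mem_univ _⟩
  set D := pr (fun f => Separated (st f w p) (st f w q) (i + 1))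
  have h4 : (1 - (i + 1 : ℕ) * ((4 * (i + 1) + 2 : ℕ) : ℝ) / n) ≤ D := by linarith
  calc _ ≤ D / n := by gcongr
    _ = D - (n - 1) / n * D := by field_simp; ring
    _ ≤ _ := by linarith

end Merging

section Joint

variable {n : ℕ}

lemma fresh_of_branch {f : Fin n × Bool → Fin n} {w w' : ℕ → Bool} {p q x : Fin n} {l h s : ℕ}
    (hx : x = p ∨ x = q) (hlt : ∀ t < h, w' t = w t) (hne : w h ≠ w' h)
    (hsep : Separated (st f w p) (st f w q) l) (hhs : h ≤ s) (hsl : s < l)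
    (hout : h < s → st f w' x s ∉ pathSet (st f w p) (st f w q) l) :
    (∀ t < l, (st f w p t, w t) ≠ (st f w' x s, w' s)) ∧
      (∀ t < l, (st f w q t, w t) ≠ (st f w' x s, w' s)) := by
  rcases Nat.lt_or_eq_of_le hhs with hs | rfl
  · have := hout hs
    constructor <;> intro t ht he <;> rw [Prod.mk.injEq] at he <;> rw [← he.1] at this
    · exact this (mem_pathSet_left _ _ ht.le)
    · exact this (mem_pathSet_right _ _ ht.le)
  · rw [st_congr_word f w x hlt h le_rfl]
    constructor <;> intro t ht he <;> rw [Prod.mk.injEq] at he <;>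
      obtain ⟨h1, h2⟩ := he <;> rcases hx with rfl | rfl
    · by_cases hth : t = h
      · subst hth; exact hne h2
      · exact ((hsep t ht h hsl).1 hth).1 h1
    · exact (hsep t ht h hsl).2 h1
    · exact (hsep h hsl t ht).2 h1.symm
    · by_cases hth : t = h
      · subst hth; exact hne h2
      · exact ((hsep t ht h hsl).1 hth).2 h1

lemma pathUpTo_spec (f : Fin n × Bool → Fin n) (w : ℕ → Bool) (p q : Fin n) (l : ℕ) :
    (Separated (pathUpTo f w p l) (pathUpTo f w q l) l ∧
      pathUpTo f w p l l = pathUpTo f w q l l) ↔ Merges f w p q l := by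
  have hp : ∀ t ≤ l, pathUpTo f w p l t = st f w p t := fun _ => pathUpTo_of_le f w p
  have hq : ∀ t ≤ l, pathUpTo f w q l t = st f w q t := fun _ => pathUpTo_of_le f w q
  rw [hp l le_rfl, hq l le_rfl, Merges]
  refine and_congr_left fun _ => ⟨fun h => h.congr ?_ ?_, fun h => h.congr ?_ ?_⟩
  · exact fun t ht => (hp t ht.le).symm
  · exact fun t ht => (hq t ht.le).symm
  · exact fun t ht => hp t ht.le
  · exact fun t ht => hq t ht.le

lemma pathSet_pathUpTo (f : Fin n × Bool → Fin n) (w : ℕ → Bool) (p q : Fin n) (l : ℕ) :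
    pathSet (pathUpTo f w p l) (pathUpTo f w q l) l = pathSet (st f w p) (st f w q) l :=
  pathSet_congr (fun _ => pathUpTo_of_le f w p) fun _ => pathUpTo_of_le f w q

/-- After the index `h`, the path `R` meets `P` or `Q` at index `i` for the first time. -/
def FirstHit (P Q R : ℕ → Fin n) (l h i : ℕ) : Prop :=
  (∀ t, h < t → t < i → R t ∉ pathSet P Q l) ∧
    (∀ s < i, ∀ t < i, s ≠ t → R s ≠ R t) ∧ R i ∈ pathSet P Q l

lemma firstHit_pathUpTo (f : Fin n × Bool → Fin n) (w w' : ℕ → Bool) (p q r : Fin n)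
    {l h i : ℕ} (hi : i ≤ l) :
    FirstHit (pathUpTo f w p l) (pathUpTo f w q l) (pathUpTo f w' r l) l h i ↔
      FirstHit (st f w p) (st f w q) (st f w' r) l h i := by
  have hr : ∀ t ≤ i, pathUpTo f w' r l t = st f w' r t := fun t ht =>
    pathUpTo_of_le f w' r (ht.trans hi)
  unfold FirstHit
  rw [pathSet_pathUpTo, hr i le_rfl]
  refine and_congr ?_ (and_congr_left fun _ => ?_)
  · refine forall_congr' fun t => forall_congr' fun _ => forall_congr' fun ht => ?_
    rw [hr t ht.le]
  · refine forall_congr' fun s => forall_congr' fun hs => forall_congr' fun t =>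
      forall_congr' fun ht => ?_
    rw [hr t ht.le, hr s hs.le]

/-- The path of `p` under `w'` first meets the two paths under `w` at index `i`,
and that the path of `q` under `w'` does so, or reaches the final state, at index `s + 1`. -/
def DoubleHit (f : Fin n × Bool → Fin n) (w w' : ℕ → Bool) (p q : Fin n) (l h i s : ℕ) : Prop :=
  Merges f w p q l ∧ Merges f w' p q l ∧
    FirstHit (pathUpTo f w p l) (pathUpTo f w q l) (pathUpTo f w' p l) l h i ∧
    (∀ t, h < t → t ≤ s → st f w' q t ∉ pathSet (st f w p) (st f w q) l) ∧
    st f w' q (s + 1) ∈ insert (pathUpTo f w' p l l)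
      (pathSet (pathUpTo f w p l) (pathUpTo f w q l) l)

lemma exists_doubleHit {f : Fin n × Bool → Fin n} {w w' : ℕ → Bool} {p q : Fin n} {l h i : ℕ}
    (h1 : Merges f w p q l) (h2 : Merges f w' p q l) (hhi : h < i) (hil : i < l)
    (hi : st f w' p i ∈ pathSet (st f w p) (st f w q) l) :
    ∃ i ∈ Finset.Ioo h l, ∃ s ∈ Finset.Ico h l, DoubleHit f w w' p q l h i s := by
  have hex : ∃ i, h < i ∧ st f w' p i ∈ pathSet (st f w p) (st f w q) l := ⟨i, hhi, hi⟩
  have hle : Nat.find hex ≤ i := Nat.find_min' hex ⟨hhi, hi⟩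
  have hspec := Nat.find_spec hex
  have hmin := fun m => Nat.find_min hex (m := m)
  have hex' : ∃ i, h < i ∧ st f w' q i ∈ insert (pathUpTo f w' p l l)
      (pathSet (pathUpTo f w p l) (pathUpTo f w q l) l) := by
    refine ⟨l, by omega, ?_⟩
    rw [pathUpTo_of_le _ _ _ le_rfl, h2.2]
    exact Finset.mem_insert_self _ _
  have hle' : Nat.find hex' ≤ l := by
    refine Nat.find_min' hex' ⟨by omega, ?_⟩
    rw [pathUpTo_of_le _ _ _ le_rfl, h2.2]
    exact Finset.mem_insert_self _ _
  have hspec' := Nat.find_spec hex'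
  have hmin' := fun m => Nat.find_min hex' (m := m)
  obtain ⟨s, hs⟩ : ∃ s, Nat.find hex' = s + 1 := ⟨Nat.find hex' - 1, by omega⟩
  rw [hs] at hle' hspec' hmin'
  refine ⟨Nat.find hex, Finset.mem_Ioo.2 ⟨hspec.1, by omega⟩, s,
    Finset.mem_Ico.2 ⟨by omega, by omega⟩, h1, h2, ?_, ?_, hspec'.2⟩
  · rw [firstHit_pathUpTo _ _ _ _ _ _ (by omega)]
    exact ⟨fun t ht ht' hm => hmin t ht' ⟨ht, hm⟩,
      fun s hs t ht hst => ((h2.1 s (by omega) t (by omega)).1 hst).1, hspec.2⟩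
  · intro t ht hts hm
    refine hmin' t (by omega) ⟨ht, Finset.mem_insert_of_mem ?_⟩
    rwa [pathSet_pathUpTo]

variable [NeZero n]

lemma pr_firstHit_le (w w' : ℕ → Bool) (p q : Fin n) {m h i : ℕ}
    (hlt : ∀ t < h, w' t = w t) (hne : w h ≠ w' h) (hhi : h < i) (him : i ≤ m + 1) :
    pr (fun f => Merges f w p q (m + 1) ∧
      FirstHit (st f w p) (st f w q) (st f w' p) (m + 1) h i) ≤
      ((2 * m + 4 : ℕ) : ℝ) / n * (1 / n) := by
  obtain ⟨s, rfl⟩ : ∃ s, i = s + 1 := ⟨i - 1, by omega⟩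
  have key := pr_fresh_step w w w' p q p p (m + 1) s
    (fun P Q _ S => (Separated P Q (m + 1) ∧ P (m + 1) = Q (m + 1)) ∧
      (∀ t, h < t → t ≤ s → S t ∉ pathSet P Q (m + 1)) ∧ ∀ t < s, S t ≠ S s)
    (fun P Q _ _ => pathSet P Q (m + 1)) ((2 * m + 4 : ℕ) : ℝ)
    (fun f => Merges f w p q (m + 1) ∧
      FirstHit (st f w p) (st f w q) (st f w' p) (m + 1) h (s + 1)) ?_ ?_ ?_
  · refine key.trans ?_
    gcongr
    refine le_trans (pr_mono fun f hf => ?_) (pr_merges_le w p q m)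
    rw [pathUpTo_spec] at hf
    exact hf.1
  · intro f hf
    rw [pathUpTo_spec, pathSet_pathUpTo] at hf
    have hr : ∀ t ≤ s, pathUpTo f w' p s t = st f w' p t := fun _ => pathUpTo_of_le f w' p
    obtain ⟨h1, h2, h3⟩ := hf
    have h4 := fresh_of_branch (Or.inl rfl) hlt hne h1.1 (by omega : h ≤ s) (by omega)
      (fun hs => by rw [← hr s le_rfl]; exact h2 s hs le_rfl)
    refine ⟨h4.1, h4.2, h4.1, fun t ht he => h3 t ht ?_⟩
    rw [hr t ht.le, hr s le_rfl]
    exact (Prod.mk.injEq _ _ _ _ ▸ he).1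
  · intro P Q _ _
    have := card_pathSet_le P Q (m + 1)
    exact_mod_cast (by omega : (pathSet P Q (m + 1)).card ≤ 2 * m + 4)
  · rintro f ⟨h1, h2, h3, h4⟩
    have hr : ∀ t ≤ s, pathUpTo f w' p s t = st f w' p t := fun _ => pathUpTo_of_le f w' p
    rw [pathUpTo_spec, pathSet_pathUpTo]
    refine ⟨⟨h1, fun t ht hts => ?_, fun t ht => ?_⟩, h4⟩
    · rw [hr t hts]; exact h2 t ht (by omega)
    · rw [hr t ht.le, hr s le_rfl]; exact h3 t (by omega) s (by omega) (by omega)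

lemma pr_joint_step (w w' : ℕ → Bool) (p q : Fin n) {l h s : ℕ}
    (hlt : ∀ t < h, w' t = w t) (hne : w h ≠ w' h) (hhs : h ≤ s) (hsl : s < l)
    (Ψ : (ℕ → Fin n) → (ℕ → Fin n) → (ℕ → Fin n) → Prop)
    (Z : (ℕ → Fin n) → (ℕ → Fin n) → (ℕ → Fin n) → Finset (Fin n)) (k : ℝ)
    (hk : ∀ P Q R, ((Z P Q R).card : ℝ) ≤ k) :
    pr (fun f => Merges f w p q l ∧ Merges f w' p q l ∧
      Ψ (pathUpTo f w p l) (pathUpTo f w q l) (pathUpTo f w' p l) ∧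
      (∀ t, h < t → t ≤ s → st f w' q t ∉ pathSet (st f w p) (st f w q) l) ∧
      st f w' q (s + 1) ∈
        Z (pathUpTo f w p l) (pathUpTo f w q l) (pathUpTo f w' p l)) ≤
    k / n * pr (fun f => Merges f w p q l ∧
      Ψ (pathUpTo f w p l) (pathUpTo f w q l) (pathUpTo f w' p l)) := by
  have hk0 : 0 ≤ k := le_trans (by positivity) (hk (fun _ => 0) (fun _ => 0) fun _ => 0)
  have key := pr_fresh_step w w' w' p q p q l s
    (fun P Q R S => (Separated P Q l ∧ P l = Q l) ∧ Ψ P Q R ∧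
      (∀ t, h < t → t ≤ s → S t ∉ pathSet P Q l) ∧ (∀ t < s, S t ≠ S s) ∧
      ∀ t < l, R t ≠ S s)
    (fun P Q R _ => Z P Q R) k
    (fun f => Merges f w p q l ∧ Merges f w' p q l ∧
      Ψ (pathUpTo f w p l) (pathUpTo f w q l) (pathUpTo f w' p l) ∧
      (∀ t, h < t → t ≤ s → st f w' q t ∉ pathSet (st f w p) (st f w q) l) ∧
      st f w' q (s + 1) ∈
        Z (pathUpTo f w p l) (pathUpTo f w q l) (pathUpTo f w' p l))
    ?_ (fun _ _ _ _ => hk _ _ _) ?_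
  · refine key.trans ?_
    gcongr
    refine pr_mono fun f hf => ?_
    rw [pathUpTo_spec] at hf
    exact ⟨hf.1, hf.2.1⟩
  · intro f hf
    rw [pathUpTo_spec, pathSet_pathUpTo] at hf
    have hr : ∀ t ≤ s, pathUpTo f w' q s t = st f w' q t := fun _ => pathUpTo_of_le f w' q
    obtain ⟨h1, -, h2, h3, h5⟩ := hf
    have h4 := fresh_of_branch (Or.inr rfl) hlt hne h1.1 hhs hsl
      (fun hs => by rw [← hr s le_rfl]; exact h2 s hs le_rfl)
    refine ⟨h4.1, h4.2, fun t ht he => h5 t ht ?_, fun t ht he => h3 t ht ?_⟩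
    · rw [hr s le_rfl, pathUpTo_of_le _ _ _ ht.le]
      exact (Prod.mk.injEq _ _ _ _ ▸ he).1
    · rw [hr t ht.le, hr s le_rfl]
      exact (Prod.mk.injEq _ _ _ _ ▸ he).1
  · rintro f ⟨h1, h2, h3, h4, h5⟩
    have hr : ∀ t ≤ s, pathUpTo f w' q s t = st f w' q t := fun _ => pathUpTo_of_le f w' q
    rw [pathUpTo_spec, pathSet_pathUpTo]
    refine ⟨⟨h1, h3, fun t ht hts => ?_, fun t ht => ?_, fun t ht => ?_⟩, h5⟩
    · rw [hr t hts]; exact h4 t ht hts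
    · rw [hr t ht.le, hr s le_rfl]; exact ((h2.1 t (by omega) s hsl).1 (by omega)).2
    · rw [hr s le_rfl, pathUpTo_of_le _ _ _ ht.le]; exact (h2.1 t ht s hsl).2

lemma pr_doubleHit_le (w w' : ℕ → Bool) (p q : Fin n) {m h i s : ℕ}
    (hlt : ∀ t < h, w' t = w t) (hne : w h ≠ w' h) (hhi : h < i) (him : i ≤ m + 1)
    (hhs : h ≤ s) (hsl : s < m + 1) :
    pr (fun f => DoubleHit f w w' p q (m + 1) h i s) ≤ ((2 * m + 5 : ℕ) : ℝ) ^ 2 / n ^ 3 := by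
  refine (pr_joint_step w w' p q hlt hne hhs hsl
    (fun P Q R => FirstHit P Q R (m + 1) h i)
    (fun P Q R => insert (R (m + 1)) (pathSet P Q (m + 1))) ((2 * m + 5 : ℕ) : ℝ) ?_).trans ?_
  · intro P Q R
    have := card_pathSet_le P Q (m + 1)
    have h2 := Finset.card_insert_le (R (m + 1)) (pathSet P Q (m + 1))
    exact_mod_cast (by omega : (insert (R (m + 1)) (pathSet P Q (m + 1))).card ≤ 2 * m + 5)
  · simp only [firstHit_pathUpTo _ _ _ _ _ _ him]
    have h1 := pr_firstHit_le w w' p q hlt hne hhi him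
    have h2 : ((2 * m + 4 : ℕ) : ℝ) ≤ ((2 * m + 5 : ℕ) : ℝ) := by exact_mod_cast (by omega)
    calc _ ≤ ((2 * m + 5 : ℕ) : ℝ) / n * (((2 * m + 5 : ℕ) : ℝ) / n * (1 / n)) := by
          refine mul_le_mul_of_nonneg_left (h1.trans ?_) (by positivity)
          gcongr
      _ = _ := by ring

lemma pr_merges_and_merges_le (w w' : ℕ → Bool) (p q : Fin n) {m h : ℕ}
    (hlt : ∀ t < h, w' t = w t) (hne : w h ≠ w' h) (hm : h < m + 1) :
    pr (fun f => Merges f w p q (m + 1) ∧ Merges f w' p q (m + 1)) ≤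
      1 / n ^ 2 + 2 * ((m + 1 : ℕ) : ℝ) ^ 2 * (((2 * m + 5 : ℕ) : ℝ) ^ 2 / n ^ 3) := by
  have hA : pr (fun f => Merges f w p q (m + 1) ∧ Merges f w' p q (m + 1) ∧ True ∧
      (∀ t, h < t → t ≤ m → st f w' q t ∉ pathSet (st f w p) (st f w q) (m + 1)) ∧
      st f w' q (m + 1) ∈ ({pathUpTo f w' p (m + 1) (m + 1)} : Finset (Fin n))) ≤
      1 / n ^ 2 := by
    refine (pr_joint_step w w' p q hlt hne (by omega : h ≤ m) (by omega)
      (fun _ _ _ => True) (fun _ _ R => {R (m + 1)}) 1 (by simp)).trans ?_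
    have : pr (fun f => Merges f w p q (m + 1) ∧ True) ≤ 1 / n := by
      simpa using pr_merges_le w p q m
    calc _ ≤ 1 / (n : ℝ) * (1 / n) := by gcongr
      _ = _ := by ring
  have hB : ∀ p q : Fin n, pr (fun f => ∃ x ∈ Finset.Ioo h (m + 1) ×ˢ Finset.Ico h (m + 1),
      DoubleHit f w w' p q (m + 1) h x.1 x.2) ≤
      ((m + 1 : ℕ) : ℝ) ^ 2 * (((2 * m + 5 : ℕ) : ℝ) ^ 2 / n ^ 3) := by
    intro p q
    refine (pr_le_sum _ _ fun f hf => hf).trans ?_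
    refine (Finset.sum_le_card_nsmul _ _ (((2 * m + 5 : ℕ) : ℝ) ^ 2 / n ^ 3)
      fun x hx => ?_).trans ?_
    · rw [Finset.mem_product, Finset.mem_Ioo, Finset.mem_Ico] at hx
      exact pr_doubleHit_le w w' p q hlt hne hx.1.1 hx.1.2.le hx.2.1 hx.2.2
    · rw [nsmul_eq_mul, Finset.card_product, Nat.card_Ioo, Nat.card_Ico]
      gcongr
      rw [sq]
      exact_mod_cast Nat.mul_le_mul (by omega) (by omega)
  refine (pr_le_add fun f (hf : Merges f w p q (m + 1) ∧ Merges f w' p q (m + 1)) => ?_).trans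
    (add_le_add hA ((pr_le_add fun f hf => hf).trans (add_le_add (hB p q) (hB q p)))) |>.trans ?_
  · by_cases hp : ∃ i, h < i ∧ i < m + 1 ∧ st f w' p i ∈ pathSet (st f w p) (st f w q) (m + 1)
    · obtain ⟨i, hi1, hi2, hi3⟩ := hp
      obtain ⟨i, hi, s, hs, hd⟩ := exists_doubleHit hf.1 hf.2 hi1 hi2 hi3
      exact Or.inr (Or.inl ⟨(i, s), Finset.mem_product.2 ⟨hi, hs⟩, hd⟩)
    by_cases hq : ∃ i, h < i ∧ i < m + 1 ∧ st f w' q i ∈ pathSet (st f w p) (st f w q) (m + 1)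
    · obtain ⟨i, hi1, hi2, hi3⟩ := hq
      rw [pathSet_comm] at hi3
      obtain ⟨i, hi, s, hs, hd⟩ := exists_doubleHit hf.1.symm hf.2.symm hi1 hi2 hi3
      exact Or.inr (Or.inr ⟨(i, s), Finset.mem_product.2 ⟨hi, hs⟩, hd⟩)
    push Not at hq
    refine Or.inl ⟨hf.1, hf.2, trivial, fun t ht htm => hq t ht (by omega), ?_⟩
    rw [pathUpTo_of_le _ _ _ le_rfl, Finset.mem_singleton]
    exact hf.2.2.symm
  · exact le_of_eq (by ring)

end Joint

section Chebyshev

variable {n : ℕ}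

/-- Extend a finite word by the letter `false`. -/
def padWord {l : ℕ} (w : Fin l → Bool) : ℕ → Bool :=
  fun i => if h : i < l then w ⟨i, h⟩ else false

/-- The number of words of length `l` merging `p` and `q` exactly at their last letter. -/
noncomputable def mergeCount (f : Fin n × Bool → Fin n) (p q : Fin n) (l : ℕ) : ℕ :=
  (Finset.univ.filter fun w : Fin l → Bool => Merges f (padWord w) p q l).card

lemma padWord_of_le {l : ℕ} (w : Fin l → Bool) {i : ℕ} (h : l ≤ i) : padWord w i = false :=
  dif_neg (by omega)

lemma exists_branch {l : ℕ} {w w' : Fin l → Bool} (h : w ≠ w') :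
    ∃ i < l, (∀ t < i, padWord w' t = padWord w t) ∧ padWord w i ≠ padWord w' i := by
  have hex : ∃ i, padWord w i ≠ padWord w' i := by
    obtain ⟨i, hi⟩ := Function.ne_iff.1 h
    exact ⟨i, by simpa [padWord] using hi⟩
  refine ⟨Nat.find hex, ?_, fun t ht => ?_, Nat.find_spec hex⟩
  · by_contra hl
    exact Nat.find_spec hex (by
      rw [padWord_of_le _ (by omega), padWord_of_le _ (by omega)])
  · have := Nat.find_min hex ht
    push Not at this
    exact this.symm

lemma mergeCount_cast (f : Fin n × Bool → Fin n) (p q : Fin n) (l : ℕ) :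
    (mergeCount f p q l : ℝ) =
      ∑ w : Fin l → Bool, if Merges f (padWord w) p q l then (1 : ℝ) else 0 := by
  simp [mergeCount]

variable [NeZero n]

lemma ex_mergeCount_sq_le (p q : Fin n) (m : ℕ) :
    ex (fun f => (mergeCount f p q (m + 1) : ℝ) ^ 2) ≤
      2 ^ (m + 1) / n + (2 ^ (m + 1)) ^ 2 * (1 / n ^ 2 +
        2 * ((m + 1 : ℕ) : ℝ) ^ 2 * (((2 * m + 5 : ℕ) : ℝ) ^ 2 / n ^ 3)) := by
  set ε : ℝ := 1 / n ^ 2 + 2 * ((m + 1 : ℕ) : ℝ) ^ 2 * (((2 * m + 5 : ℕ) : ℝ) ^ 2 / n ^ 3)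
  have hε : 0 ≤ ε := by positivity
  have h1 : (fun f => (mergeCount f p q (m + 1) : ℝ) ^ 2) = fun f =>
      ∑ w : Fin (m + 1) → Bool, ∑ w' : Fin (m + 1) → Bool,
        if Merges f (padWord w) p q (m + 1) ∧ Merges f (padWord w') p q (m + 1)
          then (1 : ℝ) else 0 := by
    funext f
    rw [mergeCount_cast, sq, Finset.sum_mul_sum]
    refine Finset.sum_congr rfl fun w _ => Finset.sum_congr rfl fun w' _ => ?_
    by_cases hw : Merges f (padWord w) p q (m + 1) <;>
      by_cases hw' : Merges f (padWord w') p q (m + 1) <;> simp [hw, hw']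
  rw [h1, ex_sum]
  have h2 : ∀ w : Fin (m + 1) → Bool, ex (fun f => ∑ w' : Fin (m + 1) → Bool,
        if Merges f (padWord w) p q (m + 1) ∧ Merges f (padWord w') p q (m + 1)
          then (1 : ℝ) else 0) ≤ 1 / n + 2 ^ (m + 1) * ε := by
    intro w
    rw [ex_sum]
    calc _ ≤ ∑ w' : Fin (m + 1) → Bool, ((if w' = w then 1 / (n : ℝ) else 0) + ε) := by
          refine Finset.sum_le_sum fun w' _ => ?_
          by_cases h : w' = w
          · subst h
            simp only [and_self, if_true]
            have := pr_merges_le (padWord w') p q m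
            unfold pr at this
            linarith
          · obtain ⟨i, hi, hlt, hne⟩ := exists_branch (Ne.symm h)
            simp only [h, if_false, zero_add]
            rw [ex_ite]
            exact pr_merges_and_merges_le _ _ p q hlt hne hi
      _ = _ := by
          rw [Finset.sum_add_distrib, Finset.sum_ite_eq' , Finset.sum_const]
          simp
  refine (Finset.sum_le_sum fun w _ => h2 w).trans (le_of_eq ?_)
  rw [Finset.sum_const, Finset.card_univ]
  simp only [Fintype.card_fun, Fintype.card_bool, Fintype.card_fin, nsmul_eq_mul]
  push_cast
  ring

lemma le_ex_mergeCount {p q : Fin n} (hpq : p ≠ q) (m : ℕ) :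
    2 ^ (m + 1) * ((1 - (m + 1 : ℕ) * ((4 * (m + 1) + 2 : ℕ) : ℝ) / n) / n) ≤
      ex (fun f => (mergeCount f p q (m + 1) : ℝ)) := by
  simp only [mergeCount_cast]
  rw [ex_sum]
  simp only [ex_ite]
  have := Finset.card_nsmul_le_sum Finset.univ
    (fun w : Fin (m + 1) → Bool => pr fun f => Merges f (padWord w) p q (m + 1)) _
    fun w _ => le_pr_merges (padWord w) hpq m
  simpa only [Finset.card_univ, Fintype.card_fun, Fintype.card_bool, Fintype.card_fin,
    nsmul_eq_mul, Nat.cast_pow, Nat.cast_ofNat] using this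

lemma pr_mergeCount_le {p q : Fin n} (hpq : p ≠ q) (m : ℕ)
    (hm : (n : ℝ) ^ 2 ≤ 4 * 2 ^ (m + 1)) :
    pr (fun f => (mergeCount f p q (m + 1) : ℝ) ≤ 2 ^ (m + 1) / n / 2) ≤
      4 * ((2 * m + 5 : ℕ) : ℝ) ^ 4 / n := by
  have hn : (0 : ℝ) < n := by exact_mod_cast Nat.pos_of_ne_zero (NeZero.ne n)
  set M : ℝ := 2 ^ (m + 1) with hM
  have hM0 : 0 < M := by positivity
  set x : ℝ := ((2 * m + 5 : ℕ) : ℝ) with hx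
  set y : ℝ := ((m + 1 : ℕ) : ℝ) with hy
  have hxy : x = 2 * y + 3 := by rw [hx, hy]; push_cast; ring
  have hy1 : 1 ≤ y := by rw [hy]; exact_mod_cast (by omega)
  have hz : ((4 * (m + 1) + 2 : ℕ) : ℝ) = 4 * y + 2 := by rw [hy]; push_cast; ring
  set N : (Fin n × Bool → Fin n) → ℝ := fun f => mergeCount f p q (m + 1)
  have h1 := ex_mergeCount_sq_le p q m
  have h2 := le_ex_mergeCount hpq m
  rw [hz] at h2
  change ex (fun f => N f ^ 2) ≤ _ at h1
  change _ ≤ ex N at h2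
  have h3 : ex (fun f => (N f - M / n) ^ 2) =
      ex (fun f => N f ^ 2) - 2 * (M / n) * ex N + (M / n) ^ 2 := by
    have : (fun f => (N f - M / n) ^ 2) = fun f => (N f ^ 2 + (-(2 * (M / n))) * N f)
      + (M / n) ^ 2 := by funext f; ring
    rw [this, ex_add, ex_add, ex_const_mul, ex_const]
    ring
  have h4 : (M / n / 2) ^ 2 * pr (fun f => N f ≤ M / n / 2) ≤
      ex (fun f => (N f - M / n) ^ 2) := by
    refine mul_pr_le_ex (fun f => sq_nonneg _) fun f hf => ?_
    have h0 : 0 ≤ M / n / 2 := by positivity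
    nlinarith
  have h5 : ex (fun f => (N f - M / n) ^ 2) ≤
      M / n + M ^ 2 * (2 * y ^ 2 * (x ^ 2 / n ^ 3)) +
        2 * (M / n) ^ 2 * (y * (4 * y + 2) / n) := by
    have h6 := mul_le_mul_of_nonneg_left h2 (by positivity : 0 ≤ 2 * (M / n))
    rw [h3]
    refine (add_le_add_left (sub_le_sub h1 h6) _).trans (le_of_eq ?_)
    field_simp
    ring
  have h7 : M / n ≤ (M / n) ^ 2 * (4 / n) := by
    have : (M / n) ^ 2 * (4 / n) - M / n = M / n ^ 3 * (4 * M - n ^ 2) := by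
      field_simp
    have h8 : 0 ≤ M / n ^ 3 * (4 * M - n ^ 2) :=
      mul_nonneg (by positivity) (by linarith)
    linarith
  have h8 : (M / n / 2) ^ 2 * pr (fun f => N f ≤ M / n / 2) ≤
      (M / n / 2) ^ 2 * (4 * x ^ 4 / n) := by
    refine (h4.trans h5).trans ?_
    have h9 : 4 + 2 * y ^ 2 * x ^ 2 + 2 * (y * (4 * y + 2)) ≤ x ^ 4 := by
      have h10 : 0 ≤ 8 * y ^ 4 + 72 * y ^ 3 + 190 * y ^ 2 + 212 * y + 77 := by positivity
      rw [hxy]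
      linarith [h10]
    calc _ ≤ (M / n) ^ 2 * (4 / n) + M ^ 2 * (2 * y ^ 2 * (x ^ 2 / n ^ 3)) +
          2 * (M / n) ^ 2 * (y * (4 * y + 2) / n) := by gcongr
      _ = (M / n) ^ 2 / n * (4 + 2 * y ^ 2 * x ^ 2 + 2 * (y * (4 * y + 2))) := by
          field_simp
      _ ≤ (M / n) ^ 2 / n * x ^ 4 := by gcongr
      _ = _ := by ring
  exact le_of_mul_le_mul_left h8 (by positivity)

end Chebyshev

/-! ### Words whose paths use prescribed edges -/

section Along

variable {n : ℕ}

/-- All edges followed from `x` when reading the word belong to `E`. -/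
def Along (E : Set (Fin n × Bool)) (f : Fin n × Bool → Fin n) : List Bool → Fin n → Prop
  | [], _ => True
  | c :: v, x => (x, c) ∈ E ∧ Along E f v (f (x, c))

variable {E E' : Set (Fin n × Bool)} {f g : Fin n × Bool → Fin n}

lemma run_append_s2 (u v : List Bool) : ∀ x, run f (u ++ v) x = run f v (run f u x) := by
  induction u with
  | nil => intro x; rfl
  | cons c u ih => intro x; exact ih _

lemma along_append (u v : List Bool) :
    ∀ x, Along E f (u ++ v) x ↔ Along E f u x ∧ Along E f v (run f u x) := by
  induction u with
  | nil => intro x; simp [Along, run]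
  | cons c u ih => intro x; simp [Along, run, ih, and_assoc]

lemma Along.mono (h : E ⊆ E') {v : List Bool} : ∀ {x}, Along E f v x → Along E' f v x := by
  induction v with
  | nil => intro x _; trivial
  | cons c v ih => intro x hx; exact ⟨h hx.1, ih hx.2⟩

lemma Along.congr (h : ∀ e ∈ E, g e = f e) {v : List Bool} :
    ∀ {x}, Along E f v x → run g v x = run f v x ∧ Along E g v x := by
  induction v with
  | nil => intro x _; exact ⟨rfl, trivial⟩
  | cons c v ih =>
    intro x hx
    have := ih hx.2
    simp only [run, Along]
    rw [h _ hx.1]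
    exact ⟨this.1, hx.1, this.2⟩

lemma run_map_range (u : ℕ → Bool) (x : Fin n) (t : ℕ) :
    run f ((List.range t).map u) x = st f u x t := by
  induction t with
  | zero => rfl
  | succ t ih => rw [List.range_succ, List.map_append, run_append_s2, ih]; rfl

lemma along_map_range (u : ℕ → Bool) (x : Fin n) (t : ℕ) :
    Along E f ((List.range t).map u) x ↔ ∀ s < t, (st f u x s, u s) ∈ E := by
  induction t with
  | zero => simp [Along]
  | succ t ih =>
    rw [List.range_succ, List.map_append, along_append, ih, run_map_range, Nat.forall_lt_succ_right]
    simp [Along]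

/-- Some word of length at most `l` merges `p` and `q` without using the edges in `R`. -/
def MergesAvoid (f : Fin n × Bool → Fin n) (R : Set (Fin n × Bool)) (l : ℕ) (p q : Fin n) : Prop :=
  ∃ v : List Bool, v.length ≤ l ∧ Along Rᶜ f v p ∧ Along Rᶜ f v q ∧ run f v p = run f v q

lemma MergesAvoid.congr {R : Set (Fin n × Bool)} {l : ℕ} {p q : Fin n}
    (h : MergesAvoid f R l p q) (hg : ∀ e ∉ R, g e = f e) : MergesAvoid g R l p q := by
  obtain ⟨v, hv, hp, hq, hpq⟩ := h
  have h1 := hp.congr hg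
  have h2 := hq.congr hg
  exact ⟨v, hv, h1.2, h2.2, by rw [h1.1, h2.1, hpq]⟩

end Along

/-! ### Merging words that avoid a small set of states -/

section Avoid

variable {n : ℕ}

/-- No state has more than `k` preimages under a word of length at most `l`. -/
def FewPreimages (f : Fin n × Bool → Fin n) (l k : ℕ) : Prop :=
  ∀ w : Fin l → Bool, ∀ t ≤ l, ∀ z, preCount (padWord w) t z f ≤ k

/-- The word merges the two states and the path of the first one visits `W`. -/
def MergesVia (f : Fin n × Bool → Fin n) (w : ℕ → Bool) (W : Finset (Fin n)) (l : ℕ)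
    (x : Fin n × Fin n) : Prop :=
  st f w x.1 l = st f w x.2 l ∧ ∃ t < l, st f w x.1 t ∈ W

lemma card_mergesVia_le {f : Fin n × Bool → Fin n} {l k : ℕ} (hf : FewPreimages f l k)
    (w : Fin l → Bool) (W : Finset (Fin n)) :
    (Finset.univ.filter (MergesVia f (padWord w) W l)).card ≤ l * W.card * k ^ 2 := by
  have hsub : Finset.univ.filter (MergesVia f (padWord w) W l) ⊆
      (Finset.range l ×ˢ W).biUnion fun y =>
        (Finset.univ.filter fun p => st f (padWord w) p y.1 = y.2).biUnion fun p =>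
          (Finset.univ.filter fun q => st f (padWord w) q l = st f (padWord w) p l).image
            fun q => (p, q) := by
    rintro ⟨p, q⟩ h
    obtain ⟨h1, t, ht, h2⟩ := (Finset.mem_filter.1 h).2
    refine Finset.mem_biUnion.2 ⟨(t, st f (padWord w) p t), by simp [ht, h2], ?_⟩
    refine Finset.mem_biUnion.2 ⟨p, by simp, ?_⟩
    exact Finset.mem_image.2 ⟨q, by simp [h1.symm], rfl⟩
  refine (Finset.card_le_card hsub).trans ?_
  refine (Finset.card_biUnion_le_card_mul _ _ (k ^ 2) fun y hy => ?_).trans ?_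
  · rw [Finset.mem_product, Finset.mem_range] at hy
    refine (Finset.card_biUnion_le_card_mul _ _ k fun p _ => ?_).trans ?_
    · exact Finset.card_image_le.trans (hf w l le_rfl _)
    · rw [sq]
      exact Nat.mul_le_mul_right _ (hf w y.1 hy.1.le _)
  · rw [Finset.card_product, Finset.card_range]

lemma card_not_mergesAvoid_le [NeZero n] {f : Fin n × Bool → Fin n} {l k : ℕ}
    (hf : FewPreimages f l k)
    {R : Set (Fin n × Bool)} {W : Finset (Fin n)} (hR : ∀ e ∈ R, e.1 ∈ W) :
    ((Finset.univ.filter fun x : Fin n × Fin n => ¬ MergesAvoid f R l x.1 x.2).card : ℝ) ≤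
      (Finset.univ.filter fun x : Fin n × Fin n => x.1 ≠ x.2 ∧
        (mergeCount f x.1 x.2 l : ℝ) ≤ 2 ^ l / n / 2).card + 4 * n * (l * W.card * k ^ 2 : ℕ) := by
  have hn : (0 : ℝ) < n := by exact_mod_cast Nat.pos_of_ne_zero (NeZero.ne n)
  set touch : Fin n × Fin n → Finset (Fin l → Bool) := fun x => Finset.univ.filter fun w =>
    MergesVia f (padWord w) W l x ∨ MergesVia f (padWord w) W l x.swap with htouch
  set T := Finset.univ.filter fun x : Fin n × Fin n => 2 ^ l / n / 2 < ((touch x).card : ℝ) ∨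
    ((touch x).card : ℝ) = 2 ^ l / n / 2 with hT
  have hsub : (Finset.univ.filter fun x : Fin n × Fin n => ¬ MergesAvoid f R l x.1 x.2) ⊆
      (Finset.univ.filter fun x : Fin n × Fin n => x.1 ≠ x.2 ∧
        (mergeCount f x.1 x.2 l : ℝ) ≤ 2 ^ l / n / 2) ∪ T := by
    rintro ⟨p, q⟩ h
    have h := (Finset.mem_filter.1 h).2
    by_contra hnot
    rw [Finset.mem_union, Finset.mem_filter, hT, Finset.mem_filter] at hnot
    push Not at hnot
    have hne : p ≠ q := by
      rintro rfl
      exact h ⟨[], by simp, trivial, trivial, rfl⟩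
    have h1 := hnot.1 (Finset.mem_univ _) hne
    have h2 := hnot.2 (Finset.mem_univ _)
    have h3 : (touch (p, q)).card < mergeCount f p q l := by
      have h2' := lt_of_le_of_ne h2.1 h2.2
      exact_mod_cast h2'.trans h1
    obtain ⟨w, hw, hwt⟩ := Finset.exists_mem_notMem_of_card_lt_card h3
    have hw := (Finset.mem_filter.1 hw).2
    rw [htouch, Finset.mem_filter] at hwt
    push Not at hwt
    have hwt := hwt (Finset.mem_univ _)
    unfold MergesVia at hwt
    simp only [Prod.swap] at hwt
    push Not at hwt
    have h4 := hwt.1 hw.2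
    have h5 := hwt.2 hw.2.symm
    refine h ⟨(List.range l).map (padWord w), by simp, ?_, ?_, ?_⟩
    · rw [along_map_range]
      exact fun s hs hR' => h4 s hs (hR _ hR')
    · rw [along_map_range]
      exact fun s hs hR' => h5 s hs (hR _ hR')
    · rw [run_map_range, run_map_range]; exact hw.2
  have hsum : (∑ x, (touch x).card) ≤ 2 ^ l * (2 * (l * W.card * k ^ 2)) := by
    have h1 : ∑ x, (touch x).card = ∑ w : Fin l → Bool, (Finset.univ.filter fun x : Fin n × Fin n =>
        MergesVia f (padWord w) W l x ∨ MergesVia f (padWord w) W l x.swap).card := by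
      simp only [htouch, Finset.card_filter]
      exact Finset.sum_comm
    rw [h1]
    refine (Finset.sum_le_card_nsmul _ _ (2 * (l * W.card * k ^ 2)) fun w _ => ?_).trans ?_
    · rw [Finset.filter_or]
      refine (Finset.card_union_le _ _).trans ?_
      have h2 := card_mergesVia_le hf w W
      have h3 : (Finset.univ.filter fun x : Fin n × Fin n =>
          MergesVia f (padWord w) W l x.swap).card ≤
          (Finset.univ.filter (MergesVia f (padWord w) W l)).card :=
        Finset.card_le_card_of_injOn Prod.swap (fun x hx => by simpa using hx)
          Prod.swap_injective.injOn
      omega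
    · simp
  have hTc : (T.card : ℝ) * (2 ^ l / n / 2) ≤ 2 ^ l * (2 * (l * W.card * k ^ 2 : ℕ)) := by
    calc (T.card : ℝ) * (2 ^ l / n / 2) = ∑ x ∈ T, (2 ^ l / n / 2 : ℝ) := by
          rw [Finset.sum_const, nsmul_eq_mul]
      _ ≤ ∑ x ∈ T, ((touch x).card : ℝ) := Finset.sum_le_sum fun x hx => by
          rcases (Finset.mem_filter.1 hx).2 with h | h
          · exact h.le
          · exact h.ge
      _ ≤ ∑ x, ((touch x).card : ℝ) :=
          Finset.sum_le_sum_of_subset_of_nonneg (Finset.subset_univ _) fun _ _ _ => by positivity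
      _ ≤ _ := by exact_mod_cast hsum
  have hTc' : (T.card : ℝ) ≤ 4 * n * (l * W.card * k ^ 2 : ℕ) := by
    have : (0 : ℝ) < 2 ^ l / n / 2 := by positivity
    refine le_of_mul_le_mul_right (hTc.trans (le_of_eq ?_)) this
    field_simp
    ring
  calc _ ≤ (((Finset.univ.filter fun x : Fin n × Fin n => x.1 ≠ x.2 ∧
        (mergeCount f x.1 x.2 l : ℝ) ≤ 2 ^ l / n / 2).card + T.card : ℕ) : ℝ) := by
        exact_mod_cast (Finset.card_le_card hsub).trans (Finset.card_union_le _ _)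
    _ ≤ _ := by push_cast at hTc' ⊢; linarith

end Avoid

/-! ### Testing several fresh pairs of states -/

section Tests

variable {n : ℕ}

/-- The edges with letter `false` leaving the states reached from `x` and `y` by the words
`u bⁱ`, `i < j`. -/
def testEdge (f : Fin n × Bool → Fin n) (x y : Fin n) (u : List Bool) (j : ℕ)
    (a : Fin j × Bool) : Fin n × Bool :=
  (run f (u ++ List.replicate a.1 true) (if a.2 then y else x), false)

/-- The test edges are distinct and are not used before. -/
def FreshTests (f : Fin n × Bool → Fin n) (x y : Fin n) (u : List Bool) (j : ℕ) : Prop :=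
  Function.Injective (testEdge f x y u j) ∧
    Along (Set.range (testEdge f x y u j))ᶜ f (u ++ List.replicate j true) x ∧
    Along (Set.range (testEdge f x y u j))ᶜ f (u ++ List.replicate j true) y

lemma Along.append_replicate {E : Set (Fin n × Bool)} {f : Fin n × Bool → Fin n} {x : Fin n}
    {u : List Bool} {j : ℕ} (h : Along E f (u ++ List.replicate j true) x) {i : ℕ} (hi : i ≤ j) :
    Along E f (u ++ List.replicate i true) x := by
  obtain ⟨k, rfl⟩ := Nat.exists_eq_add_of_le hi
  rw [List.replicate_add, ← List.append_assoc, along_append] at h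
  exact h.1

lemma FreshTests.congr {f g : Fin n × Bool → Fin n} {x y : Fin n} {u : List Bool} {j : ℕ}
    (h : FreshTests f x y u j) (hg : ∀ e ∉ Set.range (testEdge f x y u j), g e = f e) :
    testEdge g x y u j = testEdge f x y u j ∧ FreshTests g x y u j := by
  obtain ⟨h1, h2, h3⟩ := h
  have he : testEdge g x y u j = testEdge f x y u j := by
    funext a
    unfold testEdge
    congr 1
    split_ifs
    · exact ((h3.append_replicate a.1.2.le).congr hg).1
    · exact ((h2.append_replicate a.1.2.le).congr hg).1
  refine ⟨he, ?_⟩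
  unfold FreshTests
  rw [he]
  exact ⟨h1, (h2.congr hg).2, (h3.congr hg).2⟩

lemma pr_tests_fail_le (x y : Fin n) (u : List Bool) (j l : ℕ) (D : ℝ) (hD : 0 ≤ D) :
    pr (fun f => (FreshTests f x y u j ∧
      ((Finset.univ.filter fun z : Fin n × Fin n =>
        ¬ MergesAvoid f (Set.range (testEdge f x y u j)) l z.1 z.2).card : ℝ) ≤ D) ∧
      ∀ i : Fin j, ¬ MergesAvoid f (Set.range (testEdge f x y u j)) l
        (f (testEdge f x y u j (i, false))) (f (testEdge f x y u j (i, true)))) *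
      (n : ℝ) ^ (j * 2) ≤ D ^ j := by
  have key := pr_resample_family (α := Fin n × Bool) (β := Fin n) (ι := Fin j × Bool)
    (fun f => FreshTests f x y u j ∧
      ((Finset.univ.filter fun z : Fin n × Fin n =>
        ¬ MergesAvoid f (Set.range (testEdge f x y u j)) l z.1 z.2).card : ℝ) ≤ D)
    (fun f => testEdge f x y u j)
    (fun f v => ∀ i : Fin j, ¬ MergesAvoid f (Set.range (testEdge f x y u j)) l
        (v (i, false)) (v (i, true))) (D ^ j) (fun f hf => hf.1.1) ?_ ?_
  · simp only [Fintype.card_prod, Fintype.card_fin, Fintype.card_bool] at key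
    exact key.trans (mul_le_of_le_one_right (by positivity) (pr_le_one _))
  · intro f v hf
    set g := Function.extend (testEdge f x y u j) v f
    have hg : ∀ e ∉ Set.range (testEdge f x y u j), g e = f e := fun e he =>
      Function.extend_apply' _ _ _ (by simpa using he)
    obtain ⟨he, hF⟩ := hf.1.congr hg
    have hM : ∀ p q, MergesAvoid g (Set.range (testEdge f x y u j)) l p q ↔
        MergesAvoid f (Set.range (testEdge f x y u j)) l p q := fun p q =>
      ⟨fun h => h.congr fun e he => (hg e he).symm, fun h => h.congr hg⟩
    simp only [he, hM, and_true]
    exact ⟨hF, hf.2⟩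
  · intro f hf
    have hc : (Finset.univ.filter fun v : Fin j × Bool → Fin n => ∀ i : Fin j,
        ¬ MergesAvoid f (Set.range (testEdge f x y u j)) l (v (i, false)) (v (i, true))).card ≤
        (Fintype.piFinset fun _ : Fin j => Finset.univ.filter fun z : Fin n × Fin n =>
        ¬ MergesAvoid f (Set.range (testEdge f x y u j)) l z.1 z.2).card := by
      refine Finset.card_le_card_of_injOn (fun v i => (v (i, false), v (i, true)))
        (fun v hv => ?_) fun v _ v' _ h => ?_
      · simpa [Fintype.mem_piFinset] using hv
      · funext ⟨i, b⟩
        have := congrFun h i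
        simp only [Prod.mk.injEq] at this
        cases b
        · exact this.1
        · exact this.2
    rw [Fintype.card_piFinset, Finset.prod_const, Finset.card_univ, Fintype.card_fin] at hc
    refine le_trans (le_trans (le_of_eq ?_) (Nat.cast_le.2 hc)) ?_
    · congr!
    · rw [Nat.cast_pow]
      gcongr
      exact hf.2

lemma exists_merge_of_mergesAvoid {f : Fin n × Bool → Fin n} {x y : Fin n} {u : List Bool}
    {j l : ℕ} {i : Fin j} {R : Set (Fin n × Bool)}
    (h : MergesAvoid f R l (f (testEdge f x y u j (i, false))) (f (testEdge f x y u j (i, true)))) :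
    ∃ v : List Bool, v.length ≤ u.length + j + l ∧ run f v x = run f v y := by
  obtain ⟨v, hv, -, -, h⟩ := h
  refine ⟨u ++ List.replicate i true ++ false :: v, ?_, ?_⟩
  · have := i.2
    simp only [List.length_append, List.length_replicate, List.length_cons]
    omega
  · rw [run_append_s2, run_append_s2 _ (false :: v)]
    simpa [testEdge, run] using h

end Tests

/-! ### Small sets of states have few internal edges -/

section Sparse

variable {n : ℕ}

/-- Every set `S` of at most `m` states has at most `|S|` edges from `S` to `S`. -/
def Sparse (f : Fin n × Bool → Fin n) (m : ℕ) : Prop :=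
  ∀ S : Finset (Fin n), S.card ≤ m →
    (Finset.univ.filter fun e => e.1 ∈ S ∧ f e ∈ S).card ≤ S.card

lemma pr_forall_mem_le (D : Finset (Fin n × Bool)) (S : Finset (Fin n)) :
    pr (fun f : Fin n × Bool → Fin n => ∀ e ∈ D, f e ∈ S) * (n : ℝ) ^ D.card ≤
      (S.card : ℝ) ^ D.card := by
  have key := pr_resample_family (α := Fin n × Bool) (β := Fin n) (ι := D)
    (fun _ => True) (fun _ => Subtype.val) (fun _ v => ∀ e, v e ∈ S) ((S.card : ℝ) ^ D.card)
    (fun _ _ => Subtype.val_injective) (fun _ _ _ => ⟨trivial, rfl, rfl⟩) (fun _ _ => by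
      have : (Finset.univ.filter fun v : D → Fin n => ∀ e, v e ∈ S) =
          Fintype.piFinset fun _ => S := by ext; simp
      refine le_of_eq ?_
      trans (((Finset.univ.filter fun v : D → Fin n => ∀ e, v e ∈ S).card : ℕ) : ℝ)
      · congr!
      · rw [this, Fintype.card_piFinset]
        simp)
  simp only [true_and, Fintype.card_coe, Fintype.card_fin, Function.comp_apply,
    Subtype.forall] at key
  exact key.trans (mul_le_of_le_one_right (by positivity) (pr_le_one _))

lemma pr_not_sparse_le [NeZero n] (m : ℕ) :
    pr (fun f : Fin n × Bool → Fin n => ¬ Sparse f m) ≤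
      (m + 1) * (4 ^ m * (m + 1) ^ (m + 1)) / n := by
  have hn : (0 : ℝ) < n := by exact_mod_cast Nat.pos_of_ne_zero (NeZero.ne n)
  have h1 : ∀ f : Fin n × Bool → Fin n, ¬ Sparse f m → ∃ s ∈ Finset.range (m + 1),
      ∃ S ∈ Finset.powersetCard s Finset.univ,
        ∃ D ∈ Finset.powersetCard (s + 1) (S ×ˢ (Finset.univ : Finset Bool)),
          ∀ e ∈ D, f e ∈ S := by
    intro f hf
    unfold Sparse at hf
    push Not at hf
    obtain ⟨S, hS, hc⟩ := hf
    obtain ⟨D, hD, hDc⟩ := Finset.exists_subset_card_eq (Nat.succ_le_of_lt hc)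
    refine ⟨S.card, by simp; omega, S, by simp, D, ?_, fun e he => ?_⟩
    · rw [Finset.mem_powersetCard]
      refine ⟨fun e he => ?_, hDc⟩
      have := (Finset.mem_filter.1 (hD he)).2.1
      simp [this]
    · exact (Finset.mem_filter.1 (hD he)).2.2
  refine (pr_le_sum _ _ h1).trans ?_
  have h2 : ∀ s ∈ Finset.range (m + 1), pr (fun f : Fin n × Bool → Fin n =>
      ∃ S ∈ Finset.powersetCard s Finset.univ,
        ∃ D ∈ Finset.powersetCard (s + 1) (S ×ˢ (Finset.univ : Finset Bool)),
          ∀ e ∈ D, f e ∈ S) ≤ 4 ^ m * (m + 1) ^ (m + 1) / n := by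
    intro s hs
    rw [Finset.mem_range] at hs
    refine (pr_le_sum _ _ fun f hf => hf).trans ?_
    have h3 : ∀ S ∈ Finset.powersetCard s (Finset.univ : Finset (Fin n)),
        pr (fun f : Fin n × Bool → Fin n =>
          ∃ D ∈ Finset.powersetCard (s + 1) (S ×ˢ (Finset.univ : Finset Bool)),
          ∀ e ∈ D, f e ∈ S) ≤ 4 ^ m * ((m + 1) ^ (m + 1) / n ^ (s + 1)) := by
      intro S hS
      rw [Finset.mem_powersetCard] at hS
      refine (pr_le_sum _ _ fun f hf => hf).trans ?_
      refine (Finset.sum_le_card_nsmul _ _ ((m + 1 : ℝ) ^ (m + 1) / n ^ (s + 1))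
        fun D hD => ?_).trans ?_
      · rw [Finset.mem_powersetCard] at hD
        have h4 := pr_forall_mem_le D S
        rw [hD.2, hS.2] at h4
        rw [le_div_iff₀ (by positivity)]
        refine h4.trans ?_
        have h5 : (s : ℝ) ≤ m + 1 := by exact_mod_cast hs.le
        calc (s : ℝ) ^ (s + 1) ≤ ((m : ℝ) + 1) ^ (s + 1) := by gcongr
          _ ≤ _ := pow_le_pow_right₀ (by linarith [(Nat.cast_nonneg m : (0 : ℝ) ≤ m)])
            (by omega)
      · rw [nsmul_eq_mul]
        gcongr
        rw [Finset.card_powersetCard, Finset.card_product, hS.2, Finset.card_univ,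
          Fintype.card_bool]
        have h6 : (s * 2).choose (s + 1) ≤ 4 ^ m := by
          refine (Nat.choose_le_two_pow _ _).trans ?_
          rw [mul_comm, pow_mul]
          exact Nat.pow_le_pow_right (by norm_num) (by omega)
        exact_mod_cast h6
    refine (Finset.sum_le_card_nsmul _ _ _ h3).trans ?_
    rw [nsmul_eq_mul, Finset.card_powersetCard, Finset.card_univ, Fintype.card_fin]
    have h7 : ((n.choose s : ℕ) : ℝ) ≤ (n : ℝ) ^ s := by exact_mod_cast Nat.choose_le_pow n s
    calc _ ≤ (n : ℝ) ^ s * (4 ^ m * ((m + 1) ^ (m + 1) / n ^ (s + 1))) := by gcongr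
      _ = _ := by field_simp; ring
  refine (Finset.sum_le_card_nsmul _ _ _ h2).trans (le_of_eq ?_)
  rw [nsmul_eq_mul, Finset.card_range]
  push_cast
  ring

end Sparse

/-! ### Exploring a sparse automaton -/

section Exploration

variable {n : ℕ}

/-- `E` is a set of edges inside `S`, and exploring at most `m` further states does not reveal
more edges than states. -/
structure Tight (f : Fin n × Bool → Fin n) (S : Finset (Fin n)) (E : Finset (Fin n × Bool))
    (m : ℕ) : Prop where
  closed : ∀ e ∈ E, e.1 ∈ S ∧ f e ∈ S
  tight : ∀ S' E', S ⊆ S' → E ⊆ E' → (∀ e ∈ E', e.1 ∈ S' ∧ f e ∈ S') →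
    S'.card ≤ S.card + m → E'.card + S.card ≤ S'.card + E.card

/-- No edge leaving `z` belongs to `E`. -/
def Unexplored (E : Finset (Fin n × Bool)) (z : Fin n) : Prop := ∀ c, (z, c) ∉ E

variable {f : Fin n × Bool → Fin n} {S : Finset (Fin n)} {E : Finset (Fin n × Bool)} {m : ℕ}

lemma Tight.mono (h : Tight f S E m) {k : ℕ} (hk : k ≤ m) : Tight f S E k :=
  ⟨h.closed, fun S' E' h1 h2 h3 h4 => h.tight S' E' h1 h2 h3 (by omega)⟩

lemma Tight.run_mem (h : Tight f S E m) {v : List Bool} :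
    ∀ {x}, x ∈ S → Along (E : Set (Fin n × Bool)) f v x → run f v x ∈ S := by
  induction v with
  | nil => intro x hx _; exact hx
  | cons c v ih => intro x _ hv; exact ih (h.closed _ hv.1).2 hv.2

lemma Tight.notMem (h : Tight f S E m) {e : Fin n × Bool} (he : e ∉ E) (heS : e.1 ∈ S) :
    f e ∉ S := by
  intro hf
  have := h.tight S (insert e E) subset_rfl (Finset.subset_insert _ _) (fun a ha => by
    rcases Finset.mem_insert.1 ha with rfl | ha
    · exact ⟨heS, hf⟩
    · exact h.closed a ha) (by omega)
  rw [Finset.card_insert_of_notMem he] at this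
  omega

lemma Tight.add_edge (h : Tight f S E (m + 1)) {e : Fin n × Bool} (he : e ∉ E) (heS : e.1 ∈ S) :
    Tight f (insert (f e) S) (insert e E) m := by
  have hf := h.notMem he heS
  refine ⟨fun a ha => ?_, fun S' E' h1 h2 h3 h4 => ?_⟩
  · rcases Finset.mem_insert.1 ha with rfl | ha
    · exact ⟨Finset.mem_insert_of_mem heS, Finset.mem_insert_self _ _⟩
    · exact ⟨Finset.mem_insert_of_mem (h.closed a ha).1,
        Finset.mem_insert_of_mem (h.closed a ha).2⟩
  · rw [Finset.card_insert_of_notMem hf] at h4 ⊢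
    rw [Finset.card_insert_of_notMem he]
    have := h.tight S' E' ((Finset.subset_insert _ _).trans h1)
      ((Finset.subset_insert _ _).trans h2) h3 (by omega)
    omega

lemma Tight.unexplored_add_edge (h : Tight f S E m) {e : Fin n × Bool} (he : e ∉ E)
    (heS : e.1 ∈ S) : Unexplored (insert e E) (f e) := by
  have hf := h.notMem he heS
  intro c hc
  rcases Finset.mem_insert.1 hc with hc | hc
  · rw [← hc] at heS
    exact hf heS
  · exact hf (h.closed _ hc).1

/-- Following the same letter from two distinct states along unexplored edges. -/
lemma Tight.step_both (h : Tight f S E (m + 2)) {x y : Fin n} {c : Bool} (hxy : x ≠ y)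
    (hxS : x ∈ S) (hyS : y ∈ S) (hx : (x, c) ∉ E) (hy : (y, c) ∉ E) :
    ∃ S' E', E ⊆ E' ∧ Tight f S' E' m ∧ (x, c) ∈ E' ∧ (y, c) ∈ E' ∧ f (x, c) ≠ f (y, c) ∧
      f (x, c) ∈ S' ∧ f (y, c) ∈ S' ∧ Unexplored E' (f (x, c)) ∧ Unexplored E' (f (y, c)) := by
  have h1 := h.add_edge hx hxS
  have hy' : (y, c) ∉ insert (x, c) E := by
    simp only [Finset.mem_insert, Prod.mk.injEq, and_true, not_or]
    exact ⟨hxy.symm, hy⟩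
  have hyS' : (y, c).1 ∈ insert (f (x, c)) S := Finset.mem_insert_of_mem hyS
  have h2 := h1.add_edge hy' hyS'
  have hnx := h.notMem hx hxS
  have hny := h1.notMem hy' hyS'
  refine ⟨_, _, (Finset.subset_insert _ _).trans (Finset.subset_insert _ _), h2,
    by simp, by simp, fun he => hny (by simp [he]), by simp, by simp, ?_,
    h1.unexplored_add_edge hy' hyS'⟩
  intro d hd
  rcases Finset.mem_insert.1 hd with hd | hd
  · rw [Prod.mk.injEq] at hd
    rw [hd.1] at hnx
    exact hnx hyS
  · exact h.unexplored_add_edge hx hxS d hd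

lemma st_const_succ (w : Bool) (x : Fin n) (i : ℕ) :
    st f (fun _ => w) x (i + 1) = st f (fun _ => w) (f (x, w)) i := by
  induction i with
  | zero => rfl
  | succ i ih => rw [st, ih]; rfl

/-- From two distinct unexplored states, reading a power of a letter discovers only new states. -/
lemma Tight.separated (j : ℕ) : ∀ {S : Finset (Fin n)} {E : Finset (Fin n × Bool)} {x y : Fin n},
    Tight f S E (2 * j) → x ≠ y → x ∈ S → y ∈ S → Unexplored E x → Unexplored E y →
    Separated (st f (fun _ => true) x) (st f (fun _ => true) y) j ∧
      ∀ i < j, Unexplored E (st f (fun _ => true) x i) ∧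
        Unexplored E (st f (fun _ => true) y i) := by
  induction j with
  | zero => intro S E x y _ _ _ _ _ _; exact ⟨fun s hs => absurd hs (by omega), by omega⟩
  | succ j ih =>
    intro S E x y h hxy hxS hyS hx hy
    obtain ⟨S', E', hE, hT, hxE, hyE, hne, hxS', hyS', hx', hy'⟩ :=
      Tight.step_both (m := 2 * j) h hxy hxS hyS (hx true) (hy true)
    obtain ⟨h1, h2⟩ := ih hT hne hxS' hyS' hx' hy'
    refine ⟨?_, ?_⟩
    · intro s hs t ht
      rcases s with _ | s <;> rcases t with _ | t
      · exact ⟨fun h => absurd rfl h, hxy⟩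
      · rw [st_const_succ, st_const_succ]
        have := h2 t (by omega)
        refine ⟨fun _ => ⟨fun he => this.1 true ?_, fun he => this.2 true ?_⟩,
          fun he => this.2 true ?_⟩
        · rw [← he]; exact hxE
        · rw [← he]; exact hyE
        · rw [← he]; exact hxE
      · rw [st_const_succ, st_const_succ]
        have := h2 s (by omega)
        refine ⟨fun _ => ⟨fun he => this.1 true ?_, fun he => this.2 true ?_⟩,
          fun he => this.1 true ?_⟩
        · rw [he]; exact hxE
        · rw [he]; exact hyE
        · rw [he]; exact hyE
      · simp only [st_const_succ]
        have := h1 s (by omega) t (by omega)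
        exact ⟨fun hst => this.1 (by omega), this.2⟩
    · intro i hi
      rcases i with _ | i
      · exact ⟨hx, hy⟩
      · rw [st_const_succ, st_const_succ]
        have := h2 i (by omega)
        exact ⟨fun c hc => this.1 c (hE hc), fun c hc => this.2 c (hE hc)⟩

/-- In a sparse automaton one can leave the explored edges from every state. -/
lemma exists_exit (hsp : Sparse f S.card) (hE : ∀ e ∈ E, e.1 ∈ S ∧ f e ∈ S) {x : Fin n}
    (hx : x ∈ S) : ∃ v : List Bool, v.length ≤ S.card ∧ Along (E : Set (Fin n × Bool)) f v x ∧
      ∃ c, (run f v x, c) ∉ E := by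
  by_contra hno
  push Not at hno
  have key : ∀ i ≤ S.card, ∃ R ⊆ S, R.card = i + 1 ∧ ∀ r ∈ R, ∃ v : List Bool, v.length ≤ i ∧
      Along (E : Set (Fin n × Bool)) f v x ∧ run f v x = r := by
    intro i
    induction i with
    | zero =>
      intro _
      refine ⟨{x}, by simpa using hx, by simp, fun r hr => ⟨[], by simp, trivial, ?_⟩⟩
      rw [Finset.mem_singleton.1 hr]; rfl
    | succ i ih =>
      intro hi
      obtain ⟨R, hRS, hRc, hR⟩ := ih (by omega)
      have hRE : ∀ r ∈ R, ∀ c, (r, c) ∈ E := by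
        intro r hr c
        obtain ⟨v, hv, ha, rfl⟩ := hR r hr
        exact hno v (by omega) ha c
      have hout : ∃ r ∈ R, ∃ c, f (r, c) ∉ R := by
        by_contra hcl
        push Not at hcl
        have h1 := hsp R (Finset.card_le_card hRS)
        have h2 : R ×ˢ (Finset.univ : Finset Bool) ⊆
            Finset.univ.filter fun e => e.1 ∈ R ∧ f e ∈ R := by
          rintro ⟨r, c⟩ hrc
          have hr := (Finset.mem_product.1 hrc).1
          simp only [Finset.mem_filter, Finset.mem_univ, true_and]
          exact ⟨hr, hcl r hr c⟩
        have h3 := Finset.card_le_card h2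
        rw [Finset.card_product, Finset.card_univ, Fintype.card_bool] at h3
        omega
      obtain ⟨r, hr, c, hrc⟩ := hout
      refine ⟨insert (f (r, c)) R, ?_, by rw [Finset.card_insert_of_notMem hrc, hRc], ?_⟩
      · exact Finset.insert_subset (hE _ (hRE r hr c)).2 hRS
      · intro r' hr'
        rcases Finset.mem_insert.1 hr' with rfl | hr'
        · obtain ⟨v, hv, ha, hv'⟩ := hR r hr
          refine ⟨v ++ [c], by simp; omega, ?_, ?_⟩
          · rw [along_append]
            refine ⟨ha, ?_, trivial⟩
            rw [hv']; exact hRE r hr c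
          · rw [run_append_s2, hv']; rfl
        · obtain ⟨v, hv, ha⟩ := hR r' hr'
          exact ⟨v, by omega, ha⟩
  obtain ⟨R, hRS, hRc, -⟩ := key S.card le_rfl
  have := Finset.card_le_card hRS
  omega

/-- Reading a word from an unexplored state discovers only new states. -/
lemma Tight.walk (v : List Bool) : ∀ {S : Finset (Fin n)} {E : Finset (Fin n × Bool)} {x : Fin n}
    {m : ℕ}, Tight f S E (m + v.length) → x ∈ S → Unexplored E x →
    ∃ S' E', S ⊆ S' ∧ E ⊆ E' ∧ Tight f S' E' m ∧ Along (E' : Set (Fin n × Bool)) f v x ∧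
      run f v x ∈ S' ∧ Unexplored E' (run f v x) ∧ (v ≠ [] → run f v x ∉ S) ∧
      ∀ e ∈ E', e ∈ E ∨ e.1 ∉ S ∨ (e.1 = x ∧ v.head? = some e.2) := by
  induction v with
  | nil =>
    intro S E x m h hx hu
    exact ⟨S, E, subset_rfl, subset_rfl, h, trivial, hx, hu, fun h => absurd rfl h,
      fun e he => Or.inl he⟩
  | cons c v ih =>
    intro S E x m h hx hu
    have hnot := h.notMem (hu c) hx
    obtain ⟨S', E', hS, hE, hT, hA, hS', hU, hn, hs⟩ :=
      ih (Tight.add_edge (m := m + v.length) h (hu c) hx) (Finset.mem_insert_self _ _)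
        (h.unexplored_add_edge (hu c) hx)
    refine ⟨S', E', (Finset.subset_insert _ _).trans hS, (Finset.subset_insert _ _).trans hE, hT,
      ⟨hE (Finset.mem_insert_self _ _), hA⟩, hS', hU, fun _ hm => ?_, fun e he => ?_⟩
    · by_cases hv : v = []
      · subst hv; exact hnot hm
      · exact hn hv (Finset.mem_insert_of_mem hm)
    · rcases hs e he with h1 | h1 | h1
      · rcases Finset.mem_insert.1 h1 with rfl | h1
        · exact Or.inr (Or.inr ⟨rfl, rfl⟩)
        · exact Or.inl h1
      · exact Or.inr (Or.inl fun h => h1 (Finset.mem_insert_of_mem h))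
      · refine Or.inr (Or.inl ?_)
        rw [h1.1]; exact hnot

/-- If one of two states is unexplored, some word leads both of them to distinct unexplored
states. -/
lemma Tight.exists_both_of_unexplored (h : Tight f S E (m + 2 + S.card)) (hsp : Sparse f S.card)
    {x y : Fin n} (hxy : x ≠ y) (hxS : x ∈ S) (hyS : y ∈ S) (hx : Unexplored E x) :
    ∃ v S' E', v.length ≤ S.card + 1 ∧ E ⊆ E' ∧ Tight f S' E' m ∧
      Along (E' : Set (Fin n × Bool)) f v x ∧ Along (E' : Set (Fin n × Bool)) f v y ∧
      run f v x ≠ run f v y ∧ run f v x ∈ S' ∧ run f v y ∈ S' ∧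
      Unexplored E' (run f v x) ∧ Unexplored E' (run f v y) := by
  obtain ⟨v, hv, hA, c, hc⟩ := exists_exit hsp h.closed hyS
  have hT : Tight f S E (m + 2 + v.length) := h.mono (by omega)
  obtain ⟨S₂, E₂, hS₂, hE₂, hT₂, hA₂, hxS₂, hU₂, hn, hs⟩ := hT.walk v hxS hx
  have hyS₁ := hT.run_mem hyS hA
  have hfin : run f v x ≠ run f v y ∧ ∃ c, (run f v y, c) ∉ E₂ := by
    by_cases hv0 : v = []
    · subst hv0
      refine ⟨hxy, c, fun hm => ?_⟩
      rcases hs _ hm with h1 | h1 | h1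
      · exact hc h1
      · exact h1 hyS
      · exact hxy h1.1.symm
    · refine ⟨fun he => hn hv0 (he ▸ hyS₁), ?_⟩
      by_cases hyx : run f v y = x
      · obtain ⟨a, v', rfl⟩ := List.exists_cons_of_ne_nil hv0
        refine ⟨!a, fun hm => ?_⟩
        rcases hs _ hm with h1 | h1 | h1
        · rw [hyx] at h1; exact hx _ h1
        · exact h1 hyS₁
        · simp at h1
      · refine ⟨c, fun hm => ?_⟩
        rcases hs _ hm with h1 | h1 | h1
        · exact hc h1
        · exact h1 hyS₁
        · exact hyx h1.1
  obtain ⟨hne, c, hc⟩ := hfin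
  obtain ⟨S', E', hE, hT', hxE, hyE, hne', hxS', hyS', hx', hy'⟩ :=
    hT₂.step_both hne hxS₂ (hS₂ hyS₁) (hU₂ c) hc
  refine ⟨v ++ [c], S', E', by simp; omega, hE₂.trans hE, hT', ?_, ?_, ?_⟩
  · rw [along_append]
    exact ⟨hA₂.mono (by exact_mod_cast hE), hxE, trivial⟩
  · rw [along_append]
    exact ⟨hA.mono (by exact_mod_cast hE₂.trans hE), hyE, trivial⟩
  · rw [run_append_s2, run_append_s2]
    exact ⟨hne', hxS', hyS', hx', hy'⟩

lemma exists_first_exit {E : Set (Fin n × Bool)} (v : List Bool) : ∀ {x y : Fin n},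
    ¬ (Along E f v x ∧ Along E f v y) → ∃ u c, u.length < v.length ∧ Along E f u x ∧
      Along E f u y ∧ ((run f u x, c) ∉ E ∨ (run f u y, c) ∉ E) := by
  induction v with
  | nil => intro x y h; exact absurd ⟨trivial, trivial⟩ h
  | cons c v ih =>
    intro x y h
    by_cases hc : (x, c) ∈ E ∧ (y, c) ∈ E
    · obtain ⟨u, d, hu, h1, h2, h3⟩ := ih (x := f (x, c)) (y := f (y, c))
        fun h' => h ⟨⟨hc.1, h'.1⟩, hc.2, h'.2⟩
      exact ⟨c :: u, d, by simpa using hu, ⟨hc.1, h1⟩, ⟨hc.2, h2⟩, h3⟩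
    · exact ⟨[], c, by simp, trivial, trivial, not_and_or.1 hc⟩

/-- If two states are not merged by a short word, some word leads them to distinct unexplored
states. -/
lemma Tight.exists_both (h : Tight f S E (m + 4 + S.card)) (hsp : Sparse f (S.card + 1))
    {x y : Fin n} (hxS : x ∈ S) (hyS : y ∈ S)
    (hne : ∀ v : List Bool, v.length ≤ S.card → run f v x ≠ run f v y) :
    ∃ v S' E', v.length ≤ 2 * S.card + 3 ∧ Tight f S' E' m ∧
      Along (E' : Set (Fin n × Bool)) f v x ∧ Along (E' : Set (Fin n × Bool)) f v y ∧
      run f v x ≠ run f v y ∧ run f v x ∈ S' ∧ run f v y ∈ S' ∧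
      Unexplored E' (run f v x) ∧ Unexplored E' (run f v y) := by
  have hsp' : Sparse f S.card := fun R hR => hsp R (by omega)
  obtain ⟨v, hv, hA, c, hc⟩ := exists_exit hsp' h.closed hxS
  obtain ⟨u, a, hu, hux, huy, hua⟩ := exists_first_exit (E := (E : Set (Fin n × Bool)))
    (v ++ [c]) (x := x) (y := y) (fun h' => by
      have := (along_append v [c] x).1 h'.1
      exact hc this.2.1)
  simp only [List.length_append, List.length_singleton] at hu
  have hne' := hne u (by omega)
  have hX := h.run_mem hxS hux
  have hY := h.run_mem hyS huy
  have one : ∀ {x y : Fin n}, run f u x ≠ run f u y → run f u x ∈ S → run f u y ∈ S →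
      Along (E : Set (Fin n × Bool)) f u x → Along (E : Set (Fin n × Bool)) f u y →
      (run f u x, a) ∉ E → (run f u y, a) ∈ E →
      ∃ v S' E', v.length ≤ 2 * S.card + 3 ∧ Tight f S' E' m ∧
      Along (E' : Set (Fin n × Bool)) f v x ∧ Along (E' : Set (Fin n × Bool)) f v y ∧
      run f v x ≠ run f v y ∧ run f v x ∈ S' ∧ run f v y ∈ S' ∧
      Unexplored E' (run f v x) ∧ Unexplored E' (run f v y) := by
    intro x y _ hX hY hux huy hxa hya
    have hnot := h.notMem hxa hX
    have hY' := (h.closed _ hya).2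
    have hcard : (insert (f (run f u x, a)) S).card = S.card + 1 :=
      Finset.card_insert_of_notMem hnot
    have hT : Tight f (insert (f (run f u x, a)) S) (insert (run f u x, a) E)
        (m + 2 + (insert (f (run f u x, a)) S).card) := by
      rw [hcard]
      exact Tight.add_edge (h.mono (by omega)) hxa hX
    obtain ⟨v, S', E', hv, hE, hT', h1, h2, h3⟩ := hT.exists_both_of_unexplored
      (by rwa [hcard]) (x := f (run f u x, a)) (y := f (run f u y, a))
      (fun he => hnot (he ▸ hY')) (Finset.mem_insert_self _ _) (Finset.mem_insert_of_mem hY')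
      (h.unexplored_add_edge hxa hX)
    have hE' : (E : Set (Fin n × Bool)) ⊆ E' := by
      exact_mod_cast (Finset.subset_insert _ _).trans hE
    rw [hcard] at hv
    refine ⟨u ++ a :: v, S', E', by simp; omega, hT', ?_, ?_, ?_⟩
    · rw [along_append]
      exact ⟨hux.mono hE', hE (Finset.mem_insert_self _ _), h1⟩
    · rw [along_append]
      exact ⟨huy.mono hE', hE' hya, h2⟩
    · rw [run_append_s2, run_append_s2]
      exact h3
  simp only [Finset.mem_coe] at hua
  by_cases hxa : (run f u x, a) ∈ E
  · have hya := hua.resolve_left (not_not.2 hxa)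
    obtain ⟨v, S', E', hv, hT, h1, h2, h3, h4, h5, h6, h7⟩ := one hne'.symm hY hX huy hux hya hxa
    exact ⟨v, S', E', hv, hT, h2, h1, h3.symm, h5, h4, h7, h6⟩
  by_cases hya : (run f u y, a) ∈ E
  · exact one hne' hX hY hux huy hxa hya
  obtain ⟨S', E', hE, hT', hxE, hyE, hne'', hxS', hyS', hx', hy'⟩ :=
    Tight.step_both (m := m) (h.mono (by omega)) hne' hX hY hxa hya
  have hE' : (E : Set (Fin n × Bool)) ⊆ E' := by exact_mod_cast hE
  refine ⟨u ++ [a], S', E', by simp; omega, hT', ?_, ?_, ?_⟩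
  · rw [along_append]
    exact ⟨hux.mono hE', hxE, trivial⟩
  · rw [along_append]
    exact ⟨huy.mono hE', hyE, trivial⟩
  · rw [run_append_s2, run_append_s2]
    exact ⟨hne'', hxS', hyS', hx', hy'⟩

/-- In a sparse automaton, the exploration can be made tight by adding a bounded number of
states. -/
lemma exists_tight (c : ℕ) (hsp : Sparse f (8 * (2 + c))) {x y : Fin n} (hxy : x ≠ y) :
    ∃ S E, x ∈ S ∧ y ∈ S ∧ S.card ≤ 4 * (2 + c) ∧ Tight f S E (c + S.card) := by
  by_contra hno
  have key : ∀ k ≤ 3, ∃ S : Finset (Fin n), ∃ E : Finset (Fin n × Bool), x ∈ S ∧ y ∈ S ∧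
      (∀ e ∈ E, e.1 ∈ S ∧ f e ∈ S) ∧ S.card + c ≤ 2 ^ k * (2 + c) ∧
      S.card + k ≤ E.card + 2 := by
    intro k
    induction k with
    | zero =>
      intro _
      exact ⟨{x, y}, ∅, by simp, by simp, by simp, by rw [Finset.card_pair hxy]; omega,
        by rw [Finset.card_pair hxy]; omega⟩
    | succ k ih =>
      intro hk
      obtain ⟨S, E, hx, hy, hE, hS, hSE⟩ := ih (by omega)
      have hk4 : 2 ^ k * (2 + c) ≤ 2 ^ 2 * (2 + c) :=
        Nat.mul_le_mul_right _ (Nat.pow_le_pow_right (by norm_num) (by omega))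
      have hnt : ¬ Tight f S E (c + S.card) := fun h =>
        hno ⟨S, E, hx, hy, by omega, h⟩
      have hex : ∃ S' E', S ⊆ S' ∧ E ⊆ E' ∧ (∀ e ∈ E', e.1 ∈ S' ∧ f e ∈ S') ∧
          S'.card ≤ S.card + (c + S.card) ∧ S'.card + E.card < E'.card + S.card := by
        by_contra hne
        push Not at hne
        exact hnt ⟨hE, fun S' E' h1 h2 h3 h4 => hne S' E' h1 h2 h3 h4⟩
      obtain ⟨S', E', h1, h2, h3, h4, h5⟩ := hex
      refine ⟨S', E', h1 hx, h1 hy, h3, ?_, by omega⟩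
      rw [pow_succ]
      have : 2 ^ k * 2 * (2 + c) = 2 * (2 ^ k * (2 + c)) := by ring
      omega
  obtain ⟨S, E, -, -, hE, hS, hSE⟩ := key 3 le_rfl
  have h1 := hsp S (by omega)
  have h2 : E.card ≤ (Finset.univ.filter fun e => e.1 ∈ S ∧ f e ∈ S).card :=
    Finset.card_le_card fun e he => by simpa using hE e he
  omega

/-- In a sparse automaton, fresh tests exist for every pair of states that is not merged by a
short word. -/
lemma exists_freshTests (j : ℕ) (hsp : Sparse f (8 * (2 * j + 6))) {x y : Fin n}
    (hne : ∀ v : List Bool, v.length ≤ 4 * (2 * j + 6) → run f v x ≠ run f v y) :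
    ∃ u : List Bool, u.length ≤ 8 * (2 * j + 6) + 3 ∧ FreshTests f x y u j := by
  obtain ⟨S, E, hxS, hyS, hS, hT⟩ := exists_tight (f := f) (2 * j + 4)
    (by convert hsp using 1; ring) (hne [] (by simp))
  obtain ⟨u, S', E', hu, hT', hux, huy, hne', hX, hY, hUX, hUY⟩ := hT.exists_both
    (fun R hR => hsp R (by omega)) hxS hyS fun v hv => hne v (by omega)
  obtain ⟨hsep, hunex⟩ := Tight.separated j hT' hne' hX hY hUX hUY
  have hrun : ∀ i z, run f (u ++ List.replicate i true) z =
      st f (fun _ => true) (run f u z) i := by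
    intro i z
    rw [run_append_s2, ← run_map_range, List.map_const', List.length_range]
  have htest : ∀ a, testEdge f x y u j a ∉ E' := by
    rintro ⟨i, s⟩
    unfold testEdge
    rw [hrun]
    cases s
    · exact (hunex i i.2).1 false
    · exact (hunex i i.2).2 false
  have halong : ∀ z, Along (E' : Set (Fin n × Bool)) f u z →
      Along (Set.range (testEdge f x y u j))ᶜ f (u ++ List.replicate j true) z := by
    intro z hz
    rw [along_append]
    refine ⟨hz.mono ?_, ?_⟩
    · rintro e he ⟨a, rfl⟩
      exact htest a he
    · have : List.replicate j true = (List.range j).map fun _ => true := by simp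
      rw [this, along_map_range]
      rintro s _ ⟨a, ha⟩
      simp [testEdge] at ha
  refine ⟨u, by omega, ?_, halong x hux, halong y huy⟩
  rintro ⟨i, s⟩ ⟨i', s'⟩ h
  simp only [testEdge, Prod.mk.injEq, and_true, hrun] at h
  rw [Prod.mk.injEq, Fin.ext_iff]
  by_contra hcon
  have h1 := hsep i i.2 i' i'.2
  have h2 := hsep i' i'.2 i i.2
  cases s <;> cases s'
  · exact (h1.1 (by simpa using hcon)).1 h
  · exact h1.2 h
  · exact h2.2 h.symm
  · exact (h1.1 (by simpa using hcon)).2 h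

end Exploration

/-! ### Synchronization of all pairs -/

section Synchronization

variable {n : ℕ} [NeZero n]

lemma pr_not_fewPreimages_le {l k : ℕ} (hl : 2 ^ l ≤ n ^ 2) (hk : n ≤ k ^ 4) :
    pr (fun f : Fin n × Bool → Fin n => ¬ FewPreimages f l k) ≤
      (l + 1) * (((16 * (l + 1) + 1) * (l + 1) : ℕ) : ℝ) ^ 16 / n := by
  have hn : (0 : ℝ) < n := by exact_mod_cast Nat.pos_of_ne_zero (NeZero.ne n)
  set B : ℝ := (((16 * (l + 1) + 1) * (l + 1) : ℕ) : ℝ) ^ 16 with hB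
  have hB0 : 0 ≤ B := by positivity
  have h1 : ∀ f : Fin n × Bool → Fin n, ¬ FewPreimages f l k →
      ∃ i ∈ (Finset.univ : Finset (Fin l → Bool)) ×ˢ
        (Finset.range (l + 1) ×ˢ (Finset.univ : Finset (Fin n))),
        (k : ℝ) ≤ preCount (padWord i.1) i.2.1 i.2.2 f := by
    intro f hf
    unfold FewPreimages at hf
    push Not at hf
    obtain ⟨w, t, ht, z, h⟩ := hf
    exact ⟨(w, t, z), by simp; omega, by exact_mod_cast h.le⟩
  refine (pr_le_sum _ _ h1).trans ?_
  have h2 : ∀ i ∈ (Finset.univ : Finset (Fin l → Bool)) ×ˢ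
        (Finset.range (l + 1) ×ˢ (Finset.univ : Finset (Fin n))),
      pr (fun f : Fin n × Bool → Fin n =>
        (k : ℝ) ≤ preCount (padWord i.1) i.2.1 i.2.2 f) ≤ B / n ^ 4 := by
    rintro ⟨w, t, z⟩ hi
    simp only [Finset.mem_product, Finset.mem_range, Finset.mem_univ, true_and, and_true] at hi
    have h3 := pr_preCount_ge_le (padWord w) t z 16 (k : ℝ) (by positivity)
    rw [le_div_iff₀ (by positivity), mul_comm]
    refine le_trans ?_ (h3.trans ?_)
    · have h4 : (n : ℝ) ^ 4 ≤ (k : ℝ) ^ 16 := by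
        have : n ^ 4 ≤ (k ^ 4) ^ 4 := Nat.pow_le_pow_left hk 4
        rw [← pow_mul] at this
        exact_mod_cast this
      exact mul_le_mul_of_nonneg_right h4 (pr_nonneg _)
    · rw [hB]
      have h5 : (16 * (t + 1) + 1) * (t + 1) ≤ (16 * (l + 1) + 1) * (l + 1) :=
        Nat.mul_le_mul (by omega) (by omega)
      have h6 : (((16 * (t + 1) + 1) * (t + 1) : ℕ) : ℝ) ≤
        (((16 * (l + 1) + 1) * (l + 1) : ℕ) : ℝ) := by exact_mod_cast h5
      gcongr
  refine (Finset.sum_le_card_nsmul _ _ _ h2).trans ?_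
  rw [nsmul_eq_mul, Finset.card_product, Finset.card_product, Finset.card_univ, Finset.card_univ,
    Finset.card_range, Fintype.card_fun, Fintype.card_bool, Fintype.card_fin, Fintype.card_fin]
  have h7 : ((2 ^ l * ((l + 1) * n) : ℕ) : ℝ) ≤ (n : ℝ) ^ 2 * ((l + 1) * n) := by
    have : (2 : ℝ) ^ l ≤ (n : ℝ) ^ 2 := by exact_mod_cast hl
    push_cast
    gcongr
  calc _ ≤ (n : ℝ) ^ 2 * ((l + 1) * n) * (B / n ^ 4) := by gcongr
    _ = _ := by field_simp

/-- The number of pairs of states that are merged by few words. -/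
noncomputable def badPairs (f : Fin n × Bool → Fin n) (l : ℕ) : ℕ :=
  (Finset.univ.filter fun x : Fin n × Fin n => x.1 ≠ x.2 ∧
    (mergeCount f x.1 x.2 l : ℝ) ≤ 2 ^ l / n / 2).card

lemma pr_badPairs_le (m : ℕ) (hm : (n : ℝ) ^ 2 ≤ 4 * 2 ^ (m + 1)) (T : ℝ) :
    T * pr (fun f : Fin n × Bool → Fin n => T ≤ badPairs f (m + 1)) ≤
      n * (4 * ((2 * m + 5 : ℕ) : ℝ) ^ 4) := by
  have hn : (0 : ℝ) < n := by exact_mod_cast Nat.pos_of_ne_zero (NeZero.ne n)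
  refine (mul_pr_le_ex (g := fun f => (badPairs f (m + 1) : ℝ)) (fun f => by positivity)
    fun f h => h).trans ?_
  have h1 : (fun f : Fin n × Bool → Fin n => (badPairs f (m + 1) : ℝ)) = fun f =>
      ∑ x : Fin n × Fin n, if x.1 ≠ x.2 ∧
        (mergeCount f x.1 x.2 (m + 1) : ℝ) ≤ 2 ^ (m + 1) / n / 2 then (1 : ℝ) else 0 := by
    funext f
    rw [Finset.sum_boole]
    unfold badPairs
    congr!
  rw [h1, ex_sum]
  have h2 : ∀ x ∈ (Finset.univ : Finset (Fin n × Fin n)),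
      ex (fun f : Fin n × Bool → Fin n => if x.1 ≠ x.2 ∧
        (mergeCount f x.1 x.2 (m + 1) : ℝ) ≤ 2 ^ (m + 1) / n / 2 then (1 : ℝ) else 0) ≤
      4 * ((2 * m + 5 : ℕ) : ℝ) ^ 4 / n := by
    intro x _
    rw [ex_ite]
    by_cases hx : x.1 = x.2
    · have : pr (fun f : Fin n × Bool → Fin n => x.1 ≠ x.2 ∧
        (mergeCount f x.1 x.2 (m + 1) : ℝ) ≤ 2 ^ (m + 1) / n / 2) = 0 := by
        rw [pr_eq]; simp [hx]
      rw [this]; positivity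
    · exact (pr_mono fun f h => h.2).trans (pr_mergeCount_le hx m hm)
  refine (Finset.sum_le_card_nsmul _ _ _ h2).trans (le_of_eq ?_)
  rw [nsmul_eq_mul, Finset.card_univ, Fintype.card_prod, Fintype.card_fin]
  push_cast
  field_simp

/-- The words of length at most `d`. -/
noncomputable def shortWords (d : ℕ) : Finset (List Bool) :=
  (List.finite_length_le Bool d).toFinset

/-- Some fresh family of `j` tests after a word of length at most `d` fails, although at most `D`
pairs of states would fail. -/
def TestsFail (f : Fin n × Bool → Fin n) (j l d : ℕ) (D : ℝ) : Prop :=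
  ∃ x y, ∃ u : List Bool, u.length ≤ d ∧ (FreshTests f x y u j ∧
    ((Finset.univ.filter fun z : Fin n × Fin n =>
      ¬ MergesAvoid f (Set.range (testEdge f x y u j)) l z.1 z.2).card : ℝ) ≤ D) ∧
    ∀ i : Fin j, ¬ MergesAvoid f (Set.range (testEdge f x y u j)) l
      (f (testEdge f x y u j (i, false))) (f (testEdge f x y u j (i, true)))

lemma pr_testsFail_le (j l d : ℕ) {D : ℝ} (hD : 0 ≤ D) :
    pr (fun f : Fin n × Bool → Fin n => TestsFail f j l d D) ≤
      n ^ 2 * (shortWords d).card * (D ^ j / n ^ (j * 2)) := by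
  have hn : (0 : ℝ) < n := by exact_mod_cast Nat.pos_of_ne_zero (NeZero.ne n)
  refine (pr_le_sum ((Finset.univ : Finset (Fin n × Fin n)) ×ˢ shortWords d)
    (fun i f => (FreshTests f i.1.1 i.1.2 i.2 j ∧
      ((Finset.univ.filter fun z : Fin n × Fin n =>
        ¬ MergesAvoid f (Set.range (testEdge f i.1.1 i.1.2 i.2 j)) l z.1 z.2).card : ℝ) ≤ D) ∧
      ∀ a : Fin j, ¬ MergesAvoid f (Set.range (testEdge f i.1.1 i.1.2 i.2 j)) l
        (f (testEdge f i.1.1 i.1.2 i.2 j (a, false)))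
        (f (testEdge f i.1.1 i.1.2 i.2 j (a, true)))) ?_).trans ?_
  · rintro f ⟨x, y, u, hu, h⟩
    exact ⟨((x, y), u), by simpa [shortWords] using hu, h⟩
  · refine (Finset.sum_le_card_nsmul _ _ (D ^ j / n ^ (j * 2)) fun i _ => ?_).trans ?_
    · rw [le_div_iff₀ (by positivity)]
      exact pr_tests_fail_le i.1.1 i.1.2 i.2 j l D hD
    · rw [nsmul_eq_mul, Finset.card_product, Finset.card_univ, Fintype.card_prod,
        Fintype.card_fin]
      push_cast
      rw [← pow_two]

/-- The bound on the number of pairs of states that would fail a test. -/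
def testBound (n j l k : ℕ) : ℝ := k ^ 7 + 4 * n * (l * (2 * j) * k ^ 2 : ℕ)

lemma exists_merging_word {f : Fin n × Bool → Fin n} {j l k : ℕ}
    (hsp : Sparse f (8 * (2 * j + 6))) (hf : FewPreimages f l k)
    (hb : (badPairs f l : ℝ) ≤ k ^ 7)
    (ht : ¬ TestsFail f j l (8 * (2 * j + 6) + 3) (testBound n j l k)) (x y : Fin n) :
    ∃ v : List Bool, v.length ≤ 8 * (2 * j + 6) + 3 + j + l ∧ run f v x = run f v y := by
  by_cases hne : ∀ v : List Bool, v.length ≤ 4 * (2 * j + 6) → run f v x ≠ run f v y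
  · obtain ⟨u, hu, hfr⟩ := exists_freshTests j hsp hne
    set W : Finset (Fin n) := Finset.univ.image fun a => (testEdge f x y u j a).1 with hW
    have hWc : W.card ≤ 2 * j := by
      refine Finset.card_image_le.trans (le_of_eq ?_)
      rw [Finset.card_univ, Fintype.card_prod, Fintype.card_fin, Fintype.card_bool, mul_comm]
    have hD := card_not_mergesAvoid_le hf (R := Set.range (testEdge f x y u j)) (W := W)
      (by rintro _ ⟨a, rfl⟩; exact Finset.mem_image_of_mem _ (Finset.mem_univ a))
    have hD' : ((Finset.univ.filter fun z : Fin n × Fin n =>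
        ¬ MergesAvoid f (Set.range (testEdge f x y u j)) l z.1 z.2).card : ℝ) ≤
        testBound n j l k := by
      refine hD.trans (add_le_add hb ?_)
      have : l * W.card * k ^ 2 ≤ l * (2 * j) * k ^ 2 := by gcongr
      gcongr
    by_contra hno
    refine ht ⟨x, y, u, hu, ⟨hfr, hD'⟩, fun i hi => hno ?_⟩
    obtain ⟨v, hv, h⟩ := exists_merge_of_mergesAvoid hi
    exact ⟨v, by omega, h⟩
  · push Not at hne
    obtain ⟨v, hv, h⟩ := hne
    exact ⟨v, by omega, h⟩

/-- Every pair of states is merged by a word of length at most `d`. -/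
def Synchronizes (f : Fin n × Bool → Fin n) (d : ℕ) : Prop :=
  ∀ x y, ∃ v : List Bool, v.length ≤ d ∧ run f v x = run f v y

lemma pr_not_synchronizes_le (j m k : ℕ) :
    pr (fun f : Fin n × Bool → Fin n =>
      ¬ Synchronizes f (8 * (2 * j + 6) + 3 + j + (m + 1))) ≤
    pr (fun f : Fin n × Bool → Fin n => ¬ Sparse f (8 * (2 * j + 6))) +
      (pr (fun f : Fin n × Bool → Fin n => ¬ FewPreimages f (m + 1) k) +
      (pr (fun f : Fin n × Bool → Fin n => (k : ℝ) ^ 7 ≤ badPairs f (m + 1)) +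
      pr (fun f : Fin n × Bool → Fin n =>
        TestsFail f j (m + 1) (8 * (2 * j + 6) + 3) (testBound n j (m + 1) k)))) := by
  have h : ∀ f : Fin n × Bool → Fin n,
      ¬ Synchronizes f (8 * (2 * j + 6) + 3 + j + (m + 1)) →
      ¬ Sparse f (8 * (2 * j + 6)) ∨ ¬ FewPreimages f (m + 1) k ∨
      (k : ℝ) ^ 7 ≤ badPairs f (m + 1) ∨
      TestsFail f j (m + 1) (8 * (2 * j + 6) + 3) (testBound n j (m + 1) k) := by
    intro f hf
    by_contra hno
    push Not at hno
    exact hf fun x y => exists_merging_word hno.1 hno.2.1 hno.2.2.1.le hno.2.2.2 x y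
  refine (pr_le_add h).trans ?_
  gcongr
  refine (pr_le_add fun _ h => h).trans ?_
  gcongr
  exact pr_le_add fun _ h => h

end Synchronization

/-! ### Asymptotics -/

/-- An integer approximation of the fourth root of `n`. -/
def fourthRoot (n : ℕ) : ℕ := Nat.sqrt (Nat.sqrt n) + 1

lemma le_fourthRoot_pow (n : ℕ) : n ≤ fourthRoot n ^ 4 := by
  have h1 := Nat.lt_succ_sqrt' n
  have h2 := Nat.lt_succ_sqrt' (Nat.sqrt n)
  have h3 : (Nat.sqrt n + 1) ^ 2 ≤ (fourthRoot n ^ 2) ^ 2 := Nat.pow_le_pow_left h2 2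
  rw [← pow_mul] at h3
  exact h1.le.trans h3

lemma fourthRoot_pow_le {n : ℕ} (hn : n ≠ 0) : fourthRoot n ^ 4 ≤ 16 * n := by
  have h1 := Nat.sqrt_le' n
  have h2 := Nat.sqrt_le' (Nat.sqrt n)
  have h3 : 1 ≤ Nat.sqrt n := Nat.sqrt_pos.2 (Nat.pos_of_ne_zero hn)
  have h4 : 1 ≤ Nat.sqrt (Nat.sqrt n) := Nat.sqrt_pos.2 h3
  have h5 : fourthRoot n ^ 2 ≤ 4 * Nat.sqrt n := by
    unfold fourthRoot
    nlinarith
  calc fourthRoot n ^ 4 = (fourthRoot n ^ 2) ^ 2 := by rw [← pow_mul]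
    _ ≤ (4 * Nat.sqrt n) ^ 2 := Nat.pow_le_pow_left h5 2
    _ = 16 * Nat.sqrt n ^ 2 := by ring
    _ ≤ _ := by omega

lemma exists_pr_not_synchronizes_le : ∃ C : ℝ, 0 ≤ C ∧ ∀ n : ℕ, 2 ≤ n →
    pr (fun f : Fin n × Bool → Fin n => ¬ Synchronizes f (221 + 2 * Nat.log 2 n)) ≤
      C * ((Nat.log 2 n : ℝ) ^ 33 / fourthRoot n) := by
  obtain ⟨A, hA0, hA⟩ : ∃ A : ℝ, 0 ≤ A ∧ ∀ n : ℕ, n ≠ 0 →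
      pr (fun f : Fin n × Bool → Fin n => ¬ Sparse f (8 * (2 * 10 + 6))) ≤ A / n :=
    ⟨_, by positivity, fun n hn => have : NeZero n := ⟨hn⟩; pr_not_sparse_le _⟩
  obtain ⟨c, hc⟩ : ∃ c : ℝ, c = ((shortWords (8 * (2 * 10 + 6) + 3)).card : ℝ) := ⟨_, rfl⟩
  have hc0 : 0 ≤ c := by rw [hc]; positivity
  refine ⟨A * 16 + (3 * 153 ^ 16 * 16 + (4 * 7 ^ 4 + c * (161 ^ 10 * 16 ^ 18))), by positivity,
    fun n hn => ?_⟩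
  have hn0 : n ≠ 0 := by omega
  have : NeZero n := ⟨hn0⟩
  have hnpos : (0 : ℝ) < n := by exact_mod_cast Nat.pos_of_ne_zero hn0
  have h2t : 2 ^ Nat.log 2 n ≤ n := Nat.pow_log_le_self 2 hn0
  have h2t' : n < 2 ^ (Nat.log 2 n + 1) := Nat.lt_pow_succ_log_self (by norm_num) n
  have ht1 : 1 ≤ Nat.log 2 n := Nat.log_pos (by norm_num) hn
  generalize Nat.log 2 n = t at *
  have hk1 := le_fourthRoot_pow n
  have hk2 := fourthRoot_pow_le hn0
  have hk0 : 1 ≤ fourthRoot n := by unfold fourthRoot; omega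
  generalize fourthRoot n = k at *
  obtain ⟨m, hm⟩ : ∃ m, 2 * t = m + 1 := ⟨2 * t - 1, by omega⟩
  have hkr1 : (n : ℝ) ≤ (k : ℝ) ^ 4 := by exact_mod_cast hk1
  have hkr2 : (k : ℝ) ^ 4 ≤ 16 * n := by exact_mod_cast hk2
  have hkr0 : (1 : ℝ) ≤ k := by exact_mod_cast hk0
  have htr : (1 : ℝ) ≤ t := by exact_mod_cast ht1
  have hmr : (m : ℝ) + 1 = 2 * t := by exact_mod_cast hm.symm
  have hkpos : (0 : ℝ) < k := by linarith
  have hinv : 1 / (n : ℝ) ≤ 16 / k := by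
    rw [div_le_div_iff₀ hnpos hkpos]
    have : (k : ℝ) ≤ (k : ℝ) ^ 4 := le_self_pow₀ hkr0 (by norm_num)
    linarith
  have hpow : ∀ i ≤ 33, (t : ℝ) ^ i ≤ (t : ℝ) ^ 33 := fun i hi => pow_le_pow_right₀ htr hi
  have key := pr_not_synchronizes_le (n := n) 10 m k
  rw [← hm] at key
  norm_num only at key
  refine key.trans ?_
  rw [add_mul, add_mul, add_mul]
  refine add_le_add ?_ (add_le_add ?_ (add_le_add ?_ ?_))
  · refine (hA n hn0).trans ?_
    calc A / n = A * (1 / n) := by ring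
      _ ≤ A * (16 / k) := by gcongr
      _ = A * 16 * (1 / k) := by ring
      _ ≤ _ := by
        gcongr
        exact one_le_pow₀ htr
  · refine (pr_not_fewPreimages_le (l := 2 * t) (k := k) ?_ hk1).trans ?_
    · rw [mul_comm, pow_mul]
      exact Nat.pow_le_pow_left h2t 2
    · have h1 : (((16 * (2 * t + 1) + 1) * (2 * t + 1) : ℕ) : ℝ) ≤ 153 * (t : ℝ) ^ 2 := by
        push_cast
        nlinarith
      have h2 : ((2 * t : ℕ) : ℝ) + 1 ≤ 3 * t := by push_cast; linarith
      calc _ ≤ 3 * (t : ℝ) * (153 * (t : ℝ) ^ 2) ^ 16 / n := by gcongr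
        _ = 3 * 153 ^ 16 * (t : ℝ) ^ 33 * (1 / n) := by ring
        _ ≤ 3 * 153 ^ 16 * (t : ℝ) ^ 33 * (16 / k) := by gcongr
        _ = _ := by ring
  · have h0 : (n : ℝ) ^ 2 ≤ 4 * 2 ^ (m + 1) := by
      rw [← hm]
      have : n ^ 2 ≤ (2 ^ (t + 1)) ^ 2 := Nat.pow_le_pow_left h2t'.le 2
      have h' : (2 ^ (t + 1)) ^ 2 = 4 * 2 ^ (2 * t) := by ring
      rw [h'] at this
      exact_mod_cast this
    have h1 := pr_badPairs_le (n := n) m h0 ((k : ℝ) ^ 7)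
    rw [← hm] at h1
    have h2 : ((2 * m + 5 : ℕ) : ℝ) ≤ 7 * t := by push_cast; linarith
    have h3 : pr (fun f : Fin n × Bool → Fin n => (k : ℝ) ^ 7 ≤ badPairs f (2 * t)) ≤
        (k : ℝ) ^ 4 * (4 * (7 * t) ^ 4) / k ^ 7 := by
      rw [le_div_iff₀ (by positivity), mul_comm]
      refine h1.trans ?_
      gcongr
    refine h3.trans ?_
    calc (k : ℝ) ^ 4 * (4 * (7 * t) ^ 4) / k ^ 7 = 4 * 7 ^ 4 * ((t : ℝ) ^ 4 / k ^ 3) := by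
          field_simp
      _ ≤ _ := by
        gcongr 4 * 7 ^ 4 * (?_ / ?_)
        · exact hpow 4 (by norm_num)
        · exact le_self_pow₀ hkr0 (by norm_num)
  · have hD : testBound n 10 (2 * t) k ≤ 161 * (t * (k : ℝ) ^ 7) := by
      unfold testBound
      push_cast
      have h1 : (n : ℝ) * (t * (k : ℝ) ^ 2) ≤ (k : ℝ) ^ 4 * (t * (k : ℝ) ^ 3) := by
        gcongr
        norm_num
      have h2 : (k : ℝ) ^ 7 ≤ t * (k : ℝ) ^ 7 := le_mul_of_one_le_left (by positivity) htr
      have h3 : (k : ℝ) ^ 4 * (t * (k : ℝ) ^ 3) = t * k ^ 7 := by ring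
      linarith
    have hD0 : 0 ≤ testBound n 10 (2 * t) k := by unfold testBound; positivity
    have h1 := pr_testsFail_le (n := n) 10 (2 * t) (8 * (2 * 10 + 6) + 3) hD0
    norm_num only at h1 hc
    rw [← hc] at h1
    refine h1.trans ?_
    have h4 : (k : ℝ) ^ 72 ≤ 16 ^ 18 * (n : ℝ) ^ 18 := by
      have := pow_le_pow_left₀ (by positivity) hkr2 18
      rwa [← pow_mul, mul_pow] at this
    have h5 : 1 / (n : ℝ) ^ 18 ≤ 16 ^ 18 / k ^ 72 := by
      rw [div_le_div_iff₀ (by positivity) (by positivity)]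
      linarith
    calc _ = c * testBound n 10 (2 * t) k ^ 10 * (1 / (n : ℝ) ^ 18) := by
          field_simp
      _ ≤ c * (161 * (t * (k : ℝ) ^ 7)) ^ 10 * (16 ^ 18 / k ^ 72) := by gcongr
      _ = c * (161 ^ 10 * 16 ^ 18) * ((t : ℝ) ^ 10 / k ^ 2) := by
          field_simp
      _ ≤ _ := by
        gcongr _ * (?_ / ?_)
        · exact hpow 10 (by norm_num)
        · exact le_self_pow₀ hkr0 (by norm_num)

lemma tendsto_natLog : Filter.Tendsto (Nat.log 2) Filter.atTop Filter.atTop :=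
  Filter.tendsto_atTop.2 fun b => by
    filter_upwards [Filter.eventually_ge_atTop (2 ^ b)] with n hn
    exact (Nat.le_log_iff_pow_le (by norm_num)
      ((Nat.pow_pos (by norm_num)).trans_le hn).ne').2 hn

lemma tendsto_log_pow_div_fourthRoot :
    Filter.Tendsto (fun n : ℕ => (Nat.log 2 n : ℝ) ^ 33 / fourthRoot n) Filter.atTop (nhds 0) := by
  set r : ℝ := √√(1 / 2) with hr
  have hr0 : 0 ≤ r := by positivity
  have hr4 : r ^ 4 = 1 / 2 := by
    rw [show (4 : ℕ) = 2 * 2 from rfl, pow_mul, hr, Real.sq_sqrt (by positivity),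
      Real.sq_sqrt (by positivity)]
  have hr1 : r < 1 := by
    by_contra h
    have := one_le_pow₀ (not_lt.1 h) (n := 4)
    rw [hr4] at this
    norm_num at this
  have h := (tendsto_pow_const_mul_const_pow_of_abs_lt_one 33
    (show |r| < 1 by rwa [abs_of_nonneg hr0])).comp tendsto_natLog
  refine squeeze_zero' (Filter.Eventually.of_forall fun n => by positivity) ?_ h
  filter_upwards [Filter.eventually_ge_atTop 1] with n hn
  simp only [Function.comp_apply]
  rw [div_eq_mul_inv]
  gcongr
  have hk : (0 : ℝ) < fourthRoot n := by unfold fourthRoot; positivity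
  rw [← pow_le_pow_iff_left₀ (by positivity) (by positivity) (four_ne_zero)]
  rw [← pow_mul, mul_comm, pow_mul, hr4, inv_pow, one_div, inv_pow]
  gcongr
  exact_mod_cast (Nat.pow_log_le_self 2 (by omega)).trans (le_fourthRoot_pow n)

/-- For a uniformly random transition function
`δ : Fin n × {a,b} → Fin n`, with probability tending to `1` as `n → ∞`,
every pair of states `x, y` admits a word `ω` of length at most `3·log₂ n`
with `δ_ω(x) = δ_ω(y)`. -/
theorem pairs_synchronizable_whp :
    Filter.Tendsto
      (fun n : ℕ =>
        ((Finset.univ.filter (fun δ : Fin n × Bool → Fin n =>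
            ∀ x y : Fin n, ∃ ω : List Bool,
              (ω.length : ℝ) ≤ 3 * Real.logb 2 n ∧
                run δ ω x = run δ ω y)).card : ℝ)
          / (n : ℝ) ^ (2 * n))
      Filter.atTop (nhds 1) := by
  obtain ⟨C, -, hC⟩ := exists_pr_not_synchronizes_le
  have hlim : Filter.Tendsto (fun n : ℕ => 1 - C * ((Nat.log 2 n : ℝ) ^ 33 / fourthRoot n))
      Filter.atTop (nhds 1) := by
    simpa using (tendsto_log_pow_div_fourthRoot.const_mul C).const_sub 1
  have hpr : ∀ n : ℕ, ((Finset.univ.filter (fun δ : Fin n × Bool → Fin n =>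
      ∀ x y : Fin n, ∃ ω : List Bool, (ω.length : ℝ) ≤ 3 * Real.logb 2 n ∧
        run δ ω x = run δ ω y)).card : ℝ) / (n : ℝ) ^ (2 * n) =
      pr (fun δ : Fin n × Bool → Fin n => ∀ x y : Fin n, ∃ ω : List Bool,
        (ω.length : ℝ) ≤ 3 * Real.logb 2 n ∧ run δ ω x = run δ ω y) := by
    intro n
    rw [pr_eq, Fintype.card_fun, Fintype.card_prod, Fintype.card_fin, Fintype.card_bool,
      mul_comm n 2]
    push_cast
    congr!
  simp only [hpr]
  refine tendsto_of_tendsto_of_tendsto_of_le_of_le' hlim tendsto_const_nhds ?_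
    (Filter.Eventually.of_forall fun n => pr_le_one _)
  filter_upwards [Filter.eventually_ge_atTop 2,
    tendsto_natLog.eventually_ge_atTop 221] with n hn ht
  have : NeZero n := ⟨by omega⟩
  have h1 := hC n hn
  have h2 := pr_compl_add fun f : Fin n × Bool → Fin n =>
    Synchronizes f (221 + 2 * Nat.log 2 n)
  refine le_trans (sub_le_iff_le_add.2 (h2.symm.le.trans (by gcongr)))
    (pr_mono fun f hf x y => ?_)
  obtain ⟨v, hv, h⟩ := hf x y
  refine ⟨v, ?_, h⟩
  have h3 : (v.length : ℝ) ≤ 3 * (Nat.log 2 n : ℝ) := by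
    exact_mod_cast hv.trans (by omega)
  have h4 : (Nat.log 2 n : ℝ) ≤ Real.logb 2 n := by
    exact_mod_cast Real.natLog_le_logb n 2
  linarith
end
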